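/- arXiv:1807.05820 — 2 statements merged into one kernel-verified Lean document; each statement's English description precedes it below -/
import Mathlib

section
/- For every ε > 0 there exists a constant C > 0 such that for all real H ≥ 2 one has N_{A₄}(H) ≤ C·H^{5/2 + 1/√6 + ε}. -/
open Polynomial in
/-- The number of monic, irreducible quartic polynomials with integer coefficients
bounded by `H` in absolute value whose Galois group is isomorphic to `G`. -/
noncomputable def quarticGalCount (G : Type*) [Group G] (H : ℝ) : ℕ :=
  Set.ncard {p : ℤ × ℤ × ℤ × ℤ |
    |(p.1 : ℝ)| ≤ H ∧ |(p.2.1 : ℝ)| ≤ H ∧ |(p.2.2.1 : ℝ)| ≤ H ∧ |(p.2.2.2 : ℝ)| ≤ H ∧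
    Irreducible (X ^ 4 + C (p.1 : ℚ) * X ^ 3 + C (p.2.1 : ℚ) * X ^ 2 + C (p.2.2.1 : ℚ) * X
        + C (p.2.2.2 : ℚ)) ∧
    Nonempty
      ((X ^ 4 + C (p.1 : ℚ) * X ^ 3 + C (p.2.1 : ℚ) * X ^ 2 + C (p.2.2.1 : ℚ) * X
          + C (p.2.2.2 : ℚ)).Gal ≃* G)}

/-- Every finite set of elements satisfying `P` has at most `K` elements. -/
def CardBound {α : Type*} (P : α → Prop) (K : ℝ) : Prop :=
  ∀ S : Finset α, (∀ x ∈ S, P x) → (S.card : ℝ) ≤ K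

namespace CardBound

variable {α : Type*} {P Q : α → Prop} {K L : ℝ}

theorem nonneg (hP : CardBound P K) : 0 ≤ K := by
  simpa using hP ∅ (by simp)

theorem mono (hP : CardBound P K) (hKL : K ≤ L) : CardBound P L :=
  fun S hS => (hP S hS).trans hKL

theorem imp (hP : CardBound P K) (h : ∀ x, Q x → P x) : CardBound Q K :=
  fun S hS => hP S fun x hx => h x (hS x hx)

theorem of_subsingleton (h : ∀ x y, P x → P y → x = y) : CardBound P 1 := by
  intro S hS
  exact_mod_cast Finset.card_le_one.2 fun x hx y hy => h x y (hS x hx) (hS y hy)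

theorem of_false (h : ∀ x, ¬ P x) (hK : 0 ≤ K) : CardBound P K := by
  intro S hS
  have : S = ∅ := Finset.eq_empty_of_forall_notMem fun x hx => h x (hS x hx)
  simpa [this] using hK

theorem comap {β : Type*} {Q : β → Prop} (hP : CardBound P K) (e : β → α)
    (he : ∀ x y, Q x → Q y → e x = e y → x = y) (h : ∀ x, Q x → P (e x)) : CardBound Q K := by
  classical
  intro S hS
  have hinj : Set.InjOn e S := fun x hx y hy hxy => he x y (hS x hx) (hS y hy) hxy
  rw [← Finset.card_image_of_injOn hinj]
  refine hP _ fun y hy => ?_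
  obtain ⟨x, hx, rfl⟩ := Finset.mem_image.1 hy
  exact h x (hS x hx)

theorem cases (Q : α → Prop) (h₁ : CardBound (fun x => P x ∧ Q x) K)
    (h₂ : CardBound (fun x => P x ∧ ¬ Q x) L) : CardBound P (K + L) := by
  classical
  intro S hS
  rw [← Finset.card_filter_add_card_filter_not (s := S) Q]
  push_cast
  refine add_le_add (h₁ _ fun x hx => ?_) (h₂ _ fun x hx => ?_)
  · exact ⟨hS x (Finset.mem_filter.1 hx).1, (Finset.mem_filter.1 hx).2⟩
  · exact ⟨hS x (Finset.mem_filter.1 hx).1, (Finset.mem_filter.1 hx).2⟩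

theorem fiber {β : Type*} (g : α → β) (T : Finset β) (f : β → ℝ) (hg : ∀ x, P x → g x ∈ T)
    (hf : ∀ t ∈ T, CardBound (fun x => P x ∧ g x = t) (f t)) : CardBound P (∑ t ∈ T, f t) := by
  classical
  intro S hS
  rw [Finset.card_eq_sum_card_fiberwise (f := g) (t := T) fun x hx => hg x (hS x hx)]
  push_cast
  refine Finset.sum_le_sum fun t ht => hf t ht _ fun x hx => ?_
  exact ⟨hS x (Finset.mem_filter.1 hx).1, (Finset.mem_filter.1 hx).2⟩

theorem fiber_const {β : Type*} (g : α → β) (T : Finset β) (hg : ∀ x, P x → g x ∈ T)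
    (hf : ∀ t ∈ T, CardBound (fun x => P x ∧ g x = t) K) : CardBound P (T.card * K) := by
  simpa using fiber g T (fun _ => K) hg hf

/-- A coordinate ranging over `[-R, R]`. -/
theorem box (g : α → ℤ) (R : ℤ) (hR : 1 ≤ R) (hg : ∀ x, P x → |g x| ≤ R)
    (hf : ∀ t, |t| ≤ R → CardBound (fun x => P x ∧ g x = t) K) : CardBound P (3 * R * K) := by
  have h0 : 0 ≤ K := (hf 0 (by simpa using by omega)).nonneg
  refine (fiber_const g (Finset.Icc (-R) R) (fun x hx => ?_) fun t ht => hf t ?_).mono ?_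
  · simpa [abs_le] using hg x hx
  · simpa [abs_le] using ht
  · refine mul_le_mul_of_nonneg_right ?_ h0
    rw [Int.card_Icc]
    have : (((R + 1 - -R).toNat : ℤ) : ℝ) ≤ ((3 * R : ℤ) : ℝ) := by
      exact_mod_cast by omega
    exact_mod_cast this

/-- A coordinate confined to an interval of length `A / |w|`. -/
theorem interval (g : α → ℤ) (w A : ℤ) (hw : w ≠ 0) (hA : 0 ≤ A)
    (hg : ∀ x y, P x → P y → |w| * |g x - g y| ≤ A)
    (hf : ∀ t, CardBound (fun x => P x ∧ g x = t) K) : CardBound P ((A / |(w : ℝ)| + 1) * K) := by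
  classical
  intro S hS
  have h0 : 0 ≤ K := (hf 0).nonneg
  have hA' : (0 : ℝ) ≤ A := by exact_mod_cast hA
  have hw' : 0 < |w| := abs_pos.2 hw
  rcases S.eq_empty_or_nonempty with rfl | hne
  · simp only [Finset.card_empty, Nat.cast_zero]
    positivity
  · obtain ⟨m, hm, hmin⟩ := S.exists_min_image g hne
    have key : CardBound (fun x => x ∈ S) ((Finset.Icc (g m) (g m + A / |w|)).card * K) := by
      refine fiber_const g _ (fun x hx => ?_) fun t _ => (hf t).imp fun x hx => ⟨hS x hx.1, hx.2⟩
      have h1 := hg x m (hS x hx) (hS m hm)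
      have h2 := hmin x hx
      rw [Finset.mem_Icc]
      refine ⟨h2, ?_⟩
      have : g x - g m ≤ A / |w| := by
        rw [Int.le_ediv_iff_mul_le hw', mul_comm]
        exact (mul_le_mul_of_nonneg_left (le_abs_self _) hw'.le).trans h1
      linarith
    refine (key S fun x hx => hx).trans (mul_le_mul_of_nonneg_right ?_ h0)
    rw [Int.card_Icc]
    have h3 : 0 ≤ A / |w| := Int.ediv_nonneg hA hw'.le
    have h4 : (((g m + A / |w| + 1 - g m).toNat : ℤ) : ℝ) = ((A / |w| : ℤ) : ℝ) + 1 := by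
      rw [Int.toNat_of_nonneg (by omega)]
      push_cast
      ring
    have h5 : ((A / |w| : ℤ) : ℝ) ≤ A / |(w : ℝ)| := by
      rw [le_div_iff₀ (by positivity)]
      exact_mod_cast Int.ediv_mul_le A hw'.ne'
    have h6 : (((g m + A / |w| + 1 - g m).toNat : ℕ) : ℝ) = ((A / |w| : ℤ) : ℝ) + 1 := by
      exact_mod_cast h4
    linarith

/-- A coordinate confined to an interval of length `A`. -/
theorem interval_one (g : α → ℤ) (A : ℤ) (hA : 1 ≤ A)
    (hg : ∀ x y, P x → P y → |g x - g y| ≤ A)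
    (hf : ∀ t, CardBound (fun x => P x ∧ g x = t) K) : CardBound P (2 * A * K) := by
  refine (interval g 1 A one_ne_zero (by omega) (by simpa using hg) hf).mono ?_
  have h0 : 0 ≤ K := (hf 0).nonneg
  have hA' : (1 : ℝ) ≤ A := by exact_mod_cast hA
  refine mul_le_mul_of_nonneg_right ?_ h0
  simp
  linarith

/-- A coordinate ranging over the divisors of a nonzero integer. -/
theorem divisor (g : α → ℤ) (m : ℤ) (hm : m ≠ 0) {D : ℝ} (hD : (m.natAbs.divisors.card : ℝ) ≤ D)
    (hg : ∀ x, P x → g x ∣ m)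
    (hf : ∀ t, t ∣ m → CardBound (fun x => P x ∧ g x = t) K) : CardBound P (2 * D * K) := by
  classical
  have h0 : 0 ≤ K := (hf 1 (one_dvd _)).nonneg
  let T : Finset ℤ := m.natAbs.divisors.image (fun n : ℕ => (n : ℤ)) ∪
    m.natAbs.divisors.image (fun n : ℕ => -(n : ℤ))
  have hT : ∀ t, t ∣ m → t ∈ T := by
    intro t ht
    have h1 : t.natAbs ∈ m.natAbs.divisors :=
      Nat.mem_divisors.2 ⟨Int.natAbs_dvd_natAbs.2 ht, Int.natAbs_ne_zero.2 hm⟩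
    rcases Int.natAbs_eq t with h | h
    · exact Finset.mem_union_left _ (Finset.mem_image.2 ⟨_, h1, h.symm⟩)
    · exact Finset.mem_union_right _ (Finset.mem_image.2 ⟨_, h1, h.symm⟩)
  have hT' : ∀ t ∈ T, t ∣ m := by
    intro t ht
    rcases Finset.mem_union.1 ht with h | h <;> obtain ⟨n, hn, rfl⟩ := Finset.mem_image.1 h
    · exact Int.natCast_dvd.2 (Nat.dvd_of_mem_divisors hn)
    · exact Int.neg_dvd.2 (Int.natCast_dvd.2 (Nat.dvd_of_mem_divisors hn))
  refine (fiber_const g T (fun x hx => hT _ (hg x hx)) fun t ht => hf t (hT' t ht)).mono ?_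
  refine mul_le_mul_of_nonneg_right ?_ h0
  have h2 : T.card ≤ m.natAbs.divisors.card + m.natAbs.divisors.card :=
    (Finset.card_union_le _ _).trans (add_le_add Finset.card_image_le Finset.card_image_le)
  have h3 : (T.card : ℝ) ≤ m.natAbs.divisors.card + m.natAbs.divisors.card := by exact_mod_cast h2
  linarith

/-- A nonzero coordinate `t`, with fibres of size at most `A / |t| + B`. -/
theorem weighted (g : α → ℤ) (R : ℤ) (hR : 0 ≤ R) {A B D : ℝ} (hA : 0 ≤ A)
    (hD : ∑ w ∈ Finset.Icc 1 R.toNat, (1 : ℝ) / w ≤ D)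
    (hg : ∀ x, P x → g x ≠ 0 ∧ |g x| ≤ R)
    (hf : ∀ t, t ≠ 0 → |t| ≤ R → CardBound (fun x => P x ∧ g x = t) (A / |(t : ℝ)| + B)) :
    CardBound P (2 * (A * D + B * R)) := by
  classical
  have hpos : ∀ (σ : ℤ), |σ| = 1 → CardBound (fun x => P x ∧ 0 < σ * g x) (A * D + B * R) := by
    intro σ hσ
    have hσ2 : σ * σ = 1 := by rw [← abs_mul_abs_self, hσ, one_mul]
    have hR' : ((R.toNat : ℤ) : ℝ) = R := by rw [Int.toNat_of_nonneg hR]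
    refine (fiber (fun x => (σ * g x).toNat) (Finset.Icc 1 R.toNat) (fun n => A / n + B)
      (fun x hx => ?_) fun t ht => ?_).mono ?_
    · have h1 : |σ * g x| ≤ R := by rw [abs_mul, hσ, one_mul]; exact (hg x hx.1).2
      have h2 := (abs_le.1 h1).2
      have h3 := hx.2
      rw [Finset.mem_Icc]
      omega
    · rw [Finset.mem_Icc] at ht
      have h1 : |σ * (t : ℤ)| = t := by rw [abs_mul, hσ, one_mul, abs_of_nonneg (by omega)]
      have h2 := hf (σ * t) (abs_pos.1 (by rw [h1]; omega)) (by rw [h1]; omega)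
      have h3 : |((σ * t : ℤ) : ℝ)| = t := by
        rw [← Int.cast_abs, h1]; simp
      rw [h3] at h2
      refine h2.imp fun x hx => ⟨hx.1.1, ?_⟩
      have h4 : σ * g x = t := by
        have h5 := hx.1.2
        have h6 : (σ * g x).toNat = t := hx.2
        omega
      rw [← h4, ← mul_assoc, hσ2, one_mul]
    · rw [Finset.sum_add_distrib]
      simp only [Finset.sum_const, Nat.card_Icc, Nat.add_sub_cancel, nsmul_eq_mul]
      have h1 : ∑ n ∈ Finset.Icc 1 R.toNat, A / (n : ℝ) ≤ A * D := by
        refine le_trans (le_of_eq ?_) (mul_le_mul_of_nonneg_left hD hA)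
        rw [Finset.mul_sum]
        exact Finset.sum_congr rfl fun n _ => by ring
      have h2 : ((R.toNat : ℕ) : ℝ) = R := by exact_mod_cast hR'
      rw [h2, mul_comm (R : ℝ)]
      linarith
  refine ((((hpos 1 (by simp)).imp fun x hx => ?_).cases (P := P) (fun x => 0 < g x)
    ((hpos (-1) (by simp)).imp fun x hx => ?_))).mono (by linarith)
  · exact ⟨hx.1, by simpa using hx.2⟩
  · have := (hg x hx.1).1
    exact ⟨hx.1, by have := hx.2; omega⟩

end CardBound

/-- `D` bounds the number of divisors, and the harmonic sums, of all positive integers up to `M`. -/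
def DivisorBound (M : ℤ) (D : ℝ) : Prop :=
  1 ≤ D ∧ ∀ n : ℕ, 0 < n → (n : ℤ) ≤ M →
    (n.divisors.card : ℝ) ≤ D ∧ ∑ w ∈ Finset.Icc 1 n, (1 : ℝ) / w ≤ D

namespace DivisorBound

variable {M : ℤ} {D : ℝ}

theorem one_le (hD : DivisorBound M D) : 1 ≤ D := hD.1

theorem divisors (hD : DivisorBound M D) {m : ℤ} (hm : m ≠ 0) (hM : |m| ≤ M) :
    (m.natAbs.divisors.card : ℝ) ≤ D :=
  (hD.2 m.natAbs (Int.natAbs_pos.2 hm) (by rwa [Int.natCast_natAbs])).1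

theorem harmonic (hD : DivisorBound M D) {R : ℤ} (hM : R ≤ M) :
    ∑ w ∈ Finset.Icc 1 R.toNat, (1 : ℝ) / w ≤ D := by
  rcases Nat.eq_zero_or_pos R.toNat with h | h
  · rw [h]
    simpa using zero_le_one.trans hD.1
  · exact (hD.2 _ h (by omega)).2

end DivisorBound

/-- Differences of pairs of quartics with equal invariants. -/
@[ext]
structure DiffVec where
  (X Y s v β a c : ℤ)

/-- The constraints satisfied by a difference vector at scale `h`. -/
structure IsDiff (h : ℤ) (ω : DiffVec) : Prop where
  X_le : |ω.X| ≤ 2 * h ^ 5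
  Y_le : |ω.Y| ≤ 2 * h ^ 5
  vs_ne : ω.v * ω.s ≠ 0
  k_le : |ω.v * ω.s + 3 * ω.X * ω.Y| ≤ 16 * h ^ 5
  β_le : |ω.β| ≤ h
  s_dvd : ω.s ∣ 27 * ω.a
  v_dvd : ω.v ∣ 27 * ω.c
  a_le : |ω.a + 2 * ω.Y * ω.β| ≤ 32 * h ^ 5
  c_le : |ω.c + 2 * ω.X * ω.β| ≤ 32 * h ^ 5
  d_le : |3 * ω.X * ω.a + 3 * ω.Y * ω.c + 6 * ω.X * ω.Y * ω.β - 2 * (ω.v * ω.s) * ω.β|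
    ≤ 768 * h ^ 5

/-- The symmetry exchanging the roles of the two halves of a difference vector. -/
def DiffVec.swap (ω : DiffVec) : DiffVec := ⟨ω.Y, ω.X, ω.v, ω.s, ω.β, ω.c, ω.a⟩

theorem DiffVec.swap_swap (ω : DiffVec) : ω.swap.swap = ω := rfl

theorem IsDiff.swap {h : ℤ} {ω : DiffVec} (hω : IsDiff h ω) : IsDiff h ω.swap where
  X_le := hω.Y_le
  Y_le := hω.X_le
  vs_ne := by simpa [DiffVec.swap, mul_comm] using hω.vs_ne
  k_le := by
    have := hω.k_le
    rwa [show ω.v * ω.s + 3 * ω.X * ω.Y = ω.s * ω.v + 3 * ω.Y * ω.X by ring] at this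
  β_le := hω.β_le
  s_dvd := hω.v_dvd
  v_dvd := hω.s_dvd
  a_le := hω.c_le
  c_le := hω.a_le
  d_le := by
    have := hω.d_le
    rwa [show 3 * ω.X * ω.a + 3 * ω.Y * ω.c + 6 * ω.X * ω.Y * ω.β - 2 * (ω.v * ω.s) * ω.β =
      3 * ω.Y * ω.c + 3 * ω.X * ω.a + 6 * ω.Y * ω.X * ω.β - 2 * (ω.s * ω.v) * ω.β by ring] at this

theorem CardBound.swap {P Q : DiffVec → Prop} {K : ℝ} (hP : CardBound P K)
    (h : ∀ ω, Q ω → P ω.swap) : CardBound Q K :=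
  hP.comap DiffVec.swap
    (fun x y _ _ hxy => by rw [← x.swap_swap, hxy, y.swap_swap]) h

section DiffBounds

variable {h : ℤ} {D : ℝ} {P : DiffVec → Prop}

theorem pow_le_bound (hh : 1 ≤ h) {C : ℤ} {k : ℕ} (hC : C ≤ 10 ^ 9) (hk : k ≤ 40) :
    C * h ^ k ≤ 10 ^ 9 * h ^ 40 :=
  mul_le_mul hC (pow_le_pow_right₀ hh hk) (by positivity) (by positivity)

theorem vs_le (hh : 1 ≤ h) {ω : DiffVec} (hω : IsDiff h ω) : |ω.v * ω.s| ≤ 28 * h ^ 10 := by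
  have h1 : |3 * ω.X * ω.Y| ≤ 12 * h ^ 10 := by
    have := mul_le_mul hω.X_le hω.Y_le (abs_nonneg _) (by positivity)
    rw [abs_mul, abs_mul, abs_of_nonneg (by norm_num : (0 : ℤ) ≤ 3)]
    nlinarith
  have h2 : h ^ 5 ≤ h ^ 10 := pow_le_pow_right₀ hh (by norm_num)
  have h3 : ω.v * ω.s = (ω.v * ω.s + 3 * ω.X * ω.Y) - 3 * ω.X * ω.Y := by ring
  rw [h3]
  have := abs_sub (ω.v * ω.s + 3 * ω.X * ω.Y) (3 * ω.X * ω.Y)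
  have := hω.k_le
  linarith

theorem s_dvd_tail (hh : 1 ≤ h) (hD : DivisorBound (10 ^ 9 * h ^ 40) D) (x y m b a c : ℤ)
    (hP : ∀ ω, P ω → IsDiff h ω ∧ ω.X = x ∧ ω.Y = y ∧ ω.v * ω.s = m ∧ ω.β = b ∧ ω.a = a ∧ ω.c = c) :
    CardBound P (2 * D * 1) := by
  have hD1 := hD.one_le
  by_cases hex : ∃ ω, P ω
  · obtain ⟨ω, hω⟩ := hex
    obtain ⟨h1, -, -, rfl, -, -, -⟩ := hP ω hω
    refine CardBound.divisor (fun ω => ω.s) (ω.v * ω.s) h1.vs_ne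
      (hD.divisors h1.vs_ne ((vs_le hh h1).trans
        (pow_le_bound hh (by norm_num) (by norm_num)))) (fun ω' hω' => ?_)
        fun t _ => CardBound.of_subsingleton fun ω₁ ω₂ h₁ h₂ => ?_
    · rw [← (hP ω' hω').2.2.2.1]
      exact dvd_mul_left _ _
    · obtain ⟨d₁, x₁, y₁, m₁, b₁, a₁, c₁⟩ := hP _ h₁.1
      obtain ⟨d₂, x₂, y₂, m₂, b₂, a₂, c₂⟩ := hP _ h₂.1
      have hs : ω₁.s = ω₂.s := h₁.2.trans h₂.2.symm
      have hs0 : ω₁.s ≠ 0 := right_ne_zero_of_mul d₁.vs_ne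
      have hv : ω₁.v = ω₂.v := by
        rw [← m₂, ← hs] at m₁
        exact mul_right_cancel₀ hs0 m₁
      ext <;> simp_all
  · push Not at hex
    exact CardBound.of_false hex (by linarith)

theorem vs_tail (hh : 1 ≤ h) (hD : DivisorBound (10 ^ 9 * h ^ 40) D) (x y b a c : ℤ)
    (hP : ∀ ω, P ω → IsDiff h ω ∧ ω.X = x ∧ ω.Y = y ∧ ω.β = b ∧ ω.a = a ∧ ω.c = c) :
    CardBound P (2 * (32 * h ^ 5 : ℤ) * (2 * D * 1)) := by
  have hh5 : 1 ≤ h ^ 5 := one_le_pow₀ hh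
  refine CardBound.interval_one (fun ω => ω.v * ω.s) (32 * h ^ 5) (by omega)
    (fun ω₁ ω₂ h₁ h₂ => ?_) fun t => s_dvd_tail hh hD x y t b a c fun ω hω => ?_
  · obtain ⟨d₁, x₁, y₁, -⟩ := hP _ h₁
    obtain ⟨d₂, x₂, y₂, -⟩ := hP _ h₂
    have k₁ := abs_le.1 d₁.k_le
    have k₂ := abs_le.1 d₂.k_le
    rw [x₁, y₁] at k₁
    rw [x₂, y₂] at k₂
    rw [abs_le]
    constructor <;> linarith
  · obtain ⟨h1, h2, h3, h4⟩ := hP _ hω.1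
    exact ⟨h1, h2, h3, hω.2, h4⟩

theorem card_diff_zero (hh : 1 ≤ h) (hD : DivisorBound (10 ^ 9 * h ^ 40) D) :
    CardBound (fun ω => IsDiff h ω ∧ ω.c = 0 ∧ ω.β = 0 ∧ ω.a = 0) (10 ^ 7 * D ^ 2 * h ^ 15) := by
  have hh5 : 1 ≤ h ^ 5 := one_le_pow₀ hh
  have hD1 := hD.one_le
  have hhR : (1 : ℝ) ≤ h := by exact_mod_cast hh
  refine (CardBound.box (fun ω => ω.X) (2 * h ^ 5) (by omega) (fun ω hω => hω.1.X_le) fun x _ =>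
    CardBound.box (fun ω => ω.Y) (2 * h ^ 5) (by omega) (fun ω hω => hω.1.1.Y_le) fun y _ =>
    vs_tail hh hD x y 0 0 0 ?_).mono ?_
  · rintro ω ⟨⟨⟨h1, h2, h3, h4⟩, h5⟩, h6⟩
    exact ⟨h1, h5, h6, h3, h4, h2⟩
  · push_cast
    obtain ⟨d, hd0, rfl⟩ : ∃ d : ℝ, 0 ≤ d ∧ D = 1 + d := ⟨D - 1, by linarith, by ring⟩
    rw [← sub_nonneg]
    ring_nf
    positivity

theorem card_diff_c_zero_β_zero (hh : 1 ≤ h) (hD : DivisorBound (10 ^ 9 * h ^ 40) D) :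
    CardBound (fun ω => IsDiff h ω ∧ ω.c = 0 ∧ ω.β = 0 ∧ ω.a ≠ 0) (10 ^ 7 * D ^ 2 * h ^ 15) := by
  have hh5 : 1 ≤ h ^ 5 := one_le_pow₀ hh
  have hD1 := hD.one_le
  have hhR : (1 : ℝ) ≤ h := by exact_mod_cast hh
  refine (CardBound.weighted (fun ω => ω.a) (32 * h ^ 5) (by omega)
    (A := 512 * h ^ 5 * (3 * (2 * h ^ 5) * (2 * (32 * h ^ 5) * (2 * D * 1))))
    (B := 3 * (2 * h ^ 5) * (2 * (32 * h ^ 5) * (2 * D * 1))) (by positivity)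
    (hD.harmonic (pow_le_bound hh (by norm_num) (by norm_num))) ?_ ?_).mono ?_
  · rintro ω ⟨h1, h2, h3, h4⟩
    refine ⟨h4, ?_⟩
    have := h1.a_le
    simpa [h3] using this
  · intro a ha _
    refine (CardBound.interval (fun ω => ω.X) a (512 * h ^ 5) ha (by omega) ?_ fun x =>
      CardBound.box (fun ω => ω.Y) (2 * h ^ 5) (by omega) ?_ fun y _ =>
      vs_tail hh hD x y 0 a 0 ?_).mono (le_of_eq ?_)
    · rintro ω₁ ω₂ ⟨⟨h1, h2, h3, -⟩, rfl⟩ ⟨⟨h1', h2', h3', -⟩, h4⟩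
      have e := abs_le.1 h1.d_le
      have e' := abs_le.1 h1'.d_le
      simp only [h2, h3, h2', h3', h4] at e e'
      rw [← abs_mul, abs_le]
      constructor <;> linarith
    · rintro ω ⟨⟨⟨h1, h2, h3, -⟩, h4⟩, h5⟩
      exact h1.Y_le
    · rintro ω ⟨⟨⟨⟨h1, h2, h3, -⟩, h4⟩, h5⟩, h6⟩
      exact ⟨h1, h5, h6, h3, h4, h2⟩
    · push_cast
      ring
  · push_cast
    obtain ⟨z, hz0, hz⟩ : ∃ z : ℝ, 0 ≤ z ∧ (h : ℝ) ^ 5 = 1 + z :=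
      ⟨h ^ 5 - 1, by linarith [one_le_pow₀ hhR (n := 5)], by ring⟩
    obtain ⟨d, hd0, rfl⟩ : ∃ d : ℝ, 0 ≤ d ∧ D = 1 + d := ⟨D - 1, by linarith, by ring⟩
    rw [show (h : ℝ) ^ 15 = (h ^ 5) ^ 3 by ring, hz, ← sub_nonneg]
    ring_nf
    positivity

theorem card_diff_c_zero_X_ne_zero (hh : 1 ≤ h) (hD : DivisorBound (10 ^ 9 * h ^ 40) D) :
    CardBound (fun ω => IsDiff h ω ∧ ω.c = 0 ∧ ω.β ≠ 0 ∧ ω.X ≠ 0) (10 ^ 9 * D ^ 3 * h ^ 15) := by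
  have hh5 : 1 ≤ h ^ 5 := one_le_pow₀ hh
  have hh5' : h ≤ h ^ 5 := le_self_pow₀ hh (by norm_num)
  have hD1 := hD.one_le
  have hhR : (1 : ℝ) ≤ h := by exact_mod_cast hh
  refine (CardBound.weighted (fun ω => ω.β) h (by omega)
    (A := 288 * h ^ 5 * (96 * h ^ 5 * D * (2 * (512 * h ^ 5 * D + 2 * h ^ 5))))
    (B := 96 * h ^ 5 * D * (2 * (512 * h ^ 5 * D + 2 * h ^ 5))) (by positivity)
    (hD.harmonic ?_) ?_ ?_).mono ?_
  · simpa using pow_le_bound hh (C := 1) (k := 1) (by norm_num) (by norm_num)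
  · rintro ω ⟨h1, h2, h3, h4⟩
    exact ⟨h3, h1.β_le⟩
  · intro b hb _
    refine (CardBound.weighted (fun ω => ω.X) (2 * h ^ 5) (by omega)
      (A := 3 * (16 * h ^ 5) * ((288 * h ^ 5 / |(b : ℝ)| + 1) * ((512 * h ^ 5) * (2 * D * 1))))
      (B := 3 * (16 * h ^ 5) * ((288 * h ^ 5 / |(b : ℝ)| + 1) * (2 * D * 1))) (by positivity)
      (hD.harmonic (pow_le_bound hh (by norm_num) (by norm_num))) ?_ ?_).mono
        (le_of_eq ?_)
    · rintro ω ⟨⟨h1, h2, h3, h4⟩, h5⟩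
      exact ⟨h4, h1.X_le⟩
    · intro x hx _
      refine (CardBound.box (fun ω => ω.v * ω.s + 3 * ω.X * ω.Y) (16 * h ^ 5) (by omega) ?_
        fun κ _ => CardBound.interval (fun ω => ω.Y) b (288 * h ^ 5) hb (by omega) ?_
        fun y => CardBound.interval (fun ω => ω.a) x (512 * h ^ 5) hx (by omega) ?_
        fun a => s_dvd_tail hh hD x y (κ - 3 * x * y) b a 0 ?_).mono (le_of_eq ?_)
      · rintro ω ⟨⟨⟨h1, -⟩, -⟩, -⟩
        exact h1.k_le
      · rintro ω₁ ω₂ ⟨⟨⟨⟨h1, h2, -⟩, rfl⟩, rfl⟩, rfl⟩ ⟨⟨⟨⟨h1', h2', -⟩, hb'⟩, hx'⟩, hk'⟩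
        have e := abs_le.1 h1.d_le
        have e' := abs_le.1 h1'.d_le
        have f := h1.a_le
        have f' := h1'.a_le
        simp only [h2, h2', hb', hx', mul_zero, add_zero] at e e' f' hk'
        have hX : 1 ≤ |ω₁.X| := Int.one_le_abs hx
        refine le_of_mul_le_mul_left (a := |ω₁.X|) ?_ (by omega)
        rw [← abs_mul, ← abs_mul]
        have g : |ω₁.X * ((ω₁.a + 2 * ω₁.Y * ω₁.β) - (ω₂.a + 2 * ω₂.Y * ω₁.β))|
            ≤ |ω₁.X| * (64 * h ^ 5) := by
          rw [abs_mul]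
          refine mul_le_mul_of_nonneg_left ?_ (abs_nonneg _)
          exact (abs_sub _ _).trans (by linarith)
        have g' := abs_le.1 g
        have k : h ^ 5 ≤ |ω₁.X| * h ^ 5 := le_mul_of_one_le_left (by omega) hX
        have hk'' : ω₂.v * ω₂.s = ω₁.v * ω₁.s + 3 * ω₁.X * ω₁.Y - 3 * ω₁.X * ω₂.Y := by
          linarith
        rw [hk''] at e'
        rw [abs_le]
        constructor <;> linarith
      · rintro ω₁ ω₂ ⟨⟨⟨⟨⟨h1, h2, -⟩, hb⟩, rfl⟩, hk⟩, hy⟩ ⟨⟨⟨⟨⟨h1', h2', -⟩, hb'⟩, hx'⟩, hk'⟩, hy'⟩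
        have e := abs_le.1 h1.d_le
        have e' := abs_le.1 h1'.d_le
        have hm : ω₂.v * ω₂.s = ω₁.v * ω₁.s := by
          rw [← hk, hx', hy', hy] at hk'
          linarith
        simp only [h2, h2', hb, hb', hx', hy, hy', hm] at e e'
        rw [← abs_mul, abs_le]
        constructor <;> linarith
      · rintro ω ⟨⟨⟨⟨⟨⟨h1, h2, -⟩, hb⟩, rfl⟩, hk⟩, rfl⟩, ha⟩
        exact ⟨h1, rfl, rfl, by linarith, hb, ha, h2⟩
      · push_cast
        ring
    · push_cast
      ring
  · have hR : (h : ℝ) ≤ h ^ 5 := by exact_mod_cast hh5'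
    have h1 : 288 * (h : ℝ) ^ 5 * (96 * h ^ 5 * D * (2 * (512 * h ^ 5 * D + 2 * h ^ 5))) * D +
        96 * h ^ 5 * D * (2 * (512 * h ^ 5 * D + 2 * h ^ 5)) * h ≤
        288 * (h : ℝ) ^ 5 * (96 * h ^ 5 * D * (2 * (512 * h ^ 5 * D + 2 * h ^ 5))) * D +
        96 * h ^ 5 * D * (2 * (512 * h ^ 5 * D + 2 * h ^ 5)) * h ^ 5 := by gcongr
    refine (mul_le_mul_of_nonneg_left h1 (by norm_num)).trans ?_
    obtain ⟨z, hz0, hz⟩ : ∃ z : ℝ, 0 ≤ z ∧ (h : ℝ) ^ 5 = 1 + z :=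
      ⟨h ^ 5 - 1, by linarith [one_le_pow₀ hhR (n := 5)], by ring⟩
    obtain ⟨d, hd0, rfl⟩ : ∃ d : ℝ, 0 ≤ d ∧ D = 1 + d := ⟨D - 1, by linarith, by ring⟩
    rw [show (h : ℝ) ^ 15 = (h ^ 5) ^ 3 by ring, hz, ← sub_nonneg]
    ring_nf
    positivity

theorem card_diff_c_zero_X_zero (hh : 1 ≤ h) (hD : DivisorBound (10 ^ 9 * h ^ 40) D) :
    CardBound (fun ω => IsDiff h ω ∧ ω.c = 0 ∧ ω.β ≠ 0 ∧ ω.X = 0) (10 ^ 7 * D ^ 2 * h ^ 15) := by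
  have hh5 : 1 ≤ h ^ 5 := one_le_pow₀ hh
  have hh5' : h ≤ h ^ 5 := le_self_pow₀ hh (by norm_num)
  have hD1 := hD.one_le
  have hhR : (1 : ℝ) ≤ h := by exact_mod_cast hh
  refine (CardBound.weighted (fun ω => ω.β) h (by omega)
    (A := 768 * h ^ 5 * (3 * (2 * h ^ 5) * (2 * (64 * h ^ 5) * (2 * D * 1))))
    (B := 3 * (2 * h ^ 5) * (2 * (64 * h ^ 5) * (2 * D * 1))) (by positivity)
    (hD.harmonic ?_) ?_ ?_).mono ?_
  · simpa using pow_le_bound hh (C := 1) (k := 1) (by norm_num) (by norm_num)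
  · rintro ω ⟨h1, h2, h3, h4⟩
    exact ⟨h3, h1.β_le⟩
  · intro b hb _
    refine (CardBound.interval (fun ω => ω.v * ω.s) b (768 * h ^ 5) hb (by omega) ?_ fun m =>
      CardBound.box (fun ω => ω.Y) (2 * h ^ 5) (by omega) ?_ fun y _ =>
      CardBound.interval_one (fun ω => ω.a) (64 * h ^ 5) (by omega) ?_ fun a =>
      s_dvd_tail hh hD 0 y m b a 0 ?_).mono (le_of_eq ?_)
    · rintro ω₁ ω₂ ⟨⟨h1, h2, h3, h4⟩, rfl⟩ ⟨⟨h1', h2', h3', h4'⟩, hb'⟩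
      have e := abs_le.1 h1.d_le
      have e' := abs_le.1 h1'.d_le
      simp only [h2, h2', h4, h4', hb'] at e e'
      rw [← abs_mul, abs_le]
      constructor <;> linarith
    · rintro ω ⟨⟨⟨h1, h2, h3⟩, h4⟩, h5⟩
      exact h1.Y_le
    · rintro ω₁ ω₂ ⟨⟨⟨⟨h1, -⟩, hb⟩, -⟩, hy⟩ ⟨⟨⟨⟨h1', -⟩, hb'⟩, -⟩, hy'⟩
      have e := abs_le.1 h1.a_le
      have e' := abs_le.1 h1'.a_le
      simp only [hb, hb', hy, hy'] at e e'
      rw [abs_le]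
      constructor <;> linarith
    · rintro ω ⟨⟨⟨⟨⟨h1, h2, h3, h4⟩, hb⟩, hm⟩, hy⟩, ha⟩
      exact ⟨h1, h4, hy, hm, hb, ha, h2⟩
    · push_cast
      ring
  · have hR : (h : ℝ) ≤ h ^ 5 := by exact_mod_cast hh5'
    refine (mul_le_mul_of_nonneg_left (add_le_add_right
      (mul_le_mul_of_nonneg_left hR (by positivity)) _) (by norm_num)).trans ?_
    obtain ⟨z, hz0, hz⟩ : ∃ z : ℝ, 0 ≤ z ∧ (h : ℝ) ^ 5 = 1 + z :=
      ⟨h ^ 5 - 1, by linarith [one_le_pow₀ hhR (n := 5)], by ring⟩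
    obtain ⟨d, hd0, rfl⟩ : ∃ d : ℝ, 0 ≤ d ∧ D = 1 + d := ⟨D - 1, by linarith, by ring⟩
    rw [show (h : ℝ) ^ 15 = (h ^ 5) ^ 3 by ring, hz, ← sub_nonneg]
    ring_nf
    positivity

theorem card_diff_c_zero (hh : 1 ≤ h) (hD : DivisorBound (10 ^ 9 * h ^ 40) D) :
    CardBound (fun ω => IsDiff h ω ∧ ω.c = 0) (2 * 10 ^ 9 * D ^ 3 * h ^ 15) := by
  have hD1 := hD.one_le
  have hhR : (1 : ℝ) ≤ h := by exact_mod_cast hh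
  refine (CardBound.cases (fun ω => ω.β = 0)
    (CardBound.cases (fun ω => ω.a = 0) ((card_diff_zero hh hD).imp ?_)
      ((card_diff_c_zero_β_zero hh hD).imp ?_))
    (CardBound.cases (fun ω => ω.X = 0) ((card_diff_c_zero_X_zero hh hD).imp ?_)
      ((card_diff_c_zero_X_ne_zero hh hD).imp ?_))).mono ?_
  · tauto
  · tauto
  · tauto
  · tauto
  · have h1 : D ^ 2 * h ^ 15 ≤ D ^ 3 * h ^ 15 :=
      mul_le_mul_of_nonneg_right (pow_le_pow_right₀ hD1 (by norm_num)) (by positivity)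
    have h2 : 0 ≤ D ^ 3 * h ^ 15 := by positivity
    linarith

end DiffBounds

/-- A quadratic function is small only on short intervals to either side of its vertex. -/
theorem disc_mul_sub_sq_le {α b γ x y τ : ℤ} (hτ : 0 ≤ τ) (hx : |α * x ^ 2 + b * x + γ| ≤ τ)
    (hy : |α * y ^ 2 + b * y + γ| ≤ τ) (hs : 0 ≤ (2 * α * x + b) * (2 * α * y + b)) :
    |α| * (x - y) ^ 2 ≤ 2 * τ ∧ |b ^ 2 - 4 * α * γ| * (x - y) ^ 2 ≤ 16 * τ ^ 2 := by
  set u := 2 * α * x + b with hu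
  set w := 2 * α * y + b with hw
  set F := α * x ^ 2 + b * x + γ with hF
  set G := α * y ^ 2 + b * y + γ with hG
  have h1 : (x - y) * (u + w) = 2 * (F - G) := by rw [hu, hw, hF, hG]; ring
  have h2 : |x - y| * |u + w| ≤ 4 * τ := by
    rw [← abs_mul, h1, abs_mul, abs_of_nonneg (by norm_num : (0 : ℤ) ≤ 2)]
    have := abs_sub F G
    linarith
  have h3 : |u + w| = |u| + |w| := (abs_add_eq_add_abs_iff u w).2 (by
    rcases mul_nonneg_iff.1 hs with h | h
    · exact Or.inl h
    · exact Or.inr h)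
  have h4 : u - w = 2 * α * (x - y) := by rw [hu, hw]; ring
  have h5 : 2 * |α| * |x - y| ≤ |u + w| := by
    have : |u - w| ≤ |u| + |w| := abs_sub u w
    rw [h4, abs_mul, abs_mul, abs_of_nonneg (by norm_num : (0 : ℤ) ≤ 2)] at this
    linarith
  have hα : |α| * (x - y) ^ 2 ≤ 2 * τ := by
    have := mul_le_mul_of_nonneg_left h5 (abs_nonneg (x - y))
    rw [← sq_abs (x - y)]
    nlinarith
  refine ⟨hα, ?_⟩
  have hu2 : u ^ 2 = (b ^ 2 - 4 * α * γ) + 4 * α * F := by rw [hu, hF]; ring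
  have hτα : |4 * α * F| ≤ 4 * |α| * τ := by
    rw [abs_mul, abs_mul, abs_of_nonneg (by norm_num : (0 : ℤ) ≤ 4)]
    exact mul_le_mul_of_nonneg_left hx (by positivity)
  set Δ := b ^ 2 - 4 * α * γ with hΔ
  by_cases hc : |Δ| ≤ 8 * |α| * τ
  · have h6 : |Δ| * (x - y) ^ 2 ≤ 8 * |α| * τ * (x - y) ^ 2 :=
      mul_le_mul_of_nonneg_right hc (sq_nonneg _)
    nlinarith
  · push Not at hc
    have hw2 : w ^ 2 = Δ + 4 * α * G := by rw [hw, hG, hΔ]; ring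
    have hτα' : |4 * α * G| ≤ 4 * |α| * τ := by
      rw [abs_mul, abs_mul, abs_of_nonneg (by norm_num : (0 : ℤ) ≤ 4)]
      exact mul_le_mul_of_nonneg_left hy (by positivity)
    have e1 := abs_le.1 hτα
    have e2 := abs_le.1 hτα'
    have hΔ0 : 0 < Δ := by
      by_contra hneg
      rw [abs_of_nonpos (not_lt.1 hneg)] at hc
      have := sq_nonneg u
      have : 0 ≤ |α| * τ := by positivity
      nlinarith
    rw [abs_of_pos hΔ0] at hc ⊢
    have h7 : Δ ≤ (u + w) ^ 2 := by nlinarith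
    have h8 : (|x - y| * |u + w|) ^ 2 ≤ (4 * τ) ^ 2 := pow_le_pow_left₀ (by positivity) h2 2
    rw [mul_pow, sq_abs, sq_abs] at h8
    have := mul_le_mul_of_nonneg_left h7 (sq_nonneg (x - y))
    nlinarith

namespace IsDiff

variable {h : ℤ} {ω : DiffVec}

theorem key_le (hh : 1 ≤ h) (hω : IsDiff h ω) :
    |3 * ω.X * ω.a + 3 * ω.Y * ω.c - 4 * (ω.v * ω.s) * ω.β| ≤ 800 * h ^ 6 := by
  have h1 : |2 * ω.β * (ω.v * ω.s + 3 * ω.X * ω.Y)| ≤ 2 * h * (16 * h ^ 5) := by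
    rw [abs_mul, abs_mul, abs_of_nonneg (by norm_num : (0 : ℤ) ≤ 2)]
    exact mul_le_mul (mul_le_mul_of_nonneg_left hω.β_le (by norm_num)) hω.k_le (abs_nonneg _)
      (by positivity)
  have h2 : h ^ 5 ≤ h ^ 6 := pow_le_pow_right₀ hh (by norm_num)
  have h3 := abs_sub (3 * ω.X * ω.a + 3 * ω.Y * ω.c + 6 * ω.X * ω.Y * ω.β - 2 * (ω.v * ω.s) * ω.β)
    (2 * ω.β * (ω.v * ω.s + 3 * ω.X * ω.Y))
  have h4 := hω.d_le
  calc _ = |(3 * ω.X * ω.a + 3 * ω.Y * ω.c + 6 * ω.X * ω.Y * ω.β - 2 * (ω.v * ω.s) * ω.β) -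
    (2 * ω.β * (ω.v * ω.s + 3 * ω.X * ω.Y))| := by congr 1; ring
    _ ≤ _ := by linarith

theorem c_abs_le (hh : 1 ≤ h) (hω : IsDiff h ω) : |ω.c| ≤ 36 * h ^ 6 := by
  have h1 : |2 * ω.X * ω.β| ≤ 4 * h ^ 6 := by
    rw [abs_mul, abs_mul, abs_of_nonneg (by norm_num : (0 : ℤ) ≤ 2)]
    have := mul_le_mul hω.X_le hω.β_le (abs_nonneg _) (by positivity)
    linarith
  have h2 : h ^ 5 ≤ h ^ 6 := pow_le_pow_right₀ hh (by norm_num)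
  have h3 := abs_sub (ω.c + 2 * ω.X * ω.β) (2 * ω.X * ω.β)
  rw [add_sub_cancel_right] at h3
  have := hω.c_le
  linarith

theorem a_abs_le (hh : 1 ≤ h) (hω : IsDiff h ω) : |ω.a| ≤ 36 * h ^ 6 := hω.swap.c_abs_le hh

theorem v_abs_le (hh : 1 ≤ h) (hω : IsDiff h ω) (hc : ω.c ≠ 0) : |ω.v| ≤ 972 * h ^ 6 := by
  have h1 : |ω.v| ≤ |27 * ω.c| := by
    refine Int.le_of_dvd (by positivity) ?_
    rw [abs_dvd_abs]
    exact hω.v_dvd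
  rw [abs_mul, abs_of_nonneg (by norm_num : (0 : ℤ) ≤ 27)] at h1
  have := hω.c_abs_le hh
  linarith

/-- `X` is nearly a root of a quadratic polynomial. -/
theorem quad_le (hh : 1 ≤ h) (hω : IsDiff h ω) :
    |3 * ω.a * ω.X ^ 2 + -(4 * (ω.v * ω.s) * ω.β) * ω.X + -(ω.c * (ω.v * ω.s))| ≤
      832 * h ^ 6 * |ω.X| + 512 * h ^ 10 := by
  have h1 : |ω.X * (3 * ω.X * ω.a + 3 * ω.Y * ω.c - 4 * (ω.v * ω.s) * ω.β)| ≤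
      |ω.X| * (800 * h ^ 6) := by
    rw [abs_mul]
    exact mul_le_mul_of_nonneg_left (hω.key_le hh) (abs_nonneg _)
  have h2 : |(ω.v * ω.s + 3 * ω.X * ω.Y) * (ω.c + 2 * ω.X * ω.β)| ≤ 16 * h ^ 5 * (32 * h ^ 5) := by
    rw [abs_mul]
    exact mul_le_mul hω.k_le hω.c_le (abs_nonneg _) (by positivity)
  have h3 : |ω.X * (2 * ω.β * (ω.v * ω.s + 3 * ω.X * ω.Y))| ≤ |ω.X| * (2 * h * (16 * h ^ 5)) := by
    rw [abs_mul, abs_mul, abs_mul, abs_of_nonneg (by norm_num : (0 : ℤ) ≤ 2)]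
    refine mul_le_mul_of_nonneg_left ?_ (abs_nonneg _)
    exact mul_le_mul (mul_le_mul_of_nonneg_left hω.β_le (by norm_num)) hω.k_le (abs_nonneg _)
      (by positivity)
  have e1 := abs_le.1 h1
  have e2 := abs_le.1 h2
  have e3 := abs_le.1 h3
  rw [abs_le]
  constructor <;> linarith

end IsDiff

section DiffBounds

variable {h : ℤ} {D : ℝ}

/-- The bound for `Y` once the other coordinates are fixed. -/
theorem c_mul_Y_sub_le (hh : 1 ≤ h) {ω₁ ω₂ : DiffVec} (h₁ : IsDiff h ω₁) (h₂ : IsDiff h ω₂)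
    (hX : ω₁.X = ω₂.X) (ha : ω₁.a = ω₂.a) (hc : ω₁.c = ω₂.c) (hv : ω₁.v = ω₂.v)
    (hs : ω₁.s = ω₂.s) (hβ : ω₁.β = ω₂.β) : |ω₂.c| * |ω₁.Y - ω₂.Y| ≤ 534 * h ^ 6 := by
  have e₁ := abs_le.1 (h₁.key_le hh)
  have e₂ := abs_le.1 (h₂.key_le hh)
  have h6 : 0 ≤ h ^ 6 := by positivity
  simp only [hX, ha, hc, hv, hs, hβ] at e₁
  rw [← abs_mul, abs_le]
  constructor <;> linarith

theorem card_diff_X_small (hh : 1 ≤ h) (hD : DivisorBound (10 ^ 9 * h ^ 40) D) :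
    CardBound (fun ω => IsDiff h ω ∧ ω.a ≠ 0 ∧ ω.c ≠ 0 ∧ |ω.X| ≤ h ^ 2)
      (10 ^ 7 * D ^ 3 * h ^ 15) := by
  have hD1 := hD.one_le
  have h2 : 1 ≤ h ^ 2 := one_le_pow₀ hh
  have h6 : 1 ≤ h ^ 6 := one_le_pow₀ hh
  have hhR : (1 : ℝ) ≤ h := by exact_mod_cast hh
  refine (CardBound.box (fun ω => ω.X) (h ^ 2) h2 (fun ω hω => hω.2.2.2) fun x _ =>
    CardBound.box (fun ω => ω.β) h hh (fun ω hω => hω.1.1.β_le) fun b _ =>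
    CardBound.box (fun ω => ω.a) (36 * h ^ 6) (by omega) (fun ω hω => hω.1.1.1.a_abs_le hh)
      fun a ha => CardBound.mono (K := 2 * D * (2 * (534 * h ^ 6 * (2 * D * 1) * D +
        (2 * D * 1) * (36 * h ^ 6)))) ?_ le_rfl).mono ?_
  · by_cases ha0 : a = 0
    · refine CardBound.of_false ?_ (by positivity)
      rintro ω ⟨⟨⟨h1, -⟩, -⟩, rfl⟩
      exact h1.2.1 ha0
    refine CardBound.divisor (fun ω => ω.s) (27 * a) (by omega) (hD.divisors (by omega) ?_) ?_
      fun s _ => ?_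
    · rw [abs_mul, abs_of_nonneg (by norm_num : (0 : ℤ) ≤ 27)]
      refine le_trans ?_ (pow_le_bound (C := 972) (k := 6) hh (by norm_num) (by norm_num))
      linarith
    · rintro ω ⟨⟨⟨h1, -⟩, -⟩, rfl⟩
      exact h1.1.s_dvd
    refine (CardBound.weighted (fun ω => ω.c) (36 * h ^ 6) (by omega)
      (A := 534 * h ^ 6 * (2 * D * 1)) (B := 2 * D * 1) (by positivity)
      (hD.harmonic (pow_le_bound hh (by norm_num) (by norm_num))) ?_ ?_).mono (le_of_eq ?_)
    · rintro ω ⟨⟨⟨⟨h1, -⟩, -⟩, -⟩, -⟩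
      exact ⟨h1.2.2.1, h1.1.c_abs_le hh⟩
    · intro c hc0 hc
      refine (CardBound.divisor (fun ω => ω.v) (27 * c) (by omega) (hD.divisors (by omega) ?_) ?_
        fun v _ => CardBound.interval (fun ω => ω.Y) c (534 * h ^ 6) hc0 (by omega) ?_
        fun y => CardBound.of_subsingleton ?_).mono (le_of_eq ?_)
      · rw [abs_mul, abs_of_nonneg (by norm_num : (0 : ℤ) ≤ 27)]
        refine le_trans ?_ (pow_le_bound (C := 972) (k := 6) hh (by norm_num) (by norm_num))
        linarith
      · rintro ω ⟨⟨h1, -⟩, rfl⟩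
        exact h1.1.1.1.1.v_dvd
      · rintro ω₁ ω₂ ⟨⟨⟨⟨⟨⟨⟨d, -⟩, hX⟩, hβ⟩, ha⟩, hs⟩, hc⟩, hv⟩
          ⟨⟨⟨⟨⟨⟨⟨d', -⟩, hX'⟩, hβ'⟩, ha'⟩, hs'⟩, hc'⟩, hv'⟩
        rw [← hc']
        exact c_mul_Y_sub_le hh d d' (by omega) (by omega) (by omega) (by omega) (by omega)
          (by omega)
      · rintro ω₁ ω₂ ⟨⟨⟨⟨⟨⟨⟨⟨d, -⟩, hX⟩, hβ⟩, ha⟩, hs⟩, hc⟩, hv⟩, hy⟩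
          ⟨⟨⟨⟨⟨⟨⟨⟨d', -⟩, hX'⟩, hβ'⟩, ha'⟩, hs'⟩, hc'⟩, hv'⟩, hy'⟩
        ext <;> omega
      · push_cast
        ring
    · push_cast
      ring
  · push_cast
    obtain ⟨d, hd0, rfl⟩ : ∃ d : ℝ, 0 ≤ d ∧ D = 1 + d := ⟨D - 1, by linarith, by ring⟩
    rw [← sub_nonneg]
    ring_nf
    positivity

theorem X_sub_le_of_disc_ne_zero (hh : 1 ≤ h) {ω₁ ω₂ : DiffVec} (h₁ : IsDiff h ω₁)
    (h₂ : IsDiff h ω₂) (hX₁ : |ω₁.X| ≤ |ω₁.Y|) (hX₂ : |ω₂.X| ≤ |ω₂.Y|) (hm : h ^ 8 < |ω₁.v * ω₁.s|)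
    (hE : 4 * ω₁.β ^ 2 * (ω₁.v * ω₁.s) + 3 * ω₁.a * ω₁.c ≠ 0) (ha : ω₂.a = ω₁.a)
    (hc : ω₂.c = ω₁.c) (hv : ω₂.v = ω₁.v) (hs : ω₂.s = ω₁.s) (hβ : ω₂.β = ω₁.β)
    (hsgn : 0 ≤ (2 * (3 * ω₁.a) * ω₁.X + -(4 * (ω₁.v * ω₁.s) * ω₁.β)) *
      (2 * (3 * ω₂.a) * ω₂.X + -(4 * (ω₂.v * ω₂.s) * ω₂.β))) :
    |ω₁.X - ω₂.X| ≤ 96256 * h ^ 2 := by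
  rw [ha, hv, hs, hβ] at hsgn
  have hτ : ∀ ω : DiffVec, IsDiff h ω → |ω.X| ≤ |ω.Y| → h ^ 8 < |ω.v * ω.s| →
      832 * h ^ 6 * |ω.X| + 512 * h ^ 10 ≤ 3008 * h ^ 2 * |ω.v * ω.s| := by
    intro ω hω hXY hm
    have h5 : h ^ 5 ≤ h ^ 8 := pow_le_pow_right₀ hh (by norm_num)
    have e1 : 3 * (|ω.X| * |ω.Y|) ≤ |ω.v * ω.s| + 16 * h ^ 5 := by
      have h3 : 3 * ω.X * ω.Y = (ω.v * ω.s + 3 * ω.X * ω.Y) - ω.v * ω.s := by ring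
      have h4 : 3 * (|ω.X| * |ω.Y|) = |3 * ω.X * ω.Y| := by
        rw [abs_mul, abs_mul, abs_of_nonneg (by norm_num : (0 : ℤ) ≤ 3), mul_assoc]
      rw [h4, h3]
      have := abs_sub (ω.v * ω.s + 3 * ω.X * ω.Y) (ω.v * ω.s)
      have := hω.k_le
      linarith
    have e2 : |ω.X| * |ω.X| ≤ |ω.X| * |ω.Y| := mul_le_mul_of_nonneg_left hXY (abs_nonneg _)
    have e3 : |ω.X| * |ω.X| ≤ 6 * |ω.v * ω.s| := by linarith [abs_nonneg (ω.v * ω.s)]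
    have e4 : h ^ 4 * |ω.X| ≤ 3 * |ω.v * ω.s| := by
      refine abs_le_of_sq_le_sq' ?_ (by positivity) |>.2
      have := mul_le_mul hm.le e3 (by positivity) (by positivity)
      nlinarith [sq_nonneg (|ω.v * ω.s|)]
    have e5 := mul_le_mul_of_nonneg_left e4 (by positivity : 0 ≤ h ^ 2)
    have e6 := mul_le_mul_of_nonneg_left hm.le (by positivity : 0 ≤ h ^ 2)
    nlinarith
  have q₁ := (h₁.quad_le hh).trans (hτ ω₁ h₁ hX₁ hm)
  have q₂ := (h₂.quad_le hh).trans (hτ ω₂ h₂ hX₂ (by rwa [hv, hs]))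
  rw [ha, hc, hv, hs, hβ] at q₂
  have key := (disc_mul_sub_sq_le (by positivity) q₁ q₂ hsgn).2
  set m := ω₁.v * ω₁.s with hmdef
  have hdisc : (-(4 * m * ω₁.β)) ^ 2 - 4 * (3 * ω₁.a) * -(ω₁.c * m) =
      4 * m * (4 * ω₁.β ^ 2 * m + 3 * ω₁.a * ω₁.c) := by ring
  rw [hdisc, abs_mul, abs_mul, abs_of_nonneg (by norm_num : (0 : ℤ) ≤ 4)] at key
  set E := 4 * ω₁.β ^ 2 * m + 3 * ω₁.a * ω₁.c with hEdef
  have hdvd : m ∣ 243 * E := by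
    have : 243 * E = 972 * ω₁.β ^ 2 * m + (27 * ω₁.c) * (27 * ω₁.a) := by rw [hEdef]; ring
    rw [this]
    exact dvd_add (dvd_mul_left _ _) (mul_dvd_mul h₁.v_dvd h₁.s_dvd)
  have hmE : |m| ≤ 243 * |E| := by
    have : |m| ≤ |243 * E| := Int.le_of_dvd (by positivity) ((abs_dvd_abs _ _).2 hdvd)
    rwa [abs_mul 243, abs_of_nonneg (by norm_num : (0 : ℤ) ≤ 243)] at this
  have hmpos : 0 < |m| := lt_of_le_of_lt (by positivity) hm
  have k1 : |m| * |m| * (ω₁.X - ω₂.X) ^ 2 ≤ 64 * (4 * |m| * |E| * (ω₁.X - ω₂.X) ^ 2) := by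
    have := mul_le_mul_of_nonneg_left hmE (by positivity : 0 ≤ |m| * (ω₁.X - ω₂.X) ^ 2)
    have : 0 ≤ |m| * |E| * (ω₁.X - ω₂.X) ^ 2 := by positivity
    linarith
  have k2 : (|m| * |ω₁.X - ω₂.X|) ^ 2 ≤ (|m| * (96256 * h ^ 2)) ^ 2 := by
    rw [mul_pow, sq_abs (ω₁.X - ω₂.X)]
    nlinarith
  exact le_of_mul_le_mul_left (abs_le_of_sq_le_sq' k2 (by positivity)).2 hmpos

theorem card_diff_disc_ne_zero (hh : 1 ≤ h) (hD : DivisorBound (10 ^ 9 * h ^ 40) D) :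
    CardBound (fun ω => IsDiff h ω ∧ ω.a ≠ 0 ∧ ω.c ≠ 0 ∧ |ω.X| ≤ |ω.Y| ∧ h ^ 8 < |ω.v * ω.s| ∧
      4 * ω.β ^ 2 * (ω.v * ω.s) + 3 * ω.a * ω.c ≠ 0) (10 ^ 13 * D ^ 3 * h ^ 15) := by
  have hD1 := hD.one_le
  have h2 : 1 ≤ h ^ 2 := one_le_pow₀ hh
  have h6 : 1 ≤ h ^ 6 := one_le_pow₀ hh
  have hhR : (1 : ℝ) ≤ h := by exact_mod_cast hh
  refine (CardBound.box (fun ω => ω.β) h hh (fun ω hω => hω.1.β_le) fun b _ =>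
    CardBound.box (fun ω => ω.a) (36 * h ^ 6) (by omega) (fun ω hω => hω.1.1.a_abs_le hh)
      fun a ha => CardBound.mono (K := 2 * D * (2 * (534 * h ^ 6 * (2 * D * (385024 * h ^ 2)) * D +
        (2 * D * (385024 * h ^ 2)) * (36 * h ^ 6)))) ?_ le_rfl).mono ?_
  · by_cases ha0 : a = 0
    · refine CardBound.of_false ?_ (by positivity)
      rintro ω ⟨⟨h1, -⟩, rfl⟩
      exact h1.2.1 ha0
    refine CardBound.divisor (fun ω => ω.s) (27 * a) (by omega) (hD.divisors (by omega) ?_) ?_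
      fun s _ => ?_
    · rw [abs_mul, abs_of_nonneg (by norm_num : (0 : ℤ) ≤ 27)]
      refine le_trans ?_ (pow_le_bound (C := 972) (k := 6) hh (by norm_num) (by norm_num))
      linarith
    · rintro ω ⟨⟨h1, -⟩, rfl⟩
      exact h1.1.s_dvd
    refine (CardBound.weighted (fun ω => ω.c) (36 * h ^ 6) (by omega)
      (A := 534 * h ^ 6 * (2 * D * (385024 * h ^ 2))) (B := 2 * D * (385024 * h ^ 2))
      (by positivity)
      (hD.harmonic (pow_le_bound hh (by norm_num) (by norm_num))) ?_ ?_).mono (le_of_eq ?_)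
    · rintro ω ⟨⟨⟨h1, -⟩, -⟩, -⟩
      exact ⟨h1.2.2.1, h1.1.c_abs_le hh⟩
    · intro c hc0 hc
      refine (CardBound.divisor (fun ω => ω.v) (27 * c) (by omega) (hD.divisors (by omega) ?_) ?_
        fun v _ => CardBound.cases
          (fun ω => 0 ≤ 2 * (3 * ω.a) * ω.X + -(4 * (ω.v * ω.s) * ω.β))
          (CardBound.interval_one (fun ω => ω.X) (96256 * h ^ 2) (by omega) ?_ fun x =>
            CardBound.interval (fun ω => ω.Y) c (534 * h ^ 6) hc0 (by omega) ?_
            fun y => CardBound.of_subsingleton ?_)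
          (CardBound.interval_one (fun ω => ω.X) (96256 * h ^ 2) (by omega) ?_ fun x =>
            CardBound.interval (fun ω => ω.Y) c (534 * h ^ 6) hc0 (by omega) ?_
            fun y => CardBound.of_subsingleton ?_)).mono (le_of_eq ?_)
      · rw [abs_mul, abs_of_nonneg (by norm_num : (0 : ℤ) ≤ 27)]
        refine le_trans ?_ (pow_le_bound (C := 972) (k := 6) hh (by norm_num) (by norm_num))
        linarith
      · rintro ω ⟨⟨h1, -⟩, rfl⟩
        exact h1.1.1.1.v_dvd
      · rintro ω₁ ω₂ ⟨⟨⟨⟨⟨⟨⟨d, -, -, hXY, hm, hE⟩, hβ⟩, ha⟩, hs⟩, hc⟩, hv⟩, hsg⟩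
          ⟨⟨⟨⟨⟨⟨⟨d', -, -, hXY', -, -⟩, hβ'⟩, ha'⟩, hs'⟩, hc'⟩, hv'⟩, hsg'⟩
        exact X_sub_le_of_disc_ne_zero hh d d' hXY hXY' hm hE (by omega) (by omega) (by omega)
          (by omega) (by omega) (mul_nonneg hsg hsg')
      · rintro ω₁ ω₂ ⟨⟨⟨⟨⟨⟨⟨⟨d, -⟩, hβ⟩, ha⟩, hs⟩, hc⟩, hv⟩, -⟩, hX⟩
          ⟨⟨⟨⟨⟨⟨⟨⟨d', -⟩, hβ'⟩, ha'⟩, hs'⟩, hc'⟩, hv'⟩, -⟩, hX'⟩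
        rw [← hc']
        exact c_mul_Y_sub_le hh d d' (by omega) (by omega) (by omega) (by omega) (by omega)
          (by omega)
      · rintro ω₁ ω₂ ⟨⟨⟨⟨⟨⟨⟨⟨⟨d, -⟩, hβ⟩, ha⟩, hs⟩, hc⟩, hv⟩, -⟩, hX⟩, hy⟩
          ⟨⟨⟨⟨⟨⟨⟨⟨⟨d', -⟩, hβ'⟩, ha'⟩, hs'⟩, hc'⟩, hv'⟩, -⟩, hX'⟩, hy'⟩
        ext <;> omega
      · rintro ω₁ ω₂ ⟨⟨⟨⟨⟨⟨⟨d, -, -, hXY, hm, hE⟩, hβ⟩, ha⟩, hs⟩, hc⟩, hv⟩, hsg⟩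
          ⟨⟨⟨⟨⟨⟨⟨d', -, -, hXY', -, -⟩, hβ'⟩, ha'⟩, hs'⟩, hc'⟩, hv'⟩, hsg'⟩
        exact X_sub_le_of_disc_ne_zero hh d d' hXY hXY' hm hE (by omega) (by omega) (by omega)
          (by omega) (by omega) (mul_nonneg_of_nonpos_of_nonpos (not_le.1 hsg).le (not_le.1 hsg').le)
      · rintro ω₁ ω₂ ⟨⟨⟨⟨⟨⟨⟨⟨d, -⟩, hβ⟩, ha⟩, hs⟩, hc⟩, hv⟩, -⟩, hX⟩
          ⟨⟨⟨⟨⟨⟨⟨⟨d', -⟩, hβ'⟩, ha'⟩, hs'⟩, hc'⟩, hv'⟩, -⟩, hX'⟩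
        rw [← hc']
        exact c_mul_Y_sub_le hh d d' (by omega) (by omega) (by omega) (by omega) (by omega)
          (by omega)
      · rintro ω₁ ω₂ ⟨⟨⟨⟨⟨⟨⟨⟨⟨d, -⟩, hβ⟩, ha⟩, hs⟩, hc⟩, hv⟩, -⟩, hX⟩, hy⟩
          ⟨⟨⟨⟨⟨⟨⟨⟨⟨d', -⟩, hβ'⟩, ha'⟩, hs'⟩, hc'⟩, hv'⟩, -⟩, hX'⟩, hy'⟩
        ext <;> omega
      · push_cast
        ring
    · push_cast
      ring
  · push_cast
    obtain ⟨d, hd0, rfl⟩ : ∃ d : ℝ, 0 ≤ d ∧ D = 1 + d := ⟨D - 1, by linarith, by ring⟩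
    rw [← sub_nonneg]
    ring_nf
    positivity

end DiffBounds

section DiffBounds

variable {h : ℤ} {D : ℝ}

theorem abs_mul_ediv_sub_ediv {n p q : ℤ} (hp : n ∣ p) (hq : n ∣ q) :
    |n| * |p / n - q / n| = |p - q| := by
  rw [← abs_mul, mul_sub, Int.mul_ediv_cancel' hp, Int.mul_ediv_cancel' hq]

theorem card_diff_vs_small (hh : 1 ≤ h) (hD : DivisorBound (10 ^ 9 * h ^ 40) D) :
    CardBound (fun ω => IsDiff h ω ∧ ω.c ≠ 0 ∧ h ^ 2 < |ω.X| ∧ h ^ 2 < |ω.Y| ∧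
      |ω.v * ω.s| ≤ h ^ 8 ∧ |ω.s| ≤ |ω.v|) (10 ^ 11 * D ^ 3 * h ^ 15) := by
  have hD1 := hD.one_le
  have h2 : 1 ≤ h ^ 2 := one_le_pow₀ hh
  have h3 : 1 ≤ h ^ 3 := one_le_pow₀ hh
  have h4 : 1 ≤ h ^ 4 := one_le_pow₀ hh
  have h5 : 1 ≤ h ^ 5 := one_le_pow₀ hh
  have h6 : 1 ≤ h ^ 6 := one_le_pow₀ hh
  have h8 : 1 ≤ h ^ 8 := one_le_pow₀ hh
  have hhR : (1 : ℝ) ≤ h := by exact_mod_cast hh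
  refine (CardBound.weighted (fun ω => ω.s) (h ^ 4) (by omega)
    (A := 264 * D * h ^ 6 * (4 * 10 ^ 7 * h ^ 9 * D)) (B := 264 * D * h ^ 6 * (1728 * h ^ 5 * D))
    (by positivity) (hD.harmonic ?_) ?_ ?_).mono ?_
  · simpa using pow_le_bound hh (C := 1) (k := 4) (by norm_num) (by norm_num)
  · rintro ω ⟨d, -, -, -, h1, h2⟩
    refine ⟨right_ne_zero_of_mul d.vs_ne, abs_le_of_sq_le_sq (?_ :
      |ω.s| ^ 2 ≤ (h ^ 4) ^ 2) (by omega)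
      |>.trans' (by rw [abs_abs])⟩
    rw [abs_mul] at h1
    nlinarith [abs_nonneg ω.s]
  · intro s hs0 _
    have hs : 0 < |s| := abs_pos.2 hs0
    have hsR : (0 : ℝ) < |(s : ℝ)| := by positivity
    set R := min (972 * h ^ 6) (h ^ 8 / |s|) with hR
    have hR0 : 0 ≤ R := le_min (by omega) (Int.ediv_nonneg (by omega) hs.le)
    have hR1 : (R : ℝ) ≤ 972 * h ^ 6 := by exact_mod_cast min_le_left _ _
    have hR2 : (R : ℝ) ≤ h ^ 8 / |(s : ℝ)| := by
      rw [le_div_iff₀ hsR]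
      exact_mod_cast (mul_le_mul_of_nonneg_right (min_le_right _ _) hs.le).trans
        (Int.ediv_mul_le _ hs.ne')
    refine (CardBound.weighted (fun ω => ω.v) R hR0
      (A := 132 * D * h ^ 6 * (13824 * h ^ 3 / |(s : ℝ)| + 1) * (1728 * h ^ 5))
      (B := 132 * D * h ^ 6 * (13824 * h ^ 3 / |(s : ℝ)| + 1)) (by positivity)
      (hD.harmonic ((min_le_left _ _).trans (pow_le_bound hh (by norm_num) (by norm_num))))
      ?_ ?_).mono ?_
    · rintro ω ⟨⟨d, hc, -, -, h1, -⟩, rfl⟩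
      refine ⟨left_ne_zero_of_mul d.vs_ne, le_min (d.v_abs_le hh hc) ?_⟩
      rw [abs_mul] at h1
      exact (Int.le_ediv_iff_mul_le hs).2 h1
    · intro v hv0 _
      refine (CardBound.interval_one (fun ω => ω.X * ω.Y) (11 * h ^ 5) (by omega) ?_ fun q =>
        CardBound.mono (K := 2 * D * (3 * h * ((1728 * h ^ 5 / |(v : ℝ)| + 1) *
          ((13824 * h ^ 3 / |(s : ℝ)| + 1) * 1)))) ?_ le_rfl).mono (le_of_eq ?_)
      · rintro ω₁ ω₂ ⟨⟨⟨d, -⟩, hs⟩, hv⟩ ⟨⟨⟨d', -⟩, hs'⟩, hv'⟩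
        have e := abs_le.1 d.k_le
        have e' := abs_le.1 d'.k_le
        simp only [hs, hv] at e
        simp only [hs', hv'] at e'
        rw [abs_le]
        constructor <;> linarith
      · by_cases hex : ∃ ω : DiffVec, |ω.X| ≤ 2 * h ^ 5 ∧ |ω.Y| ≤ 2 * h ^ 5 ∧ h ^ 2 < |ω.X| ∧
          h ^ 2 < |ω.Y| ∧ ω.X * ω.Y = q
        · obtain ⟨ω₀, hX₀, hY₀, hX₁, hY₁, hq⟩ := hex
          have hq0 : q ≠ 0 := by
            rw [← hq]
            exact mul_ne_zero (abs_pos.1 (by omega)) (abs_pos.1 (by omega))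
          have hqM : |q| ≤ 10 ^ 9 * h ^ 40 := by
            rw [← hq, abs_mul]
            refine le_trans ?_ (pow_le_bound (C := 4) (k := 10) hh (by norm_num) (by norm_num))
            have := mul_le_mul hX₀ hY₀ (abs_nonneg _) (by positivity)
            linarith
          refine CardBound.divisor (fun ω => ω.X) q hq0 (hD.divisors hq0 hqM) ?_ fun x _ => (
            CardBound.box (fun ω => ω.β) h hh ?_ fun b _ =>
            CardBound.interval (fun ω => 27 * ω.c / ω.v) v (1728 * h ^ 5) hv0 (by omega) ?_ fun z =>
            CardBound.interval (fun ω => 27 * ω.a / ω.s) s (13824 * h ^ 3) hs0 (by omega) ?_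
            fun x' => CardBound.of_subsingleton ?_).mono (le_of_eq ?_)
          · rintro ω ⟨-, rfl⟩
            exact dvd_mul_right _ _
          · rintro ω ⟨⟨⟨⟨⟨d, -⟩, -⟩, -⟩, -⟩, -⟩
            exact d.β_le
          · rintro ω₁ ω₂ ⟨⟨⟨⟨⟨⟨d, -⟩, hs⟩, hv⟩, hq⟩, hx⟩, hb⟩
              ⟨⟨⟨⟨⟨⟨d', -⟩, hs'⟩, hv'⟩, hq'⟩, hx'⟩, hb'⟩
            have e := abs_le.1 d.c_le
            have e' := abs_le.1 d'.c_le
            have dv := d.v_dvd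
            have dv' := d'.v_dvd
            simp only [hx, hb, hv] at e dv
            simp only [hx', hb', hv'] at e' dv'
            simp only [hv, hv']
            rw [abs_mul_ediv_sub_ediv dv dv', abs_le]
            constructor <;> linarith
          · rintro ω₁ ω₂ ⟨⟨⟨⟨⟨⟨⟨d, hc, hX, -⟩, hs⟩, hv⟩, hq⟩, hx⟩, hb⟩, hz⟩
              ⟨⟨⟨⟨⟨⟨⟨d', -⟩, hs'⟩, hv'⟩, hq'⟩, hx'⟩, hb'⟩, hz'⟩
            have e := abs_le.1 d.d_le
            have e' := abs_le.1 d'.d_le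
            have hX0 : ω₁.X ≠ 0 := abs_pos.1 (by omega)
            have hY : ω₂.Y = ω₁.Y := by
              have : ω₁.X * ω₂.Y = ω₁.X * ω₁.Y := by rw [hq, ← hq', hx, hx']
              exact mul_left_cancel₀ hX0 this
            have hc : ω₂.c = ω₁.c := by
              have e1 := Int.mul_ediv_cancel' d.v_dvd
              have e2 := Int.mul_ediv_cancel' d'.v_dvd
              rw [hz, hv] at e1
              rw [hz', hv'] at e2
              omega
            have ds := d.s_dvd
            have ds' := d'.s_dvd
            have hXx : ω₂.X = ω₁.X := by omega
            have hsx : ω₂.s = ω₁.s := by omega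
            have hvx : ω₂.v = ω₁.v := by omega
            have hbx : ω₂.β = ω₁.β := by omega
            rw [hsx, hs] at ds'
            rw [hs] at ds
            simp only [hs, hs']
            rw [abs_mul_ediv_sub_ediv ds ds']
            simp only [hXx, hsx, hvx, hbx, hY, hc] at e'
            have h7 : |ω₁.X| * |27 * ω₁.a - 27 * ω₂.a| ≤ |ω₁.X| * (13824 * h ^ 3) := by
              have h8 : h ^ 2 * (13824 * h ^ 3) ≤ |ω₁.X| * (13824 * h ^ 3) :=
                mul_le_mul_of_nonneg_right hX.le (by omega)
              refine le_trans ?_ h8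
              rw [← abs_mul, abs_le]
              constructor <;> linarith
            exact le_of_mul_le_mul_left h7 (abs_pos.2 hX0)
          · rintro ω₁ ω₂ ⟨⟨⟨⟨⟨⟨⟨⟨d, -⟩, hs⟩, hv⟩, hq⟩, hx⟩, hb⟩, hz⟩, hz2⟩
              ⟨⟨⟨⟨⟨⟨⟨⟨d', -, hX, -⟩, hs'⟩, hv'⟩, hq'⟩, hx'⟩, hb'⟩, hz'⟩, hz2'⟩
            have hX0 : ω₂.X ≠ 0 := abs_pos.1 (by omega)
            have hY : ω₁.Y = ω₂.Y := by
              have : ω₂.X * ω₁.Y = ω₂.X * ω₂.Y := by rw [hq', ← hq, hx, hx']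
              exact mul_left_cancel₀ hX0 this
            have hc : ω₁.c = ω₂.c := by
              have e1 := Int.mul_ediv_cancel' d.v_dvd
              have e2 := Int.mul_ediv_cancel' d'.v_dvd
              rw [hz, hv] at e1
              rw [hz', hv'] at e2
              omega
            have ha : ω₁.a = ω₂.a := by
              have e1 := Int.mul_ediv_cancel' d.s_dvd
              have e2 := Int.mul_ediv_cancel' d'.s_dvd
              rw [hz2, hs] at e1
              rw [hz2', hs'] at e2
              omega
            ext <;> omega
          · push_cast
            ring
        · refine CardBound.of_false ?_ (by positivity)
          rintro ω ⟨⟨⟨⟨d, -, hX, hY, -⟩, -⟩, -⟩, hq⟩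
          exact hex ⟨ω, d.X_le, d.Y_le, hX, hY, hq⟩
      · push_cast
        ring
    · have h89 : (h : ℝ) ^ 8 ≤ h ^ 9 := pow_le_pow_right₀ hhR (by norm_num)
      have h9D : (h : ℝ) ^ 9 ≤ h ^ 9 * D := le_mul_of_one_le_right (by positivity) hD1
      have h8D : (h : ℝ) ^ 8 * D ≤ h ^ 9 * D := mul_le_mul_of_nonneg_right h89 (by linarith)
      have key : (13824 * h ^ 3 / |(s : ℝ)| + 1) * (1728 * h ^ 5) * D +
          (13824 * h ^ 3 / |(s : ℝ)| + 1) * R ≤ 4 * 10 ^ 7 * h ^ 9 * D / |(s : ℝ)| +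
            1728 * h ^ 5 * D := by
        have e1 : 13824 * h ^ 3 / |(s : ℝ)| * R ≤ 13824 * h ^ 3 / |(s : ℝ)| * (972 * h ^ 6) :=
          mul_le_mul_of_nonneg_left hR1 (by positivity)
        have e2 : (13824 * 1728 * (h ^ 8 * D) + 13824 * 972 * h ^ 9 + h ^ 8) / |(s : ℝ)| ≤
            4 * 10 ^ 7 * h ^ 9 * D / |(s : ℝ)| := by
          refine div_le_div_of_nonneg_right ?_ hsR.le
          have : 0 ≤ (h : ℝ) ^ 9 * D := by positivity
          linarith
        have e3 : (13824 * 1728 * (h ^ 8 * D) + 13824 * 972 * h ^ 9 + h ^ 8) / |(s : ℝ)| =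
            13824 * h ^ 3 / |(s : ℝ)| * (1728 * h ^ 5) * D +
            13824 * h ^ 3 / |(s : ℝ)| * (972 * h ^ 6) + h ^ 8 / |(s : ℝ)| := by ring
        linarith
      have := mul_le_mul_of_nonneg_left key (by positivity : 0 ≤ 264 * D * h ^ 6)
      refine le_trans (le_of_eq ?_) (this.trans (le_of_eq ?_)) <;> ring
  · push_cast
    obtain ⟨d, hd0, rfl⟩ : ∃ d : ℝ, 0 ≤ d ∧ D = 1 + d := ⟨D - 1, by linarith, by ring⟩
    rw [← sub_nonneg]
    ring_nf
    positivity

theorem disc_zero_dvd {ω : DiffVec} (d : IsDiff h ω)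
    (hE : 4 * ω.β ^ 2 * (ω.v * ω.s) + 3 * ω.a * ω.c = 0) :
    27 * ω.a / ω.s ∣ 972 * ω.β ^ 2 := by
  obtain ⟨x, hx⟩ := d.s_dvd
  obtain ⟨z, hz⟩ := d.v_dvd
  rw [hx, Int.mul_ediv_cancel_left _ (right_ne_zero_of_mul d.vs_ne)]
  refine ⟨-z, ?_⟩
  have h1 : ω.v * ω.s * (972 * ω.β ^ 2 + x * z) = 0 := by
    have : 27 * ω.a * (27 * ω.c) = ω.s * x * (ω.v * z) := by rw [hx, hz]
    linarith
  have := (mul_eq_zero.1 h1).resolve_left d.vs_ne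
  linarith

theorem ac_eq_of_disc_zero {ω₁ ω₂ : DiffVec} (d₁ : IsDiff h ω₁) (d₂ : IsDiff h ω₂)
    (h₁ : 4 * ω₁.β ^ 2 * (ω₁.v * ω₁.s) + 3 * ω₁.a * ω₁.c = 0)
    (h₂ : 4 * ω₂.β ^ 2 * (ω₂.v * ω₂.s) + 3 * ω₂.a * ω₂.c = 0) (ha : ω₁.a ≠ 0) (hv : ω₁.v = ω₂.v)
    (hs : ω₁.s = ω₂.s) (hβ : ω₁.β = ω₂.β) (hx : 27 * ω₁.a / ω₁.s = 27 * ω₂.a / ω₂.s) :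
    ω₁.a = ω₂.a ∧ ω₁.c = ω₂.c := by
  have haa : ω₁.a = ω₂.a := by
    have e1 := Int.mul_ediv_cancel' d₁.s_dvd
    have e2 := Int.mul_ediv_cancel' d₂.s_dvd
    rw [← hx, ← hs, e1] at e2
    omega
  refine ⟨haa, mul_left_cancel₀ ha ?_⟩
  rw [hv, hs, hβ] at h₁
  nth_rewrite 2 [haa]
  linarith

theorem X_sub_le_of_disc_zero (hh : 1 ≤ h) {ω₁ ω₂ : DiffVec} (h₁ : IsDiff h ω₁)
    (h₂ : IsDiff h ω₂) (ha0 : ω₁.a ≠ 0) (ha : ω₂.a = ω₁.a)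
    (hc : ω₂.c = ω₁.c) (hv : ω₂.v = ω₁.v) (hs : ω₂.s = ω₁.s) (hβ : ω₂.β = ω₁.β)
    (hsgn : 0 ≤ (2 * (3 * ω₁.a) * ω₁.X + -(4 * (ω₁.v * ω₁.s) * ω₁.β)) *
      (2 * (3 * ω₂.a) * ω₂.X + -(4 * (ω₂.v * ω₂.s) * ω₂.β))) :
    |ω₁.s| * |ω₁.X - ω₂.X| ≤ 100 * (h ^ 3 * |ω₁.s| + h ^ 8) := by
  rw [ha, hv, hs, hβ] at hsgn
  have hτ : ∀ ω : DiffVec, IsDiff h ω → 832 * h ^ 6 * |ω.X| + 512 * h ^ 10 ≤ 2200 * h ^ 11 := by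
    intro ω hω
    have h1 : h ^ 10 ≤ h ^ 11 := pow_le_pow_right₀ hh (by norm_num)
    have h2 := mul_le_mul_of_nonneg_left hω.X_le (by positivity : 0 ≤ 832 * h ^ 6)
    have h3 : 0 ≤ h ^ 11 := by positivity
    linarith
  have q₁ := (h₁.quad_le hh).trans (hτ ω₁ h₁)
  have q₂ := (h₂.quad_le hh).trans (hτ ω₂ h₂)
  rw [ha, hc, hv, hs, hβ] at q₂
  have key := (disc_mul_sub_sq_le (by positivity) q₁ q₂ hsgn).1
  have hsa : |ω₁.s| ≤ 9 * |3 * ω₁.a| := by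
    have : |ω₁.s| ≤ |27 * ω₁.a| := Int.le_of_dvd (by positivity) ((abs_dvd_abs _ _).2 h₁.s_dvd)
    rw [abs_mul, abs_of_nonneg (by norm_num : (0 : ℤ) ≤ 27)] at this
    rw [abs_mul, abs_of_nonneg (by norm_num : (0 : ℤ) ≤ 3)]
    linarith
  have k1 : |ω₁.s| * (ω₁.X - ω₂.X) ^ 2 ≤ 39600 * h ^ 11 := by
    have := mul_le_mul_of_nonneg_right hsa (sq_nonneg (ω₁.X - ω₂.X))
    linarith
  have k2 := mul_le_mul_of_nonneg_left k1 (abs_nonneg ω₁.s)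
  refine (abs_le_of_sq_le_sq' ?_ (by positivity)).2
  rw [mul_pow, sq_abs (ω₁.X - ω₂.X)]
  have := sq_nonneg (h ^ 3 * |ω₁.s| - h ^ 8)
  have : 0 ≤ |ω₁.s| * h ^ 11 := by positivity
  nlinarith

theorem card_diff_disc_zero (hh : 1 ≤ h) (hD : DivisorBound (10 ^ 9 * h ^ 40) D) :
    CardBound (fun ω => IsDiff h ω ∧ ω.a ≠ 0 ∧ ω.c ≠ 0 ∧ |ω.s| ≤ |ω.v| ∧
      4 * ω.β ^ 2 * (ω.v * ω.s) + 3 * ω.a * ω.c = 0) (10 ^ 9 * D ^ 3 * h ^ 15) := by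
  have hD1 := hD.one_le
  have h2 : 1 ≤ h ^ 2 := one_le_pow₀ hh
  have h3 : 1 ≤ h ^ 3 := one_le_pow₀ hh
  have h5 : 1 ≤ h ^ 5 := one_le_pow₀ hh
  have h6 : 1 ≤ h ^ 6 := one_le_pow₀ hh
  have h8 : 1 ≤ h ^ 8 := one_le_pow₀ hh
  have hhR : (1 : ℝ) ≤ h := by exact_mod_cast hh
  refine (CardBound.box (fun ω => ω.β) h hh (fun ω hω => hω.1.β_le) fun b hb => CardBound.mono
    (K := 2 * D * (2 * (400 * h ^ 8 * (14418 * h ^ 6 * D + 972 * h ^ 6) * D +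
      404 * h ^ 3 * (14418 * h ^ 6 * D + 972 * h ^ 6) * (6 * h ^ 5)))) ?_ le_rfl).mono ?_
  · by_cases hb0 : b = 0
    · refine CardBound.of_false ?_ (by positivity)
      rintro ω ⟨⟨d, ha, hc, -, hE⟩, hβ⟩
      rw [hβ, hb0] at hE
      simp [ha, hc] at hE
    have hM : |972 * b ^ 2| ≤ 10 ^ 9 * h ^ 40 := by
      rw [abs_mul, abs_of_nonneg (by norm_num : (0 : ℤ) ≤ 972), abs_pow]
      refine le_trans ?_ (pow_le_bound (C := 972) (k := 2) hh (by norm_num) (by norm_num))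
      have := pow_le_pow_left₀ (abs_nonneg b) hb 2
      linarith
    have hb2 : 972 * b ^ 2 ≠ 0 := by positivity
    refine CardBound.divisor (fun ω => 27 * ω.a / ω.s) (972 * b ^ 2) hb2 (hD.divisors hb2 hM) ?_
      fun x _ => ?_
    · rintro ω ⟨⟨d, -, -, -, hE⟩, rfl⟩
      exact disc_zero_dvd d hE
    refine (CardBound.weighted (fun ω => ω.s) (6 * h ^ 5) (by omega)
      (A := 400 * h ^ 8 * (14418 * h ^ 6 * D + 972 * h ^ 6))
      (B := 404 * h ^ 3 * (14418 * h ^ 6 * D + 972 * h ^ 6)) (by positivity)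
      (hD.harmonic (pow_le_bound hh (by norm_num) (by norm_num))) ?_ ?_).mono (le_of_eq ?_)
    · rintro ω ⟨⟨⟨d, -, -, hsv, -⟩, -⟩, -⟩
      refine ⟨right_ne_zero_of_mul d.vs_ne, ?_⟩
      have h1 := vs_le hh d
      rw [abs_mul] at h1
      have h2 : |ω.s| ^ 2 ≤ (6 * h ^ 5) ^ 2 := by
        have : 0 ≤ h ^ 10 := by positivity
        nlinarith [abs_nonneg ω.s]
      exact (abs_le_of_sq_le_sq' h2 (by omega)).2
    · intro s hs0 _
      have hsR : (0 : ℝ) < |(s : ℝ)| := by positivity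
      have hs' : ((|s| : ℤ) : ℝ) = |(s : ℝ)| := by push_cast; rfl
      refine (CardBound.weighted (fun ω => ω.v) (972 * h ^ 6) (by omega)
        (A := 2 * (100 * (h ^ 3 * |(s : ℝ)| + h ^ 8) / |(s : ℝ)| + 1) * (14418 * h ^ 6))
        (B := 2 * (100 * (h ^ 3 * |(s : ℝ)| + h ^ 8) / |(s : ℝ)| + 1)) (by positivity)
        (hD.harmonic (pow_le_bound hh (by norm_num) (by norm_num))) ?_ ?_).mono ?_
      · rintro ω ⟨⟨⟨⟨d, -, hc, -⟩, -⟩, -⟩, -⟩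
        exact ⟨left_ne_zero_of_mul d.vs_ne, d.v_abs_le hh hc⟩
      · intro v hv0 _
        have hA : 0 ≤ 100 * (h ^ 3 * |s| + h ^ 8) := by positivity
        have hY : ∀ ω₁ ω₂ : DiffVec, IsDiff h ω₁ → IsDiff h ω₂ →
            4 * ω₁.β ^ 2 * (ω₁.v * ω₁.s) + 3 * ω₁.a * ω₁.c = 0 →
            4 * ω₂.β ^ 2 * (ω₂.v * ω₂.s) + 3 * ω₂.a * ω₂.c = 0 → ω₁.a ≠ 0 → ω₂.c ≠ 0 →
            ω₁.v = ω₂.v → ω₁.s = ω₂.s → ω₁.β = ω₂.β →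
            27 * ω₁.a / ω₁.s = 27 * ω₂.a / ω₂.s → ω₁.X = ω₂.X →
            |ω₂.v| * |ω₁.Y - ω₂.Y| ≤ 14418 * h ^ 6 := by
          intro ω₁ ω₂ d₁ d₂ hE₁ hE₂ ha hc hv hs hβ hx hX
          obtain ⟨haa, hcc⟩ := ac_eq_of_disc_zero d₁ d₂ hE₁ hE₂ ha hv hs hβ hx
          have h1 := c_mul_Y_sub_le hh d₁ d₂ hX haa hcc hv hs hβ
          have h2 : |ω₂.v| ≤ |27 * ω₂.c| :=
            Int.le_of_dvd (by positivity) ((abs_dvd_abs _ _).2 d₂.v_dvd)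
          rw [abs_mul, abs_of_nonneg (by norm_num : (0 : ℤ) ≤ 27)] at h2
          have h3 := mul_le_mul_of_nonneg_right h2 (abs_nonneg (ω₁.Y - ω₂.Y))
          linarith
        refine (CardBound.cases
          (fun ω => 0 ≤ 2 * (3 * ω.a) * ω.X + -(4 * (ω.v * ω.s) * ω.β))
          (CardBound.interval (fun ω => ω.X) s (100 * (h ^ 3 * |s| + h ^ 8)) hs0 hA ?_ fun x =>
            CardBound.interval (fun ω => ω.Y) v (14418 * h ^ 6) hv0 (by omega) ?_
            fun y => CardBound.of_subsingleton ?_)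
          (CardBound.interval (fun ω => ω.X) s (100 * (h ^ 3 * |s| + h ^ 8)) hs0 hA ?_ fun x =>
            CardBound.interval (fun ω => ω.Y) v (14418 * h ^ 6) hv0 (by omega) ?_
            fun y => CardBound.of_subsingleton ?_)).mono (le_of_eq ?_)
        · rintro ω₁ ω₂ ⟨⟨⟨⟨⟨⟨d, ha, hc, -, hE⟩, hβ⟩, hx⟩, hs⟩, hv⟩, hsg⟩
            ⟨⟨⟨⟨⟨⟨d', ha', hc', -, hE'⟩, hβ'⟩, hx'⟩, hs'⟩, hv'⟩, hsg'⟩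
          obtain ⟨haa, hcc⟩ := ac_eq_of_disc_zero d d' hE hE' ha (by omega) (by omega) (by omega)
            (by omega)
          rw [← hs]
          exact X_sub_le_of_disc_zero hh d d' ha haa.symm hcc.symm (by omega) (by omega) (by omega)
            (mul_nonneg hsg hsg')
        · rintro ω₁ ω₂ ⟨⟨⟨⟨⟨⟨⟨d, ha, hc, -, hE⟩, hβ⟩, hx⟩, hs⟩, hv⟩, -⟩, hX⟩
            ⟨⟨⟨⟨⟨⟨⟨d', ha', hc', -, hE'⟩, hβ'⟩, hx'⟩, hs'⟩, hv'⟩, -⟩, hX'⟩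
          rw [← hv']
          exact hY ω₁ ω₂ d d' hE hE' ha hc' (by omega) (by omega) (by omega) (by omega) (by omega)
        · rintro ω₁ ω₂ ⟨⟨⟨⟨⟨⟨⟨⟨d, ha, hc, -, hE⟩, hβ⟩, hx⟩, hs⟩, hv⟩, -⟩, hX⟩, hy⟩
            ⟨⟨⟨⟨⟨⟨⟨⟨d', ha', hc', -, hE'⟩, hβ'⟩, hx'⟩, hs'⟩, hv'⟩, -⟩, hX'⟩, hy'⟩
          obtain ⟨haa, hcc⟩ := ac_eq_of_disc_zero d d' hE hE' ha (by omega) (by omega) (by omega)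
            (by omega)
          ext <;> omega
        · rintro ω₁ ω₂ ⟨⟨⟨⟨⟨⟨d, ha, hc, -, hE⟩, hβ⟩, hx⟩, hs⟩, hv⟩, hsg⟩
            ⟨⟨⟨⟨⟨⟨d', ha', hc', -, hE'⟩, hβ'⟩, hx'⟩, hs'⟩, hv'⟩, hsg'⟩
          obtain ⟨haa, hcc⟩ := ac_eq_of_disc_zero d d' hE hE' ha (by omega) (by omega) (by omega)
            (by omega)
          rw [← hs]
          exact X_sub_le_of_disc_zero hh d d' ha haa.symm hcc.symm (by omega) (by omega) (by omega)
            (mul_nonneg_of_nonpos_of_nonpos (not_le.1 hsg).le (not_le.1 hsg').le)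
        · rintro ω₁ ω₂ ⟨⟨⟨⟨⟨⟨⟨d, ha, hc, -, hE⟩, hβ⟩, hx⟩, hs⟩, hv⟩, -⟩, hX⟩
            ⟨⟨⟨⟨⟨⟨⟨d', ha', hc', -, hE'⟩, hβ'⟩, hx'⟩, hs'⟩, hv'⟩, -⟩, hX'⟩
          rw [← hv']
          exact hY ω₁ ω₂ d d' hE hE' ha hc' (by omega) (by omega) (by omega) (by omega) (by omega)
        · rintro ω₁ ω₂ ⟨⟨⟨⟨⟨⟨⟨⟨d, ha, hc, -, hE⟩, hβ⟩, hx⟩, hs⟩, hv⟩, -⟩, hX⟩, hy⟩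
            ⟨⟨⟨⟨⟨⟨⟨⟨d', ha', hc', -, hE'⟩, hβ'⟩, hx'⟩, hs'⟩, hv'⟩, -⟩, hX'⟩, hy'⟩
          obtain ⟨haa, hcc⟩ := ac_eq_of_disc_zero d d' hE hE' ha (by omega) (by omega) (by omega)
            (by omega)
          ext <;> omega
        · push_cast
          ring
      · push_cast
        have e1 : 100 * ((h : ℝ) ^ 3 * |(s : ℝ)| + h ^ 8) / |(s : ℝ)| + 1 ≤
            101 * h ^ 3 + 100 * h ^ 8 / |(s : ℝ)| := by
          have : 100 * ((h : ℝ) ^ 3 * |(s : ℝ)| + h ^ 8) / |(s : ℝ)| =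
              100 * h ^ 3 + 100 * h ^ 8 / |(s : ℝ)| := by
            field_simp
          have : (1 : ℝ) ≤ h ^ 3 := one_le_pow₀ hhR
          linarith
        have := mul_le_mul_of_nonneg_left e1
          (by positivity : 0 ≤ 4 * (14418 * (h : ℝ) ^ 6 * D + 972 * h ^ 6))
        refine le_trans (le_of_eq ?_) (this.trans (le_of_eq ?_)) <;> ring
    · push_cast
      ring
  · obtain ⟨d, hd0, rfl⟩ : ∃ d : ℝ, 0 ≤ d ∧ D = 1 + d := ⟨D - 1, by linarith, by ring⟩
    rw [← sub_nonneg]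
    ring_nf
    positivity

/-- The number of difference vectors. -/
theorem card_diff (hh : 1 ≤ h) (hD : DivisorBound (10 ^ 9 * h ^ 40) D) :
    CardBound (IsDiff h) (10 ^ 14 * D ^ 3 * h ^ 15) := by
  have hD1 := hD.one_le
  have hhR : (1 : ℝ) ≤ h := by exact_mod_cast hh
  refine (CardBound.cases (fun ω => ω.c = 0) (card_diff_c_zero hh hD) <|
    CardBound.cases (fun ω => ω.a = 0) ((card_diff_c_zero hh hD).swap ?_) <|
    CardBound.cases (fun ω => |ω.X| ≤ h ^ 2) ((card_diff_X_small hh hD).imp ?_) <|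
    CardBound.cases (fun ω => |ω.Y| ≤ h ^ 2) ((card_diff_X_small hh hD).swap ?_) <|
    CardBound.cases (fun ω => |ω.v * ω.s| ≤ h ^ 8)
      (CardBound.cases (fun ω => |ω.s| ≤ |ω.v|) ((card_diff_vs_small hh hD).imp ?_)
        ((card_diff_vs_small hh hD).swap ?_)) <|
    CardBound.cases (fun ω => 4 * ω.β ^ 2 * (ω.v * ω.s) + 3 * ω.a * ω.c = 0)
      (CardBound.cases (fun ω => |ω.s| ≤ |ω.v|) ((card_diff_disc_zero hh hD).imp ?_)
        ((card_diff_disc_zero hh hD).swap ?_))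
      (CardBound.cases (fun ω => |ω.X| ≤ |ω.Y|) ((card_diff_disc_ne_zero hh hD).imp ?_)
        ((card_diff_disc_ne_zero hh hD).swap ?_))).mono ?_
  · rintro ω ⟨⟨d, -⟩, ha⟩
    exact ⟨d.swap, ha⟩
  · rintro ω ⟨⟨⟨d, hc⟩, ha⟩, hX⟩
    exact ⟨d, ha, hc, hX⟩
  · rintro ω ⟨⟨⟨⟨d, hc⟩, ha⟩, -⟩, hY⟩
    exact ⟨d.swap, hc, ha, hY⟩
  · rintro ω ⟨⟨⟨⟨⟨⟨d, hc⟩, ha⟩, hX⟩, hY⟩, hm⟩, hsv⟩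
    exact ⟨d, hc, not_le.1 hX, not_le.1 hY, hm, hsv⟩
  · rintro ω ⟨⟨⟨⟨⟨⟨d, hc⟩, ha⟩, hX⟩, hY⟩, hm⟩, hsv⟩
    exact ⟨d.swap, ha, not_le.1 hY, not_le.1 hX, by rwa [mul_comm] at hm, (not_le.1 hsv).le⟩
  · rintro ω ⟨⟨⟨⟨⟨⟨⟨d, hc⟩, ha⟩, hX⟩, hY⟩, hm⟩, hE⟩, hsv⟩
    exact ⟨d, ha, hc, hsv, hE⟩
  · rintro ω ⟨⟨⟨⟨⟨⟨⟨d, hc⟩, ha⟩, hX⟩, hY⟩, hm⟩, hE⟩, hsv⟩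
    refine ⟨d.swap, hc, ha, (not_le.1 hsv).le, ?_⟩
    simp only [DiffVec.swap]
    linarith
  · rintro ω ⟨⟨⟨⟨⟨⟨⟨d, hc⟩, ha⟩, hX⟩, hY⟩, hm⟩, hE⟩, hXY⟩
    exact ⟨d, ha, hc, hXY, not_le.1 hm, hE⟩
  · rintro ω ⟨⟨⟨⟨⟨⟨⟨d, hc⟩, ha⟩, hX⟩, hY⟩, hm⟩, hE⟩, hXY⟩
    refine ⟨d.swap, hc, ha, (not_le.1 hXY).le, ?_, fun h0 => hE ?_⟩
    · rw [mul_comm] at hm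
      exact not_le.1 hm
    · simp only [DiffVec.swap] at h0
      linarith
  · have h1 : 0 ≤ D ^ 3 * h ^ 15 := by positivity
    linarith

end DiffBounds

section Representations

variable {D : ℝ} {M : ℤ}

theorem det_sq_lt {n x z x' z' : ℤ} (hn : 0 < n) (h : x ^ 2 + 3 * z ^ 2 = n)
    (h' : x' ^ 2 + 3 * z' ^ 2 = n) : |x * z' - x' * z| < n := by
  have h1 : n ^ 2 = (x * x' + 3 * z * z') ^ 2 + 3 * (x * z' - x' * z) ^ 2 := by
    rw [sq n]
    nth_rewrite 1 [← h]
    rw [← h']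
    ring
  refine abs_lt_of_sq_lt_sq ?_ hn.le
  have := sq_nonneg (x * x' + 3 * z * z')
  by_contra hc
  push Not at hc
  have : 0 < n ^ 2 := by positivity
  nlinarith

theorem isCoprime_of_primitive {n x z : ℤ} (h : x ^ 2 + 3 * z ^ 2 = n) (hc : IsCoprime x z) :
    IsCoprime z n := by
  rw [← h, show x ^ 2 + 3 * z ^ 2 = x ^ 2 + z * (3 * z) by ring]
  exact IsCoprime.add_mul_left_right (hc.symm.pow_right) _

/-- Two primitive representations with the same relative position to a third have a determinant
divisible by nearly `n`. -/
theorem dvd_twelve_mul_det {n x₀ z₀ x z x' z' : ℤ} (hn : 0 < n) (h₀ : x₀ ^ 2 + 3 * z₀ ^ 2 = n)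
    (h : x ^ 2 + 3 * z ^ 2 = n) (h' : x' ^ 2 + 3 * z' ^ 2 = n) (c₀ : IsCoprime x₀ z₀)
    (c : IsCoprime x z)
    (hg : Int.gcd n (x * z₀ - x₀ * z) = Int.gcd n (x' * z₀ - x₀ * z')) :
    n ∣ 12 * (x * z' - x' * z) := by
  set g := Int.gcd n (x * z₀ - x₀ * z) with hgdef
  have hgpos : 0 < g := Int.gcd_pos_of_ne_zero_left _ hn.ne'
  obtain ⟨q, hq⟩ : (g : ℤ) ∣ n := Int.gcd_dvd_left _ _
  have plus : ∀ {u w : ℤ}, u ^ 2 + 3 * w ^ 2 = n → Int.gcd n (u * z₀ - x₀ * w) = g →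
      q ∣ u * z₀ + x₀ * w := by
    intro u w hu hgu
    have h1 : n ∣ (u * z₀ - x₀ * w) * (u * z₀ + x₀ * w) := by
      refine ⟨z₀ ^ 2 - w ^ 2, ?_⟩
      have : (u * z₀ - x₀ * w) * (u * z₀ + x₀ * w) = u ^ 2 * z₀ ^ 2 - x₀ ^ 2 * w ^ 2 := by ring
      rw [this, show u ^ 2 = n - 3 * w ^ 2 by linarith, show x₀ ^ 2 = n - 3 * z₀ ^ 2 by linarith]
      ring
    obtain ⟨A, hA⟩ : (g : ℤ) ∣ u * z₀ - x₀ * w := hgu ▸ Int.gcd_dvd_right _ _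
    have hg0 : (g : ℤ) ≠ 0 := by exact_mod_cast hgpos.ne'
    have h2 : q ∣ A * (u * z₀ + x₀ * w) := by
      rw [hA] at h1
      nth_rewrite 1 [hq] at h1
      rw [mul_assoc] at h1
      exact Int.dvd_of_mul_dvd_mul_left hg0 h1
    have hco : IsCoprime q A := by
      have h3 : (g : ℤ) * Int.gcd q A = g := by
        have := Int.gcd_mul_left (g : ℤ) q A
        rw [← hq, ← hA, hgu] at this
        simp at this
        exact_mod_cast this.symm
      rw [Int.isCoprime_iff_gcd_eq_one]
      have h4 : (g : ℤ) * Int.gcd q A = g * 1 := by rw [h3, mul_one]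
      exact_mod_cast mul_left_cancel₀ hg0 h4
    exact hco.dvd_of_dvd_mul_left h2
  have hz₀ := isCoprime_of_primitive h₀ c₀
  have hz := isCoprime_of_primitive h c
  have hgW : (g : ℤ) ∣ x * z' - x' * z := by
    have h1 : (g : ℤ) ∣ x * z₀ - x₀ * z := Int.gcd_dvd_right _ _
    have h2 : (g : ℤ) ∣ x' * z₀ - x₀ * z' := hg ▸ Int.gcd_dvd_right _ _
    have h3 : (g : ℤ) ∣ z₀ * (x * z' - x' * z) := by
      rw [show z₀ * (x * z' - x' * z) = (x * z₀ - x₀ * z) * z' - (x' * z₀ - x₀ * z') * z by ring]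
      exact dvd_sub (h1.mul_right _) (h2.mul_right _)
    exact ((hz₀.of_isCoprime_of_dvd_right ⟨q, hq⟩).symm).dvd_of_dvd_mul_left h3
  have hp := plus h rfl
  have hp' := plus h' hg.symm
  have hqn : q ∣ n := ⟨g, by rw [hq, mul_comm]⟩
  have hqW : q ∣ x * z' - x' * z := by
    have h3 : q ∣ z₀ * (x * z' - x' * z) := by
      rw [show z₀ * (x * z' - x' * z) = (x * z₀ + x₀ * z) * z' - (x' * z₀ + x₀ * z') * z by ring]
      exact dvd_sub (hp.mul_right _) (hp'.mul_right _)
    exact ((hz₀.of_isCoprime_of_dvd_right hqn).symm).dvd_of_dvd_mul_left h3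
  obtain ⟨W, hW⟩ := hgW
  have hr : (Int.gcd g q : ℤ) ∣ 12 := by
    set r := (Int.gcd g q : ℤ)
    have r1 : r ∣ x * z₀ - x₀ * z := (Int.gcd_dvd_left _ _).trans (Int.gcd_dvd_right _ _)
    have r2 : r ∣ x * z₀ + x₀ * z := (Int.gcd_dvd_right _ _).trans hp
    have rn : r ∣ n := (Int.gcd_dvd_right _ _).trans hqn
    have r3 : r ∣ z₀ * (2 * x) := by
      rw [show z₀ * (2 * x) = (x * z₀ - x₀ * z) + (x * z₀ + x₀ * z) by ring]
      exact dvd_add r1 r2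
    have r4 : r ∣ 2 * x := ((hz₀.of_isCoprime_of_dvd_right rn).symm).dvd_of_dvd_mul_left r3
    have r5 : r ∣ z ^ 2 * 12 := by
      rw [show z ^ 2 * 12 = 4 * n - 2 * x * (2 * x) by rw [← h]; ring]
      exact dvd_sub (rn.mul_left _) (r4.mul_right _)
    exact ((hz.of_isCoprime_of_dvd_right rn).pow_left.symm).dvd_of_dvd_mul_left r5
  obtain ⟨e, he⟩ := hr
  obtain ⟨V, hV⟩ := hqW
  have hbez := Int.gcd_eq_gcd_ab g q
  rw [show 12 * (x * z' - x' * z) =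
    e * (g * (x * z' - x' * z) * Int.gcdA g q + q * (x * z' - x' * z) * Int.gcdB g q) by
      rw [he, hbez]; ring]
  refine Dvd.dvd.mul_left (dvd_add ?_ ?_) _
  · rw [hV, hq]
    exact ⟨V * Int.gcdA g q, by ring⟩
  · rw [hW, hq]
    exact ⟨W * Int.gcdB g q, by ring⟩

theorem card_primitive (hD : DivisorBound M D) {n : ℤ} (hn : 0 < n) (hM : n ≤ M) :
    CardBound (fun p : ℤ × ℤ => p.1 ^ 2 + 3 * p.2 ^ 2 = n ∧ IsCoprime p.1 p.2) (144 * D) := by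
  have hD1 := hD.one_le
  by_cases hex : ∃ p : ℤ × ℤ, p.1 ^ 2 + 3 * p.2 ^ 2 = n ∧ IsCoprime p.1 p.2
  swap
  · push Not at hex
    exact CardBound.of_false (fun x hx => hex x hx.1 hx.2) (by linarith)
  obtain ⟨⟨x₀, z₀⟩, h₀, c₀⟩ := hex
  refine (CardBound.divisor (fun p => (Int.gcd n (p.1 * z₀ - x₀ * p.2) : ℤ)) n hn.ne'
    (hD.divisors hn.ne' (by rwa [abs_of_pos hn])) (fun p _ => Int.gcd_dvd_left _ _)
    fun g _ => CardBound.mono (K := 3 * (12 : ℤ) * (1 + 1)) ?_ le_rfl).mono (le_of_eq ?_)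
  · by_cases hex : ∃ p : ℤ × ℤ, (p.1 ^ 2 + 3 * p.2 ^ 2 = n ∧ IsCoprime p.1 p.2) ∧
      (Int.gcd n (p.1 * z₀ - x₀ * p.2) : ℤ) = g
    swap
    · push Not at hex
      exact CardBound.of_false (fun x hx => hex x hx.1 hx.2) (by norm_num)
    obtain ⟨⟨x₁, z₁⟩, ⟨h₁, c₁⟩, hg₁⟩ := hex
    have hdvd : ∀ p : ℤ × ℤ, ((p.1 ^ 2 + 3 * p.2 ^ 2 = n ∧ IsCoprime p.1 p.2) ∧
        (Int.gcd n (p.1 * z₀ - x₀ * p.2) : ℤ) = g) → n ∣ 12 * (p.1 * z₁ - x₁ * p.2) := by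
      rintro p ⟨⟨h, c⟩, hg⟩
      refine dvd_twelve_mul_det hn h₀ h h₁ c₀ c ?_
      have := hg.trans hg₁.symm
      exact_mod_cast this
    have hsub : ∀ p p' : ℤ × ℤ, p.1 ^ 2 + 3 * p.2 ^ 2 = n → p'.1 ^ 2 + 3 * p'.2 ^ 2 = n →
        p.1 * z₁ - x₁ * p.2 = p'.1 * z₁ - x₁ * p'.2 →
        0 ≤ (p.1 * x₁ + 3 * p.2 * z₁) * (p'.1 * x₁ + 3 * p'.2 * z₁) → p = p' := by
      intro p p' h h' hW hV
      have e1 : (p.1 * x₁ + 3 * p.2 * z₁) ^ 2 = (p'.1 * x₁ + 3 * p'.2 * z₁) ^ 2 := by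
        have e2 : (p.1 * x₁ + 3 * p.2 * z₁) ^ 2 + 3 * (p.1 * z₁ - x₁ * p.2) ^ 2 = n * n := by
          nth_rewrite 1 [← h]
          rw [← h₁]
          ring
        have e3 : (p'.1 * x₁ + 3 * p'.2 * z₁) ^ 2 + 3 * (p'.1 * z₁ - x₁ * p'.2) ^ 2 = n * n := by
          nth_rewrite 1 [← h']
          rw [← h₁]
          ring
        rw [hW] at e2
        linarith
      have e4 : p.1 * x₁ + 3 * p.2 * z₁ = p'.1 * x₁ + 3 * p'.2 * z₁ := by
        rcases sq_eq_sq_iff_eq_or_eq_neg.1 e1 with h | h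
        · exact h
        · rw [h] at hV ⊢
          nlinarith
      refine Prod.ext (mul_left_cancel₀ hn.ne' ?_) (mul_left_cancel₀ hn.ne' ?_)
      · rw [← h₁]
        linear_combination x₁ * e4 + 3 * z₁ * hW
      · rw [← h₁]
        linear_combination z₁ * e4 - x₁ * hW
    refine CardBound.box (fun p => 12 * (p.1 * z₁ - x₁ * p.2) / n) 12 (by norm_num) ?_ fun m _ =>
      CardBound.cases (fun p => 0 ≤ p.1 * x₁ + 3 * p.2 * z₁)
        (CardBound.of_subsingleton ?_) (CardBound.of_subsingleton ?_)
    · rintro p hp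
      have h1 := det_sq_lt hn hp.1.1 h₁
      obtain ⟨m, hm⟩ := hdvd p hp
      rw [hm, Int.mul_ediv_cancel_left _ hn.ne']
      refine le_of_mul_le_mul_left ?_ hn
      have h2 : n * |m| = 12 * |p.1 * z₁ - x₁ * p.2| := by
        have h3 : |n * m| = 12 * |p.1 * z₁ - x₁ * p.2| := by
          rw [← hm, abs_mul, abs_of_nonneg (by norm_num : (0 : ℤ) ≤ 12)]
        rw [← h3, abs_mul, abs_of_pos hn]
      linarith
    all_goals
      rintro p p' ⟨⟨hp, hm⟩, hs⟩ ⟨⟨hp', hm'⟩, hs'⟩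
      have e1 := Int.mul_ediv_cancel' (hdvd p hp)
      have e2 := Int.mul_ediv_cancel' (hdvd p' hp')
      rw [hm] at e1
      rw [hm'] at e2
      refine hsub p p' hp.1.1 hp'.1.1 (by omega) ?_
    · exact mul_nonneg hs hs'
    · exact mul_nonneg_of_nonpos_of_nonpos (not_le.1 hs).le (not_le.1 hs').le
  · push_cast
    ring

theorem card_representations (hD : DivisorBound M D) {n : ℤ} (hn : 0 < n) (hM : n ≤ M) :
    CardBound (fun p : ℤ × ℤ => p.1 ^ 2 + 3 * p.2 ^ 2 = n) (288 * D ^ 2) := by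
  have hD1 := hD.one_le
  refine (CardBound.divisor (fun p => (Int.gcd p.1 p.2 : ℤ)) n hn.ne'
    (hD.divisors hn.ne' (by rwa [abs_of_pos hn])) ?_
    fun g _ => CardBound.mono (K := 144 * D) ?_ le_rfl).mono (le_of_eq (by ring))
  · rintro p rfl
    exact dvd_add ((Int.gcd_dvd_left _ _).pow two_ne_zero)
      (((Int.gcd_dvd_right _ _).pow two_ne_zero).mul_left 3)
  · have key : ∀ p : ℤ × ℤ, p.1 ^ 2 + 3 * p.2 ^ 2 = n ∧ (Int.gcd p.1 p.2 : ℤ) = g →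
        0 < g ∧ ∃ u w : ℤ, p.1 = g * u ∧ p.2 = g * w ∧ IsCoprime u w ∧
          n = g ^ 2 * (u ^ 2 + 3 * w ^ 2) := by
      rintro ⟨x, z⟩ ⟨h, hg⟩
      have hpos : 0 < Int.gcd x z := by
        refine Nat.pos_of_ne_zero fun h0 => ?_
        obtain ⟨rfl, rfl⟩ := Int.gcd_eq_zero_iff.1 h0
        simp at h
        omega
      obtain ⟨u, w, huw, hx, hz⟩ := Int.exists_gcd_one hpos
      simp only at hg h
      rw [hg] at hx hz
      refine ⟨by omega, u, w, hx.trans (mul_comm _ _), hz.trans (mul_comm _ _),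
        Int.isCoprime_iff_gcd_eq_one.2 huw, ?_⟩
      rw [← h, hx, hz]
      ring
    by_cases hex : ∃ p : ℤ × ℤ, p.1 ^ 2 + 3 * p.2 ^ 2 = n ∧ (Int.gcd p.1 p.2 : ℤ) = g
    swap
    · push Not at hex
      exact CardBound.of_false (fun x hx => hex x hx.1 hx.2) (by linarith)
    obtain ⟨p, hp⟩ := hex
    obtain ⟨hg, u, w, -, -, -, hn'⟩ := key p hp
    have hg2 : 0 < g ^ 2 := by positivity
    have hm : 0 < u ^ 2 + 3 * w ^ 2 := pos_of_mul_pos_right (hn' ▸ hn) hg2.le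
    refine (card_primitive hD hm (by nlinarith)).comap (fun p => (p.1 / g, p.2 / g)) ?_ ?_
    · intro p q hp hq hpq
      obtain ⟨-, u, w, h1, h2, -⟩ := key p hp
      obtain ⟨-, u', w', h1', h2', -⟩ := key q hq
      simp only [h1, h2, h1', h2', Int.mul_ediv_cancel_left _ hg.ne', Prod.mk.injEq] at hpq
      exact Prod.ext (by rw [h1, h1', hpq.1]) (by rw [h2, h2', hpq.2])
    · intro q hq
      obtain ⟨-, u', w', h1, h2, h3, h4⟩ := key q hq
      simp only [h1, h2, Int.mul_ediv_cancel_left _ hg.ne']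
      exact ⟨mul_left_cancel₀ hg2.ne' (h4.symm.trans hn'), h3⟩

/-- The number of `J` with `4 I ^ 3 - J ^ 2 = 27 y ^ 2` for some `y`. -/
theorem card_J (hD : DivisorBound M D) {I : ℤ} (hI : I ≠ 0) (hM : 4 * I ^ 3 ≤ M) :
    CardBound (fun J : ℤ => ∃ y : ℤ, 4 * I ^ 3 = J ^ 2 + 27 * y ^ 2) (288 * D ^ 2) := by
  have hD1 := hD.one_le
  by_cases hex : ∃ J y : ℤ, 4 * I ^ 3 = J ^ 2 + 27 * y ^ 2
  · obtain ⟨J, y, h⟩ := hex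
    have hpos : 0 < 4 * I ^ 3 := by
      refine lt_of_le_of_ne (h ▸ by positivity) (Ne.symm ?_)
      positivity
    classical
    refine (card_representations hD hpos hM).comap
      (fun J => (J, if h : ∃ y : ℤ, 4 * I ^ 3 = J ^ 2 + 27 * y ^ 2 then 3 * h.choose else 0))
      (fun x y _ _ hxy => congrArg Prod.fst hxy) fun J hJ => ?_
    have := hJ.choose_spec
    simp only [dif_pos hJ]
    linarith
  · push Not at hex
    refine CardBound.of_false (fun J hJ => ?_) (by positivity)
    obtain ⟨y, hy⟩ := hJ
    exact hex J y hy

end Representations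

/-- The integer quartic `X ^ 4 + a X ^ 3 + b X ^ 2 + c X + d`. -/
@[ext]
structure IntQuartic where
  (a b c d : ℤ)

namespace IntQuartic

instance : Inhabited IntQuartic := ⟨⟨0, 0, 0, 0⟩⟩

/-- The invariant of degree two. -/
def I (x : IntQuartic) : ℤ := 12 * x.d - 3 * x.a * x.c + x.b ^ 2

/-- The invariant of degree three. -/
def J (x : IntQuartic) : ℤ :=
  72 * x.b * x.d + 9 * x.a * x.b * x.c - 27 * x.c ^ 2 - 27 * x.a ^ 2 * x.d - 2 * x.b ^ 3

/-- The leading coefficient of the Hessian covariant, up to sign. -/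
def P (x : IntQuartic) : ℤ := 8 * x.b - 3 * x.a ^ 2

/-- The leading coefficient of the sextic covariant. -/
def Q (x : IntQuartic) : ℤ := 8 * x.c - 4 * x.a * x.b + x.a ^ 3

theorem syzygy (x : IntQuartic) : 27 * x.Q ^ 2 = -x.P ^ 3 + 48 * x.I * x.P - 64 * x.J := by
  simp only [I, J, P, Q]
  ring

/-- All coefficients are bounded by `B`. -/
structure InBox (B : ℤ) (x : IntQuartic) : Prop where
  a_le : |x.a| ≤ B
  b_le : |x.b| ≤ B
  c_le : |x.c| ≤ B
  d_le : |x.d| ≤ B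

/-- A pair of quartics of bounded height with the same invariants. -/
structure IsPair (h : ℤ) (p : IntQuartic × IntQuartic) : Prop where
  fst_box : p.1.InBox (h ^ 5)
  snd_box : p.2.InBox (h ^ 5)
  I_eq : p.1.I = p.2.I
  J_eq : p.1.J = p.2.J

variable {h : ℤ} {D : ℝ} {p q r : IntQuartic × IntQuartic}

/-- The greatest common divisor of the differences of the covariants of a pair. -/
def pairGcd (p : IntQuartic × IntQuartic) : ℤ := Int.gcd (p.1.P - p.2.P) (p.1.Q - p.2.Q)

/-- The data of a pair used to separate the pairs into classes. -/
def pairKey (p : IntQuartic × IntQuartic) : ℤ × ℤ × ℤ × ℤ :=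
  (p.1.a + p.2.a, p.1.a - p.2.a, pairGcd p, (p.1.P - p.2.P) / pairGcd p)

/-- The position of `p` relative to a pair `q` of the same class. -/
def pairDiff (q p : IntQuartic × IntQuartic) : DiffVec where
  X := p.1.a + p.2.a
  Y := p.1.a - p.2.a
  s := pairGcd p
  v := (p.1.P - p.2.P) / pairGcd p
  β := p.1.b + p.2.b - (q.1.b + q.2.b)
  a := 8 * (p.1.c - p.2.c - (q.1.c - q.2.c)) -
    2 * (p.1.a - p.2.a) * (p.1.b + p.2.b - (q.1.b + q.2.b))
  c := 8 * (p.1.c + p.2.c - (q.1.c + q.2.c)) -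
    2 * (p.1.a + p.2.a) * (p.1.b + p.2.b - (q.1.b + q.2.b))

theorem div_mul_pairGcd (p : IntQuartic × IntQuartic) :
    (p.1.P - p.2.P) / pairGcd p * pairGcd p = p.1.P - p.2.P :=
  Int.ediv_mul_cancel (Int.gcd_dvd_left _ _)

theorem pairGcd_dvd (p : IntQuartic × IntQuartic) : pairGcd p ∣ p.1.Q - p.2.Q :=
  Int.gcd_dvd_right _ _

theorem IsPair.dvd_Q_add (hp : IsPair h p) (hP : p.1.P ≠ p.2.P) :
    (p.1.P - p.2.P) / pairGcd p ∣ 27 * (p.1.Q + p.2.Q) := by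
  have hs : pairGcd p ≠ 0 := by
    intro h0
    exact hP (by have := div_mul_pairGcd p; rw [h0] at this; omega)
  have hco : IsCoprime ((p.1.P - p.2.P) / pairGcd p) ((p.1.Q - p.2.Q) / pairGcd p) :=
    Int.isCoprime_iff_gcd_eq_one.2 (Int.gcd_ediv_gcd_ediv_gcd
      (Int.gcd_pos_of_ne_zero_left _ (sub_ne_zero.2 hP)))
  refine hco.dvd_of_dvd_mul_left ⟨48 * p.1.I - (p.1.P ^ 2 + p.1.P * p.2.P + p.2.P ^ 2), ?_⟩
  refine mul_left_cancel₀ hs ?_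
  have h1 := div_mul_pairGcd p
  have h2 := Int.ediv_mul_cancel (pairGcd_dvd p)
  have h3 := syzygy p.1
  have h4 := syzygy p.2
  rw [← hp.I_eq, ← hp.J_eq] at h4
  linear_combination h3 - h4 + 27 * (p.1.Q + p.2.Q) * h2 -
    (48 * p.1.I - (p.1.P ^ 2 + p.1.P * p.2.P + p.2.P ^ 2)) * h1

theorem IsPair.isDiff (hp : IsPair h p) (hq : IsPair h q) (hP : p.1.P ≠ p.2.P)
    (hP' : q.1.P ≠ q.2.P) (hk : pairKey p = pairKey q)
    (hβ : |p.1.b + p.2.b - (q.1.b + q.2.b)| ≤ h) : IsDiff h (pairDiff q p) := by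
  have hvs := div_mul_pairGcd p
  have hvs' := div_mul_pairGcd q
  have hs := pairGcd_dvd p
  have hs' := pairGcd_dvd q
  have hv := hp.dvd_Q_add hP
  have hv' := hq.dvd_Q_add hP'
  simp only [pairKey, Prod.mk.injEq] at hk
  obtain ⟨k1, k2, k3, k4⟩ := hk
  rw [← k3] at hs' hvs' hv' k4
  rw [← k4] at hvs' hv'
  obtain ⟨⟨a, b, c, d⟩, ⟨a', b', c', d'⟩⟩ := p
  obtain ⟨⟨a₀, b₀, c₀, d₀⟩, ⟨a₀', b₀', c₀', d₀'⟩⟩ := q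
  simp only at k1 k2 hβ
  obtain rfl : a = a₀ := by omega
  obtain rfl : a' = a₀' := by omega
  have hbb : b - b' = b₀ - b₀' := by
    have := hvs.symm.trans hvs'
    simp only [P] at this
    linarith
  obtain ⟨⟨p1, p2, p3, p4⟩, ⟨p5, p6, p7, p8⟩, pI, -⟩ := hp
  obtain ⟨⟨q1, q2, q3, q4⟩, ⟨q5, q6, q7, q8⟩, qI, -⟩ := hq
  simp only [I] at p1 p2 p3 p4 p5 p6 p7 p8 q1 q2 q3 q4 q5 q6 q7 q8 pI qI
  rw [abs_le] at p1 p2 p3 p4 p5 p6 p7 p8 q1 q2 q3 q4 q5 q6 q7 q8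
  constructor
  · simp only [pairDiff]
    rw [abs_le]
    constructor <;> linarith
  · simp only [pairDiff]
    rw [abs_le]
    constructor <;> linarith
  · simp only [pairDiff]
    rw [hvs]
    exact sub_ne_zero.2 hP
  · simp only [pairDiff]
    rw [hvs]
    simp only [P]
    rw [show 8 * b - 3 * a ^ 2 - (8 * b' - 3 * a' ^ 2) + 3 * (a + a') * (a - a') =
      8 * (b - b') by ring, abs_le]
    constructor <;> linarith
  · exact hβ
  · refine Dvd.dvd.mul_left ?_ 27
    refine (dvd_sub hs hs').trans (dvd_of_eq ?_)
    simp only [pairDiff, Q]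
    linear_combination -2 * (a + a') * hbb
  · refine (dvd_sub hv hv').trans (dvd_of_eq ?_)
    simp only [pairDiff, Q]
    linear_combination -54 * (a - a') * hbb
  · simp only [pairDiff]
    rw [show ∀ y : ℤ, 8 * (c - c' - (c₀ - c₀')) - 2 * (a - a') * y + 2 * (a - a') * y =
      8 * (c - c' - (c₀ - c₀')) by intro y; ring, abs_le]
    constructor <;> linarith
  · simp only [pairDiff]
    rw [show ∀ y : ℤ, 8 * (c + c' - (c₀ + c₀')) - 2 * (a + a') * y + 2 * (a + a') * y =
      8 * (c + c' - (c₀ + c₀')) by intro y; ring, abs_le]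
    constructor <;> linarith
  · simp only [pairDiff]
    rw [hvs]
    have : 3 * (a + a') * (8 * (c - c' - (c₀ - c₀')) - 2 * (a - a') * (b + b' - (b₀ + b₀'))) +
        3 * (a - a') * (8 * (c + c' - (c₀ + c₀')) - 2 * (a + a') * (b + b' - (b₀ + b₀'))) +
        6 * (a + a') * (a - a') * (b + b' - (b₀ + b₀')) -
        2 * (8 * b - 3 * a ^ 2 - (8 * b' - 3 * a' ^ 2)) * (b + b' - (b₀ + b₀')) =
        192 * (d - d' - (d₀ - d₀')) := by
      linear_combination 16 * qI - 16 * pI + 16 * (b₀ + b₀') * hbb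
    simp only [P]
    rw [this, abs_le]
    constructor <;> linarith

theorem IsPair.ext (hp : IsPair h p) (hq : IsPair h q) (hP : p.1.P ≠ p.2.P)
    (he : pairDiff r p = pairDiff r q) : p = q := by
  have hvs := div_mul_pairGcd p
  have hvs' := div_mul_pairGcd q
  have hp1 := syzygy p.1
  have hp2 := syzygy p.2
  have hq1 := syzygy q.1
  have hq2 := syzygy q.2
  have pI := hp.I_eq
  have qI := hq.I_eq
  rw [← hp.I_eq, ← hp.J_eq] at hp2
  rw [← hq.I_eq, ← hq.J_eq] at hq2
  simp only [pairDiff, DiffVec.mk.injEq] at he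
  obtain ⟨e1, e2, e3, e4, e5, e6, e7⟩ := he
  rw [e2, e5] at e6
  rw [e1, e5] at e7
  rw [e3] at hvs e4
  rw [e4] at hvs
  have hPP := hvs.symm.trans hvs'
  have ha : p.1.a = q.1.a := by omega
  have ha' : p.2.a = q.2.a := by omega
  have hc : p.1.c = q.1.c := by omega
  have hc' : p.2.c = q.2.c := by omega
  have hb : p.1.b = q.1.b := by
    simp only [P, ha, ha'] at hPP
    omega
  have hb' : p.2.b = q.2.b := by omega
  have hPe : p.1.P = q.1.P := by simp only [P, ha, hb]
  have hPe' : p.2.P = q.2.P := by simp only [P, ha', hb']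
  have hQe : p.1.Q = q.1.Q := by simp only [Q, ha, hb, hc]
  have hQe' : p.2.Q = q.2.Q := by simp only [Q, ha', hb', hc']
  have hI : p.1.I = q.1.I := by
    refine mul_left_cancel₀ (sub_ne_zero.2 hP) (mul_left_cancel₀ (by norm_num : (48 : ℤ) ≠ 0) ?_)
    rw [← hPe, ← hQe] at hq1
    rw [← hPe', ← hQe'] at hq2
    linear_combination hq1 - hq2 - hp1 + hp2
  have hI' : p.2.I = q.2.I := by rw [← pI, hI, qI]
  simp only [I, ha, hb, hc] at hI
  simp only [I, ha', hb', hc'] at hI'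
  exact Prod.ext (IntQuartic.ext ha hb hc (by linarith)) (IntQuartic.ext ha' hb' hc' (by linarith))

/-- Pairs of quartics with the same invariants but different covariants. -/
theorem card_pairs_P_ne (hh : 1 ≤ h) (hD : DivisorBound (10 ^ 9 * h ^ 40) D) :
    CardBound (fun p => IsPair h p ∧ p.1.P ≠ p.2.P) (10 ^ 15 * D ^ 3 * h ^ 19) := by
  have hh4 : 1 ≤ h ^ 4 := one_le_pow₀ hh
  refine (CardBound.box (K := 10 ^ 14 * D ^ 3 * h ^ 15)
    (fun p : IntQuartic × IntQuartic => (p.1.b + p.2.b) / h) (2 * h ^ 4) (by linarith)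
    ?_ fun j _ => ?_).mono ?_
  · rintro p ⟨hp, -⟩
    have h1 := abs_le.1 hp.fst_box.b_le
    have h2 := abs_le.1 hp.snd_box.b_le
    rw [abs_le]
    constructor
    · exact (Int.le_ediv_iff_mul_le (by linarith)).2 (by linarith [pow_succ h 4])
    · exact Int.ediv_le_of_le_mul (by linarith) (by linarith [pow_succ h 4])
  · let R : ℤ × ℤ × ℤ × ℤ → IntQuartic × IntQuartic → Prop := fun t q =>
      ((IsPair h q ∧ q.1.P ≠ q.2.P) ∧ (q.1.b + q.2.b) / h = j) ∧ pairKey q = t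
    have hR : ∀ p, ((IsPair h p ∧ p.1.P ≠ p.2.P) ∧ (p.1.b + p.2.b) / h = j) →
        R (pairKey p) (Classical.epsilon (R (pairKey p))) :=
      fun p hp => Classical.epsilon_spec ⟨p, hp, rfl⟩
    refine (card_diff hh hD).comap (fun p => pairDiff (Classical.epsilon (R (pairKey p))) p) ?_ ?_
    · intro p q hp hq hpq
      have hk : pairKey p = pairKey q := by
        simp only [pairDiff, DiffVec.mk.injEq] at hpq
        exact Prod.ext hpq.1 (Prod.ext hpq.2.1 (Prod.ext hpq.2.2.1 hpq.2.2.2.1))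
      simp only [hk] at hpq
      exact hp.1.1.ext hq.1.1 hp.1.2 hpq
    · intro p hp
      obtain ⟨⟨hq, hj⟩, hk⟩ := hR p hp
      refine hp.1.1.isDiff hq.1 hp.1.2 hq.2 hk.symm ?_
      have h1 := Int.emod_nonneg (p.1.b + p.2.b) (by omega : h ≠ 0)
      have h2 := Int.emod_lt_of_pos (p.1.b + p.2.b) (by omega : 0 < h)
      have h3 := Int.emod_add_mul_ediv (p.1.b + p.2.b) h
      generalize Classical.epsilon (R (pairKey p)) = q at *
      have h4 := Int.emod_nonneg (q.1.b + q.2.b) (by omega : h ≠ 0)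
      have h5 := Int.emod_lt_of_pos (q.1.b + q.2.b) (by omega : 0 < h)
      have h6 := Int.emod_add_mul_ediv (q.1.b + q.2.b) h
      rw [hj] at h6
      rw [hp.2] at h3
      rw [abs_le]
      constructor <;> linarith
  · have hD1 := hD.one_le
    have hh' : (1 : ℝ) ≤ h := by exact_mod_cast hh
    have : 0 ≤ D ^ 3 * (h : ℝ) ^ 19 := by positivity
    push_cast
    nlinarith

/-- Quartics with the same invariants and the same quadratic covariant as a given one. -/
theorem card_P_eq (hh : 1 ≤ h) (x : IntQuartic) :
    CardBound (fun y => IsPair h (x, y) ∧ x.P = y.P) (24 * h ^ 3) := by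
  have hh3 : 1 ≤ h ^ 3 := one_le_pow₀ hh
  have hh5 : 0 ≤ h ^ 5 := by positivity
  have hh6 : h ^ 5 ≤ h ^ 6 := pow_le_pow_right₀ hh (by norm_num)
  have hsub : ∀ (R : IntQuartic → Prop), (∀ y y', R y → R y' → 0 ≤ y.a * y'.a) →
      CardBound (fun y => (IsPair h (x, y) ∧ x.P = y.P) ∧ R y) (2 * (3 * h ^ 3 : ℤ) * (1 + 1)) := by
    intro R hR
    refine CardBound.interval_one (fun y => y.a) (3 * h ^ 3) (by linarith) ?_ fun t =>
      CardBound.cases (fun y => y.Q = x.Q) (CardBound.of_subsingleton ?_)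
        (CardBound.of_subsingleton ?_)
    · rintro y y' ⟨⟨hy, hP⟩, hs⟩ ⟨⟨hy', hP'⟩, hs'⟩
      refine abs_le_of_sq_le_sq ?_ (by positivity)
      have h1 := abs_le.1 hy.snd_box.b_le
      have h2 := abs_le.1 hy'.snd_box.b_le
      have h3 := hR y y' hs hs'
      have h4 := hP.symm.trans hP'
      simp only [P] at h4 h1 h2
      rw [mul_pow, show (h ^ 3) ^ 2 = h ^ 6 by ring]
      rcases le_total (|y.a|) (|y'.a|) with h5 | h5
      · have h6 : y.a ^ 2 ≤ y.a * y'.a := by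
          rw [← abs_of_nonneg h3, abs_mul, ← sq_abs, sq]
          exact mul_le_mul_of_nonneg_left h5 (abs_nonneg _)
        nlinarith
      · have h6 : y'.a ^ 2 ≤ y.a * y'.a := by
          rw [← abs_of_nonneg h3, abs_mul, ← sq_abs, sq]
          exact mul_le_mul_of_nonneg_right h5 (abs_nonneg _)
        nlinarith
    all_goals
      rintro y y' ⟨⟨⟨⟨hy, hP⟩, -⟩, ha⟩, hQ⟩ ⟨⟨⟨⟨hy', hP'⟩, -⟩, ha'⟩, hQ'⟩
      have e1 : y.a = y'.a := ha.trans ha'.symm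
      have e2 : y.b = y'.b := by
        have := hP.symm.trans hP'
        simp only [P, e1] at this
        linarith
      have e3 : y.Q = y'.Q := by
        first
        | exact hQ.trans hQ'.symm
        | have h1 : ∀ z : IntQuartic, IsPair h (x, z) → x.P = z.P → ¬ z.Q = x.Q → z.Q = -x.Q := by
            intro z hz hPz hQz
            have s1 := syzygy x
            have s2 := syzygy z
            have s3 := hz.I_eq
            have s4 := hz.J_eq
            simp only at s3 s4
            rw [← s3, ← s4, ← hPz] at s2
            exact (sq_eq_sq_iff_eq_or_eq_neg.1 (by linarith)).resolve_left hQz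
          rw [h1 y hy hP hQ, h1 y' hy' hP' hQ']
      have e4 : y.c = y'.c := by
        simp only [Q, e1, e2] at e3
        linarith
      have e5 := hy.I_eq.symm.trans hy'.I_eq
      simp only [I, e1, e2, e4] at e5
      exact IntQuartic.ext e1 e2 e4 (by linarith)
  refine (CardBound.cases (fun y => 0 ≤ y.a) (hsub _ ?_) (hsub _ ?_)).mono (le_of_eq ?_)
  · exact fun y y' hy hy' => mul_nonneg hy hy'
  · exact fun y y' hy hy' => mul_nonneg_of_nonpos_of_nonpos (not_le.1 hy).le (not_le.1 hy').le
  · push_cast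
    ring

/-- Quartics of bounded height whose discriminant is a nonzero square. -/
structure IsGood (h : ℤ) (x : IntQuartic) : Prop where
  box : x.InBox (h ^ 5)
  I_ne : x.I ≠ 0
  disc_sq : ∃ y : ℤ, 4 * x.I ^ 3 = x.J ^ 2 + 27 * y ^ 2

theorem card_invariants (hh : 1 ≤ h) (hD : DivisorBound (10 ^ 9 * h ^ 40) D) :
    CardBound (fun t : ℤ × ℤ => |t.1| ≤ 16 * h ^ 10 ∧ t.1 ≠ 0 ∧
      ∃ y : ℤ, 4 * t.1 ^ 3 = t.2 ^ 2 + 27 * y ^ 2) (13824 * D ^ 2 * h ^ 10) := by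
  have hh10 : 1 ≤ h ^ 10 := one_le_pow₀ hh
  refine (CardBound.box (K := 288 * D ^ 2) (fun t : ℤ × ℤ => t.1) (16 * h ^ 10) (by linarith)
    (fun t ht => ht.1) fun i hi => ?_).mono (le_of_eq (by push_cast; ring))
  rcases eq_or_ne i 0 with rfl | hi0
  · exact CardBound.of_false (fun t ht => ht.1.2.1 ht.2) (by positivity)
  refine (card_J hD hi0 ?_).comap (fun t => t.2) ?_ ?_
  · have h1 : i ^ 3 ≤ (16 * h ^ 10) ^ 3 :=
      (le_abs_self _).trans (by rw [abs_pow]; exact pow_le_pow_left₀ (abs_nonneg _) hi 3)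
    have h2 := pow_le_bound hh (C := 16384) (k := 30) (by norm_num) (by norm_num)
    nlinarith
  · rintro t t' ⟨-, ht⟩ ⟨-, ht'⟩ he
    exact Prod.ext (ht.trans ht'.symm) he
  · rintro t ⟨⟨-, -, ht⟩, rfl⟩
    exact ht

theorem IsGood.I_le {x : IntQuartic} (hh : 1 ≤ h) (hx : IsGood h x) : |x.I| ≤ 16 * h ^ 10 := by
  have h1 : |x.a * x.c| ≤ h ^ 5 * h ^ 5 := by
    rw [abs_mul]
    exact mul_le_mul hx.box.a_le hx.box.c_le (abs_nonneg _) (by positivity)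
  have h2 : x.b ^ 2 ≤ h ^ 5 * h ^ 5 := by
    rw [← sq_abs, sq]
    exact mul_le_mul hx.box.b_le hx.box.b_le (abs_nonneg _) (by positivity)
  have h3 := abs_le.1 hx.box.d_le
  have h4 : h ^ 5 ≤ h ^ 10 := pow_le_pow_right₀ hh (by norm_num)
  have h5 : h ^ 5 * h ^ 5 = h ^ 10 := by ring
  have h6 := sq_nonneg x.b
  rw [abs_le] at h1 ⊢
  simp only [I]
  constructor <;> linarith

/-- The key count: at scale `h` there are `O(h ^ (29 / 2))` quartics of height at most `h ^ 5`
whose discriminant is a square, up to divisor functions. -/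
theorem card_good (hh : 1 ≤ h) (hD : DivisorBound (10 ^ 9 * h ^ 40) D) :
    CardBound (IsGood h) (√(10 ^ 20 * D ^ 6 * h ^ 29)) := by
  classical
  intro S hS
  have hD1 := hD.one_le
  have hh' : (1 : ℝ) ≤ h := by exact_mod_cast hh
  let key : IntQuartic → ℤ × ℤ := fun x => (x.I, x.J)
  let U := (S ×ˢ S).filter fun p => key p.1 = key p.2
  have hU : (U.card : ℝ) ≤ S.card * (24 * h ^ 3) + 10 ^ 15 * D ^ 3 * h ^ 19 := by
    have hpair : ∀ p ∈ U, p.1 ∈ S ∧ IsPair h p := by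
      intro p hp
      obtain ⟨h1, h2⟩ := Finset.mem_filter.1 hp
      obtain ⟨h3, h4⟩ := Finset.mem_product.1 h1
      exact ⟨h3, (hS _ h3).box, (hS _ h4).box, congrArg Prod.fst h2, congrArg Prod.snd h2⟩
    refine CardBound.cases (P := fun p => p.1 ∈ S ∧ IsPair h p) (fun p => p.1.P = p.2.P) ?_
      ((card_pairs_P_ne hh hD).imp fun p hp => ⟨hp.1.2, hp.2⟩) U hpair
    refine CardBound.fiber_const (fun p => p.1) S (fun p hp => hp.1.1) fun x _ => ?_
    refine (card_P_eq hh x).comap (fun p => p.2) ?_ ?_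
    · rintro p q ⟨-, hp⟩ ⟨-, hq⟩ he
      exact Prod.ext (hp.trans hq.symm) he
    · rintro p ⟨⟨⟨-, hp⟩, hP⟩, rfl⟩
      exact ⟨hp, hP⟩
  have hV : ((S.image key).card : ℝ) ≤ 13824 * D ^ 2 * h ^ 10 := by
    refine card_invariants hh hD _ fun t ht => ?_
    obtain ⟨x, hx, rfl⟩ := Finset.mem_image.1 ht
    exact ⟨(hS x hx).I_le hh, (hS x hx).I_ne, (hS x hx).disc_sq⟩
  have hCS : (S.card : ℝ) ^ 2 ≤ (S.image key).card * U.card := by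
    have h1 : S.card = ∑ t ∈ S.image key, (S.filter fun x => key x = t).card :=
      Finset.card_eq_sum_card_fiberwise fun x hx => Finset.mem_image_of_mem _ hx
    have h2 : U.card = ∑ t ∈ S.image key, (S.filter fun x => key x = t).card ^ 2 := by
      rw [Finset.card_eq_sum_card_fiberwise (f := fun p => key p.1) (t := S.image key)]
      · refine Finset.sum_congr rfl fun t _ => ?_
        rw [sq, ← Finset.card_product]
        congr 1
        ext p
        simp only [U, Finset.mem_filter, Finset.mem_product]
        constructor
        · rintro ⟨⟨⟨h1, h2⟩, h3⟩, h4⟩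
          exact ⟨⟨h1, h4⟩, h2, h3 ▸ h4⟩
        · rintro ⟨⟨h1, h4⟩, h2, h3⟩
          exact ⟨⟨⟨h1, h2⟩, h4.trans h3.symm⟩, h4⟩
      · intro p hp
        exact Finset.mem_image_of_mem _ (Finset.mem_product.1 (Finset.mem_filter.1 hp).1).1
    rw [h2]
    nth_rewrite 1 [h1]
    exact_mod_cast sq_sum_le_card_mul_sum_sq
  refine Real.le_sqrt_of_sq_le ?_
  set N : ℝ := (S.card : ℝ) with hN
  have hN0 : 0 ≤ N := Nat.cast_nonneg _
  have hkey : N ^ 2 ≤ 13824 * D ^ 2 * h ^ 10 * (N * (24 * h ^ 3) + 10 ^ 15 * D ^ 3 * h ^ 19) :=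
    hCS.trans (mul_le_mul hV hU (Nat.cast_nonneg _) (by positivity))
  have hle : D ^ 4 * (h : ℝ) ^ 26 ≤ D ^ 6 * (h : ℝ) ^ 29 :=
    mul_le_mul (pow_le_pow_right₀ hD1 (by norm_num)) (pow_le_pow_right₀ hh' (by norm_num))
      (by positivity) (by positivity)
  have hle' : D ^ 5 * (h : ℝ) ^ 29 ≤ D ^ 6 * (h : ℝ) ^ 29 :=
    mul_le_mul_of_nonneg_right (pow_le_pow_right₀ hD1 (by norm_num)) (by positivity)
  have hpos : 0 ≤ D ^ 6 * (h : ℝ) ^ 29 := by positivity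
  have hsq : N * (331776 * D ^ 2 * h ^ 13) ≤
      N ^ 2 / 2 + 331776 ^ 2 / 2 * (D ^ 4 * h ^ 26) := by
    nlinarith [sq_nonneg (N - 331776 * D ^ 2 * h ^ 13)]
  nlinarith

end IntQuartic

theorem exists_card_divisors_le {δ : ℝ} (hδ : 0 < δ) :
    ∃ C : ℝ, 1 ≤ C ∧ ∀ n : ℕ, 0 < n → (n.divisors.card : ℝ) ≤ C * (n : ℝ) ^ δ := by
  obtain ⟨N, hN⟩ := exists_nat_ge ((2 : ℝ) ^ (1 / δ))
  have hl : 0 < Real.log 2 := Real.log_pos one_lt_two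
  set c : ℝ := 1 + 1 / (δ * Real.log 2) with hc
  have hc1 : 1 ≤ c := by
    rw [hc]
    have : 0 < 1 / (δ * Real.log 2) := by positivity
    linarith
  have hcδ : 1 ≤ c * (δ * Real.log 2) := by
    rw [hc, add_mul, one_div_mul_cancel (by positivity)]
    have : 0 < δ * Real.log 2 := by positivity
    linarith
  refine ⟨c ^ N, one_le_pow₀ hc1, fun n hn => ?_⟩
  have hlocal : ∀ p ∈ n.primeFactors, ((n.factorization p + 1 : ℕ) : ℝ) ≤
      (if p < N then c else 1) * ((p ^ n.factorization p : ℕ) : ℝ) ^ δ := by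
    intro p hp
    have hp2 : (2 : ℝ) ≤ p := by exact_mod_cast (Nat.prime_of_mem_primeFactors hp).two_le
    generalize n.factorization p = e
    have hrw : ((p ^ e : ℕ) : ℝ) ^ δ = ((p : ℝ) ^ δ) ^ e := by
      push_cast
      rw [← Real.rpow_natCast, ← Real.rpow_mul (by positivity), mul_comm,
        Real.rpow_mul (by positivity), Real.rpow_natCast]
    rw [hrw]
    split_ifs with hpN
    · have h1 : 1 + δ * Real.log 2 ≤ (p : ℝ) ^ δ := by
        have h2 := Real.add_one_le_exp (δ * Real.log 2)
        have h3 : Real.exp (δ * Real.log 2) = (2 : ℝ) ^ δ := by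
          rw [Real.rpow_def_of_pos two_pos, mul_comm]
        have h4 : (2 : ℝ) ^ δ ≤ (p : ℝ) ^ δ := Real.rpow_le_rpow two_pos.le hp2 hδ.le
        linarith
      have h2 := one_add_mul_le_pow (a := δ * Real.log 2) (by nlinarith [mul_pos hδ hl]) e
      have h3 := pow_le_pow_left₀ (by positivity) h1 e
      have h4 : (0 : ℝ) ≤ e := Nat.cast_nonneg e
      push_cast
      calc (e : ℝ) + 1 ≤ c * (1 + e * (δ * Real.log 2)) := by nlinarith
        _ ≤ c * ((p : ℝ) ^ δ) ^ e :=
          mul_le_mul_of_nonneg_left (h2.trans h3) (by linarith)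
    · have h1 : (2 : ℝ) ≤ (p : ℝ) ^ δ := by
        have h2 : (2 : ℝ) ^ (1 / δ) ≤ p := hN.trans (by exact_mod_cast not_lt.1 hpN)
        calc (2 : ℝ) = ((2 : ℝ) ^ (1 / δ)) ^ δ := by
              rw [← Real.rpow_mul two_pos.le, one_div_mul_cancel hδ.ne', Real.rpow_one]
          _ ≤ (p : ℝ) ^ δ := Real.rpow_le_rpow (by positivity) h2 hδ.le
      rw [one_mul]
      calc ((e + 1 : ℕ) : ℝ) ≤ ((2 ^ e : ℕ) : ℝ) := by exact_mod_cast Nat.lt_two_pow_self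
        _ = (2 : ℝ) ^ e := by push_cast; rfl
        _ ≤ ((p : ℝ) ^ δ) ^ e := pow_le_pow_left₀ two_pos.le h1 e
  rw [Nat.card_divisors hn.ne']
  push_cast
  refine (Finset.prod_le_prod (fun p _ => by positivity)
    fun p hp => by exact_mod_cast hlocal p hp).trans ?_
  rw [Finset.prod_mul_distrib, Real.finsetProd_rpow _ _ fun p _ => Nat.cast_nonneg _,
    ← Nat.cast_prod]
  have hprod : ∏ p ∈ n.primeFactors, p ^ n.factorization p = n :=
    Nat.prod_factorization_pow_eq_self hn.ne'
  rw [hprod]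
  refine mul_le_mul_of_nonneg_right ?_ (by positivity)
  rw [Finset.prod_ite, Finset.prod_const, Finset.prod_const_one, mul_one]
  refine pow_le_pow_right₀ hc1 ?_
  have hsub : n.primeFactors.filter (· < N) ⊆ Finset.range N := fun p hp =>
    Finset.mem_range.2 (Finset.mem_filter.1 hp).2
  simpa using Finset.card_le_card hsub

theorem sum_one_div_le {δ : ℝ} (hδ : 0 < δ) {n : ℕ} (hn : 0 < n) :
    ∑ w ∈ Finset.Icc 1 n, (1 : ℝ) / w ≤ (1 + 1 / δ) * (n : ℝ) ^ δ := by
  have hn' : (1 : ℝ) ≤ n := by exact_mod_cast hn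
  have h1 : ∑ w ∈ Finset.Icc 1 n, (1 : ℝ) / w = ((harmonic n : ℚ) : ℝ) := by
    rw [harmonic_eq_sum_Icc]
    push_cast
    simp only [one_div]
  have h2 := Real.log_le_rpow_div (by linarith : (0 : ℝ) ≤ n) hδ
  have h3 := Real.one_le_rpow hn' hδ.le
  rw [h1, add_mul, one_mul, one_div_mul_eq_div]
  linarith [harmonic_le_one_add_log n]

theorem exists_divisorBound {ε : ℝ} (hε : 0 < ε) :
    ∃ C : ℝ, 1 ≤ C ∧ ∀ h : ℤ, 1 ≤ h → DivisorBound (10 ^ 9 * h ^ 40) (C * (h : ℝ) ^ ε) := by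
  have hδ : 0 < ε / 40 := by positivity
  obtain ⟨C, hC, hdiv⟩ := exists_card_divisors_le hδ
  have hpow : ∀ (h : ℤ), 1 ≤ h → ∀ n : ℕ, (n : ℤ) ≤ 10 ^ 9 * h ^ 40 →
      (n : ℝ) ^ (ε / 40) ≤ ((10 : ℝ) ^ 9) ^ (ε / 40) * (h : ℝ) ^ ε := by
    intro h hh n hn
    have hn' : (n : ℝ) ≤ 10 ^ 9 * (h : ℝ) ^ 40 := by exact_mod_cast hn
    have hh' : (0 : ℝ) ≤ h := by exact_mod_cast zero_le_one.trans hh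
    refine (Real.rpow_le_rpow (Nat.cast_nonneg _) hn' hδ.le).trans (le_of_eq ?_)
    rw [Real.mul_rpow (by positivity) (by positivity), ← Real.rpow_natCast (h : ℝ),
      ← Real.rpow_mul hh']
    congr 2
    push_cast
    ring
  have h10 : 1 ≤ ((10 : ℝ) ^ 9) ^ (ε / 40) := Real.one_le_rpow (by norm_num) hδ.le
  have hinv : 0 < 1 + 1 / (ε / 40) := by positivity
  refine ⟨(C + (1 + 1 / (ε / 40))) * ((10 : ℝ) ^ 9) ^ (ε / 40), ?_, fun h hh => ⟨?_, ?_⟩⟩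
  · nlinarith
  · have hhε : 1 ≤ (h : ℝ) ^ ε := Real.one_le_rpow (by exact_mod_cast hh) hε.le
    have : 1 ≤ (C + (1 + 1 / (ε / 40))) * ((10 : ℝ) ^ 9) ^ (ε / 40) := by nlinarith
    nlinarith
  · intro n hn hnM
    have h1 := hpow h hh n hnM
    have h0 : 0 ≤ (n : ℝ) ^ (ε / 40) := by positivity
    rw [mul_assoc]
    constructor
    · refine (hdiv n hn).trans (mul_le_mul ?_ h1 h0 (by positivity))
      linarith
    · refine (sum_one_div_le hδ hn).trans (mul_le_mul ?_ h1 h0 (by positivity))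
      linarith

set_option maxRecDepth 100000 in
theorem alternatingGroup_four_eq_mul_sq :
    ∀ g : alternatingGroup (Fin 4), ∃ a b : alternatingGroup (Fin 4), g = a ^ 2 * b ^ 2 := by
  decide

namespace IntQuartic

open Polynomial

/-- The discriminant. -/
def disc (x : IntQuartic) : ℤ :=
  256 * x.d ^ 3 - 192 * x.a * x.c * x.d ^ 2 - 128 * x.b ^ 2 * x.d ^ 2
    + 144 * x.b * x.c ^ 2 * x.d - 27 * x.c ^ 4 + 144 * x.a ^ 2 * x.b * x.d ^ 2
    - 6 * x.a ^ 2 * x.c ^ 2 * x.d - 80 * x.a * x.b ^ 2 * x.c * x.d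
    + 18 * x.a * x.b * x.c ^ 3 + 16 * x.b ^ 4 * x.d - 4 * x.b ^ 3 * x.c ^ 2
    - 27 * x.a ^ 4 * x.d ^ 2 + 18 * x.a ^ 3 * x.b * x.c * x.d - 4 * x.a ^ 3 * x.c ^ 3
    - 4 * x.a ^ 2 * x.b ^ 3 * x.d + x.a ^ 2 * x.b ^ 2 * x.c ^ 2

theorem disc_eq (x : IntQuartic) : 4 * x.I ^ 3 = x.J ^ 2 + 27 * x.disc := by
  simp only [I, J, disc]
  ring

/-- The associated rational polynomial. -/
noncomputable def toPoly (x : IntQuartic) : ℚ[X] :=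
  X ^ 4 + C (x.a : ℚ) * X ^ 3 + C (x.b : ℚ) * X ^ 2 + C (x.c : ℚ) * X + C (x.d : ℚ)

theorem natDegree_toPoly (x : IntQuartic) : x.toPoly.natDegree = 4 := by
  unfold toPoly
  compute_degree!

theorem monic_toPoly (x : IntQuartic) : x.toPoly.Monic := by
  unfold toPoly
  monicity!

theorem _root_.Polynomial.quartic_coeff_eq {R : Type*} [CommRing R] {a b c d a' b' c' d' : R}
    (h : (X ^ 4 + C a * X ^ 3 + C b * X ^ 2 + C c * X + C d : R[X]) =
      X ^ 4 + C a' * X ^ 3 + C b' * X ^ 2 + C c' * X + C d') :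
    a = a' ∧ b = b' ∧ c = c' ∧ d = d' := by
  have hcoeff := fun k => congrArg (fun p : R[X] => p.coeff k) h
  have h3 := hcoeff 3
  have h2 := hcoeff 2
  have h1 := hcoeff 1
  have h0 := hcoeff 0
  simp [coeff_X, coeff_C] at h3 h2 h1 h0
  exact ⟨h3, h2, h1, h0⟩

variable {L : Type*} [Field L] [Algebra ℚ L]

/-- The discriminant of a separable quartic is the square of the Vandermonde product of its
roots. -/
theorem exists_vandermonde_sq (x : IntQuartic) (hx : x.toPoly.Separable)
    (hsplit : (x.toPoly.map (algebraMap ℚ L)).Splits) :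
    ∃ δ : L, δ ≠ 0 ∧ δ ^ 2 = (x.disc : L) := by
  set f := x.toPoly.map (algebraMap ℚ L) with hf
  have hmonic : f.Monic := x.monic_toPoly.map _
  have hcard : f.roots.card = 4 := by
    rw [← hsplit.natDegree_eq_card_roots, natDegree_map, natDegree_toPoly]
  have hnodup : f.roots.Nodup := nodup_roots hx.map
  have hprod := hsplit.eq_prod_roots_of_monic hmonic
  obtain ⟨r, s, t, u, hroots⟩ := Multiset.card_eq_four.1 hcard
  rw [hroots] at hnodup hprod
  simp only [Multiset.insert_eq_cons, Multiset.nodup_cons, Multiset.mem_cons,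
    Multiset.mem_singleton, not_or, Multiset.nodup_singleton, and_true] at hnodup
  obtain ⟨⟨hrs, hrt, hru⟩, ⟨hst, hsu⟩, htu⟩ := hnodup
  have hexp : f = X ^ 4 + C (-(r + s + t + u)) * X ^ 3 +
      C (r * s + r * t + r * u + s * t + s * u + t * u) * X ^ 2 +
      C (-(r * s * t + r * s * u + r * t * u + s * t * u)) * X + C (r * s * t * u) := by
    rw [hprod]
    simp only [Multiset.insert_eq_cons, Multiset.map_cons, Multiset.map_singleton,
      Multiset.prod_cons, Multiset.prod_singleton, C_neg, C_add, C_mul]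
    ring
  have hfx : f = X ^ 4 + C (x.a : L) * X ^ 3 + C (x.b : L) * X ^ 2 + C (x.c : L) * X +
      C (x.d : L) := by
    simp only [hf, toPoly, Polynomial.map_add, Polynomial.map_mul, Polynomial.map_pow, map_X,
      map_intCast, Polynomial.map_intCast]
  obtain ⟨ha, hb, hc, hd⟩ := quartic_coeff_eq (hfx.symm.trans hexp)
  refine ⟨(r - s) * (r - t) * (r - u) * (s - t) * (s - u) * (t - u), ?_, ?_⟩
  · simp only [ne_eq, mul_eq_zero, sub_eq_zero, not_or]
    exact ⟨⟨⟨⟨⟨hrs, hrt⟩, hru⟩, hst⟩, hsu⟩, htu⟩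
  · simp only [disc]
    push_cast
    rw [ha, hb, hc, hd]
    ring

/-- The discriminant of an irreducible quartic with alternating Galois group is a square. -/
theorem exists_disc_eq_sq (x : IntQuartic) (hx : Irreducible x.toPoly)
    [IsSplittingField ℚ L x.toPoly] (e : Gal(L/ℚ) ≃* alternatingGroup (Fin 4)) :
    ∃ y : ℤ, y ≠ 0 ∧ x.disc = y ^ 2 := by
  obtain ⟨δ, hδ, hδ2⟩ := x.exists_vandermonde_sq (L := L) hx.separable
    (IsSplittingField.splits L x.toPoly)
  have : IsGalois ℚ L := IsGalois.of_separable_splitting_field hx.separable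
  have : FiniteDimensional ℚ L := IsSplittingField.finiteDimensional L x.toPoly
  have hsq : ∀ σ : Gal(L/ℚ), (σ ^ 2) δ = δ := by
    intro σ
    have h1 : (σ δ) ^ 2 = δ ^ 2 := by rw [← map_pow, hδ2, map_intCast]
    rw [sq, AlgEquiv.mul_apply]
    rcases sq_eq_sq_iff_eq_or_eq_neg.1 h1 with h | h
    · rw [h, h]
    · rw [h, map_neg, h, neg_neg]
  have hfix : ∀ σ : Gal(L/ℚ), σ δ = δ := by
    intro σ
    obtain ⟨a, b, hab⟩ := alternatingGroup_four_eq_mul_sq (e σ)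
    have h1 : σ = (e.symm a) ^ 2 * (e.symm b) ^ 2 := by
      rw [← map_pow, ← map_pow, ← map_mul, ← hab, MulEquiv.symm_apply_apply]
    rw [h1, AlgEquiv.mul_apply, hsq, hsq]
  obtain ⟨q, rfl⟩ := (IsGalois.mem_range_algebraMap_iff_fixed δ).2 hfix
  have hq : q ^ 2 = (x.disc : ℚ) := by
    apply (algebraMap ℚ L).injective
    rw [map_pow, hδ2, map_intCast]
  obtain ⟨y, hy⟩ := IsIntegrallyClosed.exists_algebraMap_eq_of_isIntegral_pow (R := ℤ) (x := q)
    two_pos (by rw [hq]; exact isIntegral_algebraMap (x := x.disc))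
  rw [← hy] at hq hδ
  refine ⟨y, ?_, ?_⟩
  · rintro rfl
    simp at hδ
  · simp only [algebraMap_int_eq, eq_intCast] at hq
    exact_mod_cast hq.symm

theorem isGood_of_gal {h : ℤ} {x : IntQuartic} (hbox : x.InBox (h ^ 5))
    (hx : Irreducible x.toPoly) (e : x.toPoly.Gal ≃* alternatingGroup (Fin 4)) : IsGood h x := by
  obtain ⟨y, hy, hdisc⟩ :=
    @exists_disc_eq_sq _ _ _ x hx (IsSplittingField.splittingField x.toPoly) e
  have h1 := x.disc_eq
  rw [hdisc] at h1
  refine ⟨hbox, fun hI => ?_, y, h1⟩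
  rw [hI] at h1
  have h2 : 0 < y ^ 2 := by positivity
  nlinarith [sq_nonneg x.J]

end IntQuartic

theorem quarticGalCount_alternatingGroup_le {h : ℤ} {H K : ℝ} (hH : H ≤ h ^ 5)
    (hK : CardBound (IntQuartic.IsGood h) K) :
    (quarticGalCount (alternatingGroup (Fin 4)) H : ℝ) ≤ K := by
  unfold quarticGalCount
  set A := {p : ℤ × ℤ × ℤ × ℤ |
    |(p.1 : ℝ)| ≤ H ∧ |(p.2.1 : ℝ)| ≤ H ∧ |(p.2.2.1 : ℝ)| ≤ H ∧ |(p.2.2.2 : ℝ)| ≤ H ∧ _}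
  have hle : ∀ n : ℤ, |(n : ℝ)| ≤ H → |n| ≤ h ^ 5 := fun n hn => by
    exact_mod_cast hn.trans hH
  have hbox : ∀ p ∈ A, (⟨p.1, p.2.1, p.2.2.1, p.2.2.2⟩ : IntQuartic).InBox (h ^ 5) :=
    fun p hp => ⟨hle _ hp.1, hle _ hp.2.1, hle _ hp.2.2.1, hle _ hp.2.2.2.1⟩
  have hfin : A.Finite := by
    refine (((Set.finite_Icc (-h ^ 5) (h ^ 5)).prod ((Set.finite_Icc (-h ^ 5) (h ^ 5)).prod
      ((Set.finite_Icc (-h ^ 5) (h ^ 5)).prod (Set.finite_Icc (-h ^ 5) (h ^ 5)))))).subset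
      fun p hp => ?_
    obtain ⟨h1, h2, h3, h4⟩ := hbox p hp
    exact ⟨abs_le.1 h1, abs_le.1 h2, abs_le.1 h3, abs_le.1 h4⟩
  have hA : CardBound (fun p => p ∈ A) K := by
    refine hK.comap (fun p => ⟨p.1, p.2.1, p.2.2.1, p.2.2.2⟩) ?_ ?_
    · rintro ⟨a, b, c, d⟩ ⟨a', b', c', d'⟩ - - he
      simpa using he
    · intro p hp
      obtain ⟨e⟩ := hp.2.2.2.2.2
      exact IntQuartic.isGood_of_gal (hbox p hp) hp.2.2.2.2.1 e
  rw [Set.ncard_eq_toFinset_card A hfin]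
  exact hA _ fun p hp => hfin.mem_toFinset.1 hp

theorem exponent_le : (29 : ℝ) / 10 ≤ 5 / 2 + 1 / Real.sqrt 6 := by
  have h1 : Real.sqrt 6 ≤ 5 / 2 := Real.sqrt_le_iff.2 ⟨by norm_num, by norm_num⟩
  have h2 : 0 < Real.sqrt 6 := Real.sqrt_pos.2 (by norm_num)
  have h3 : (2 : ℝ) / 5 ≤ 1 / Real.sqrt 6 := by
    rw [le_div_iff₀ h2]
    linarith
  linarith

/-- The number of `A₄` quartics is `O(H^(5/2 + 1/√6 + ε))`. -/
theorem A4_upper_bound :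
    ∀ ε : ℝ, 0 < ε → ∃ K : ℝ, 0 < K ∧ ∀ H : ℝ, 2 ≤ H →
      (quarticGalCount (alternatingGroup (Fin 4)) H : ℝ)
        ≤ K * H ^ ((5 : ℝ) / 2 + 1 / Real.sqrt 6 + ε) := by
  intro ε hε
  obtain ⟨C, hC, hD⟩ := exists_divisorBound hε
  have hC0 : 0 < C := zero_lt_one.trans_le hC
  refine ⟨10 ^ 10 * C ^ 3 * 2 ^ (29 / 2 + 3 * ε), by positivity, fun H hH => ?_⟩
  have hH0 : 0 < H := by linarith
  have hroot : 1 ≤ H ^ (1 / 5 : ℝ) := Real.one_le_rpow (by linarith) (by norm_num)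
  set h : ℤ := ⌈H ^ (1 / 5 : ℝ)⌉ with hh
  have hle : H ^ (1 / 5 : ℝ) ≤ h := Int.le_ceil _
  have hle2 : (h : ℝ) ≤ 2 * H ^ (1 / 5 : ℝ) := by
    have := Int.ceil_lt_add_one (H ^ (1 / 5 : ℝ))
    rw [← hh] at this
    linarith
  have hh1 : 1 ≤ h := by exact_mod_cast hroot.trans hle
  have hh0 : (0 : ℝ) < h := by exact_mod_cast zero_lt_one.trans_le hh1
  have hpow : H ≤ (h : ℝ) ^ 5 := by
    calc H = (H ^ (1 / 5 : ℝ)) ^ 5 := by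
          rw [← Real.rpow_natCast, ← Real.rpow_mul hH0.le]
          norm_num
      _ ≤ (h : ℝ) ^ 5 := pow_le_pow_left₀ (by linarith) hle 5
  refine (quarticGalCount_alternatingGroup_le hpow (IntQuartic.card_good hh1 (hD h hh1))).trans ?_
  have hsqrt : √(10 ^ 20 * (C * (h : ℝ) ^ ε) ^ 6 * (h : ℝ) ^ 29) =
      10 ^ 10 * C ^ 3 * (h : ℝ) ^ (29 / 2 + 3 * ε) := by
    rw [Real.sqrt_eq_iff_eq_sq (by positivity) (by positivity), mul_pow, mul_pow, mul_pow,
      ← Real.rpow_natCast ((h : ℝ) ^ (29 / 2 + 3 * ε)), ← Real.rpow_mul hh0.le,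
      ← Real.rpow_natCast ((h : ℝ) ^ ε), ← Real.rpow_mul hh0.le, ← Real.rpow_natCast (h : ℝ) 29,
      show (29 / 2 + 3 * ε) * ((2 : ℕ) : ℝ) = ε * (6 : ℕ) + (29 : ℕ) by push_cast; ring,
      Real.rpow_add hh0]
    ring
  rw [hsqrt, mul_assoc (10 ^ 10 * C ^ 3)]
  refine mul_le_mul_of_nonneg_left ?_ (by positivity)
  calc (h : ℝ) ^ (29 / 2 + 3 * ε) ≤ (2 * H ^ (1 / 5 : ℝ)) ^ (29 / 2 + 3 * ε) :=
        Real.rpow_le_rpow hh0.le hle2 (by positivity)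
    _ = 2 ^ (29 / 2 + 3 * ε) * H ^ (29 / 10 + 3 / 5 * ε) := by
        rw [Real.mul_rpow two_pos.le (by positivity), ← Real.rpow_mul hH0.le]
        congr 2
        ring
    _ ≤ 2 ^ (29 / 2 + 3 * ε) * H ^ ((5 : ℝ) / 2 + 1 / Real.sqrt 6 + ε) := by
        refine mul_le_mul_of_nonneg_left ?_ (by positivity)
        exact Real.rpow_le_rpow_of_exponent_le (by linarith) (by linarith [exponent_le])
end

section
/- There exists a constant C > 0 such that for all real H ≥ 2, the number of integer quintuples (x,a,b,c,d) with |x| ≤ 2H and |a|,|b|,|c|,|d| ≤ H satisfying x³ − b·x² + (ac − 4d)·x − (a²d − 4bd + c²) = 0 is at most C·H²(log H)². -/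
/-- A set of pairs is bounded in size by the sum of bounds for its fibres. -/
lemma finite_and_ncard_le_sum_fibres {α β : Type*} (A : Finset α) (f : α → ℝ)
    (S : Set (α × β)) (hA : ∀ p ∈ S, p.1 ∈ A)
    (hf : ∀ a ∈ A, {b | (a, b) ∈ S}.Finite ∧ ({b | (a, b) ∈ S}.ncard : ℝ) ≤ f a) :
    S.Finite ∧ (S.ncard : ℝ) ≤ ∑ a ∈ A, f a := by
  classical
  have hS : S = ⋃ a ∈ A, Prod.mk a '' {b | (a, b) ∈ S} := by
    ext ⟨a, b⟩
    simp only [Set.mem_iUnion, Set.mem_image, Set.mem_ofPred_eq, Prod.mk.injEq]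
    constructor
    · intro h
      exact ⟨a, hA _ h, b, h, rfl, rfl⟩
    · rintro ⟨a', -, b', h, rfl, rfl⟩
      exact h
  constructor
  · rw [hS]
    exact A.finite_toSet.biUnion fun a ha => (hf a ha).1.image _
  · have h1 : S.ncard ≤ ∑ a ∈ A, (Prod.mk a '' {b | (a, b) ∈ S}).ncard := by
      conv_lhs => rw [hS]
      exact Finset.set_ncard_biUnion_le _ _
    calc (S.ncard : ℝ) ≤ ((∑ a ∈ A, (Prod.mk a '' {b | (a, b) ∈ S}).ncard : ℕ) : ℝ) := by
          exact_mod_cast h1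
      _ = ∑ a ∈ A, ((Prod.mk a '' {b | (a, b) ∈ S}).ncard : ℝ) := by push_cast; rfl
      _ ≤ ∑ a ∈ A, f a := Finset.sum_le_sum fun a ha => by
          refine le_trans ?_ (hf a ha).2
          exact_mod_cast Set.ncard_image_le (hf a ha).1

/-- If a set of pairs has at most `m` first coordinates, and fibres of size at most `n`,
then it has at most `m * n` elements. -/
lemma finite_and_ncard_le_mul {α β : Type*} {m n : ℝ} (hn : 0 ≤ n) (A : Set α)
    (S : Set (α × β)) (hA : A.Finite ∧ (A.ncard : ℝ) ≤ m) (hS : ∀ p ∈ S, p.1 ∈ A)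
    (hf : ∀ a ∈ A, {b | (a, b) ∈ S}.Finite ∧ ({b | (a, b) ∈ S}.ncard : ℝ) ≤ n) :
    S.Finite ∧ (S.ncard : ℝ) ≤ m * n := by
  obtain ⟨h1, h2⟩ := finite_and_ncard_le_sum_fibres hA.1.toFinset (fun _ => n) S
    (by simpa using hS) (by simpa using hf)
  refine ⟨h1, h2.trans ?_⟩
  rw [Finset.sum_const, nsmul_eq_mul, ← Set.ncard_eq_toFinset_card A hA.1]
  exact mul_le_mul_of_nonneg_right hA.2 hn

lemma finite_and_ncard_le_of_subset {α : Type*} {S T : Set α} {m n : ℝ} (h : S ⊆ T)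
    (hT : T.Finite ∧ (T.ncard : ℝ) ≤ m) (hmn : m ≤ n) : S.Finite ∧ (S.ncard : ℝ) ≤ n :=
  ⟨hT.1.subset h,
    (Nat.cast_le.2 (Set.ncard_le_ncard h hT.1)).trans (hT.2.trans hmn)⟩

lemma finite_and_ncard_int_le {t r : ℝ} (hr : 0 ≤ r) :
    {n : ℤ | |(n : ℝ) - t| ≤ r}.Finite ∧ ({n : ℤ | |(n : ℝ) - t| ≤ r}.ncard : ℝ) ≤ 2 * r + 1 := by
  have h : {n : ℤ | |(n : ℝ) - t| ≤ r} = (Finset.Icc ⌈t - r⌉ ⌊t + r⌋ : Finset ℤ) := by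
    ext n
    simp only [Set.mem_ofPred_eq, Finset.coe_Icc, Set.mem_Icc, Int.ceil_le, Int.le_floor, abs_le]
    constructor <;> rintro ⟨h1, h2⟩ <;> constructor <;> linarith
  rw [h, Set.ncard_coe_finset, Int.card_Icc]
  refine ⟨Finset.finite_toSet _, ?_⟩
  have h1 := Int.le_ceil (t - r)
  have h2 := Int.floor_le (t + r)
  have h3 : (((⌊t + r⌋ + 1 - ⌈t - r⌉).toNat : ℤ) : ℝ)
      = ((max (⌊t + r⌋ + 1 - ⌈t - r⌉) 0 : ℤ) : ℝ) := by rw [Int.toNat_eq_max]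
  rw [Int.cast_natCast] at h3
  rw [h3]
  push_cast
  exact max_le (by linarith) (by linarith)

lemma sum_inv_abs_eq (N : ℕ) :
    ∑ n ∈ (Finset.Icc (-(N : ℤ)) N).erase 0, (|(n : ℝ)|)⁻¹ = 2 * (harmonic N : ℝ) := by
  induction N with
  | zero => simp
  | succ N ih =>
    have h : (Finset.Icc (-((N + 1 : ℕ) : ℤ)) ((N + 1 : ℕ) : ℤ)).erase 0
        = insert ((N : ℤ) + 1) (insert (-((N : ℤ) + 1))
          ((Finset.Icc (-(N : ℤ)) N).erase 0)) := by
      ext n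
      simp only [Finset.mem_erase, Finset.mem_Icc, Finset.mem_insert]
      push_cast
      omega
    rw [h, Finset.sum_insert (by simp; omega), Finset.sum_insert (by simp), ih, harmonic_succ]
    have h0 : |(N : ℝ) + 1| = N + 1 := abs_of_nonneg (by positivity)
    push_cast
    rw [abs_neg, h0]
    ring

lemma one_le_two_mul_log {H : ℝ} (hH : 2 ≤ H) : 1 ≤ 2 * Real.log H := by
  have h1 := Real.log_two_gt_d9
  have h2 := Real.log_le_log (by norm_num) hH
  linarith

lemma sum_inv_abs_le {H : ℝ} (hH : 2 ≤ H) :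
    ∑ n ∈ (Finset.Icc (-(⌊10 * H ^ 2⌋₊ : ℤ)) ⌊10 * H ^ 2⌋₊).erase 0, (|(n : ℝ)|)⁻¹
      ≤ 16 * Real.log H := by
  rw [sum_inv_abs_eq]
  have h1 := harmonic_floor_le_one_add_log (10 * H ^ 2) (by nlinarith)
  have h2 : Real.log (10 * H ^ 2) ≤ 6 * Real.log H := by
    have h3 : (16 : ℝ) ≤ H ^ 4 := by
      calc (16 : ℝ) = 2 ^ 4 := by norm_num
        _ ≤ H ^ 4 := by gcongr
    have h4 := Real.log_le_log (x := 10 * H ^ 2) (y := H ^ 6) (by positivity)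
      (by nlinarith [sq_nonneg H])
    rwa [Real.log_pow] at h4
  have := one_le_two_mul_log hH
  linarith

lemma abs_abs_sub_le_div {x m U R : ℝ} (hU : 0 < U) (hm : |m| = U ^ 2)
    (h : |x ^ 2 - m| ≤ R) : |(|x|) - U| ≤ R / U := by
  rw [le_div_iff₀ hU]
  have hx := abs_nonneg x
  rw [← sq_abs x] at h
  obtain ⟨h1, h2⟩ := abs_le.1 h
  rcases abs_cases (|x| - U) with ⟨h3, -⟩ | ⟨h3, -⟩ <;> rw [h3] <;>
    rcases abs_cases m with ⟨h4, -⟩ | ⟨h4, -⟩ <;> nlinarith [sq_nonneg (|x| - U)]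

/-- For fixed `m = g * u ^ 2`, `k = g * v ^ 2`, `l = g * u * v` with `|v| ≤ |u|`, the number of
pairs `(x, a)` with `x ^ 2`, `a ^ 2`, `a * x` close to `m`, `k`, `l`. -/
lemma finite_and_ncard_pairs_le {H U m k l : ℝ} (hH : 2 ≤ H) (hU : 0 < U) (hm : |m| = U ^ 2)
    (hk : |k| ≤ U ^ 2) :
    {p : ℤ × ℤ | |(p.1 : ℝ)| ≤ 2 * H ∧ |(p.1 : ℝ) ^ 2 - m| ≤ 12 * H ∧
      |(p.2 : ℝ) ^ 2 - k| ≤ 12 * H ∧ |(p.2 : ℝ) * p.1 - l| ≤ 12 * H}.Finite ∧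
    ({p : ℤ × ℤ | |(p.1 : ℝ)| ≤ 2 * H ∧ |(p.1 : ℝ) ^ 2 - m| ≤ 12 * H ∧
      |(p.2 : ℝ) ^ 2 - k| ≤ 12 * H ∧ |(p.2 : ℝ) * p.1 - l| ≤ 12 * H}.ncard : ℝ)
      ≤ 3584 * (H ^ 2 / U ^ 2) := by
  have hH0 : 0 < H := by linarith
  by_cases hUH : U ≤ 4 * H
  swap
  · have : {p : ℤ × ℤ | |(p.1 : ℝ)| ≤ 2 * H ∧ |(p.1 : ℝ) ^ 2 - m| ≤ 12 * H ∧
      |(p.2 : ℝ) ^ 2 - k| ≤ 12 * H ∧ |(p.2 : ℝ) * p.1 - l| ≤ 12 * H} = ∅ := by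
      ext ⟨x, a⟩
      simp only [Set.mem_ofPred_eq, Set.mem_empty_iff_false, iff_false]
      rintro ⟨h1, h2, -, -⟩
      have h3 : |m| ≤ (2 * H) ^ 2 + 12 * H := by
        have h4 : (x : ℝ) ^ 2 ≤ (2 * H) ^ 2 := sq_le_sq' (abs_le.1 h1).1 (abs_le.1 h1).2
        obtain ⟨h5, h6⟩ := abs_le.1 h2
        exact abs_le.2 ⟨by nlinarith, by nlinarith⟩
      nlinarith
    rw [this]
    exact ⟨Set.finite_empty, by simp; positivity⟩
  have h1U : 1 ≤ 4 * (H / U) := by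
    rw [← mul_div_assoc, le_div_iff₀ hU]
    linarith
  have hHU : 0 ≤ H / U := by positivity
  have hA : {x : ℤ | |(|(x : ℝ)|) - U| ≤ 12 * H / U}.Finite ∧
      ({x : ℤ | |(|(x : ℝ)|) - U| ≤ 12 * H / U}.ncard : ℝ) ≤ 56 * (H / U) := by
    have h1 := finite_and_ncard_int_le (t := U) (r := 12 * H / U) (by positivity)
    have h2 := finite_and_ncard_int_le (t := -U) (r := 12 * H / U) (by positivity)
    refine finite_and_ncard_le_of_subset
      (T := {x : ℤ | |(x : ℝ) - U| ≤ 12 * H / U} ∪ {x : ℤ | |(x : ℝ) - -U| ≤ 12 * H / U})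
      ?_ ⟨h1.1.union h2.1, (Nat.cast_le.2 (Set.ncard_union_le _ _)).trans
        (by push_cast; exact add_le_add h1.2 h2.2)⟩ ?_
    · intro x hx
      simp only [Set.mem_ofPred_eq, Set.mem_union] at hx ⊢
      rcases abs_cases (x : ℝ) with ⟨h, -⟩ | ⟨h, -⟩ <;> rw [h] at hx
      · exact Or.inl hx
      · right
        rw [abs_sub_comm] at hx
        convert hx using 2
        ring
    · rw [mul_div_assoc]
      linarith
  have key := finite_and_ncard_le_mul (n := 64 * (H / U)) (by positivity) _
    {p : ℤ × ℤ | |(p.1 : ℝ)| ≤ 2 * H ∧ |(p.1 : ℝ) ^ 2 - m| ≤ 12 * H ∧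
      |(p.2 : ℝ) ^ 2 - k| ≤ 12 * H ∧ |(p.2 : ℝ) * p.1 - l| ≤ 12 * H} hA
    (fun p hp => abs_abs_sub_le_div hU hm hp.2.1) ?_
  · refine ⟨key.1, key.2.trans (le_of_eq ?_)⟩
    field_simp
    norm_num
  intro x hx
  simp only [Set.mem_ofPred_eq] at hx ⊢
  by_cases hxU : U / 2 ≤ |(x : ℝ)|
  · have hx0 : 0 < |(x : ℝ)| := by linarith
    refine finite_and_ncard_le_of_subset ?_
      (finite_and_ncard_int_le (t := l / x) (r := 24 * (H / U)) (by positivity)) (by linarith)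
    rintro a ⟨-, -, -, h⟩
    simp only [Set.mem_ofPred_eq]
    have h1 : (a : ℝ) - l / x = (a * x - l) / x := by
      field_simp [abs_pos.1 hx0]
    rw [h1, abs_div, div_le_iff₀ hx0]
    calc |(a : ℝ) * x - l| ≤ 12 * H := h
      _ = 24 * (H / U) * (U / 2) := by field_simp; norm_num
      _ ≤ _ := by gcongr
  · refine finite_and_ncard_le_of_subset ?_
      (finite_and_ncard_int_le (t := 0) (r := 30 * (H / U)) (by positivity)) (by linarith)
    rintro a ⟨-, -, h, -⟩
    simp only [Set.mem_ofPred_eq, sub_zero]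
    have h2 : U ^ 2 ≤ 24 * H := by
      rw [le_div_iff₀ hU] at hx
      have := neg_abs_le (|(x : ℝ)| - U)
      nlinarith
    have h3 : (a : ℝ) ^ 2 ≤ 36 * H := by
      linarith [(abs_le.1 h).2, le_abs_self k]
    rw [← mul_div_assoc, le_div_iff₀ hU]
    refine abs_le_of_sq_le_sq' ?_ (by positivity) |>.2
    rw [mul_pow, sq_abs]
    nlinarith [mul_le_mul h3 h2 (by positivity) (by positivity)]

/-- Parameters `((g, u), v, x, a)` with `x ^ 2`, `a ^ 2`, `a * x` close to `g * u ^ 2`,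
`g * v ^ 2`, `g * u * v`, where `|v| ≤ |u|`. -/
def nearSquareParams (H : ℝ) : Set ((ℤ × ℤ) × ℤ × ℤ × ℤ) :=
  {p | p.1.1 ≠ 0 ∧ p.1.2 ≠ 0 ∧ |p.2.1| ≤ |p.1.2| ∧ |(p.2.2.1 : ℝ)| ≤ 2 * H ∧
    |(p.2.2.1 : ℝ) ^ 2 - p.1.1 * p.1.2 ^ 2| ≤ 12 * H ∧
    |(p.2.2.2 : ℝ) ^ 2 - p.1.1 * p.2.1 ^ 2| ≤ 12 * H ∧
    |(p.2.2.2 : ℝ) * p.2.2.1 - p.1.1 * p.1.2 * p.2.1| ≤ 12 * H}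

lemma finite_and_ncard_nearSquareParams_le {H : ℝ} (hH : 2 ≤ H) :
    (nearSquareParams H).Finite ∧
      ((nearSquareParams H).ncard : ℝ) ≤ 2752512 * H ^ 2 * Real.log H ^ 2 := by
  set I : Finset ℤ := (Finset.Icc (-(⌊10 * H ^ 2⌋₊ : ℤ)) ⌊10 * H ^ 2⌋₊).erase 0 with hI
  have mem_I (n : ℤ) (hn : n ≠ 0) (h : |(n : ℝ)| ≤ 10 * H ^ 2) : n ∈ I := by
    have h1 : n.natAbs ≤ ⌊10 * H ^ 2⌋₊ := Nat.le_floor (by rwa [Nat.cast_natAbs, Int.cast_abs])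
    rw [hI, Finset.mem_erase, Finset.mem_Icc]
    exact ⟨hn, by omega, by omega⟩
  have key := finite_and_ncard_le_sum_fibres (I ×ˢ I)
    (fun q => 10752 * H ^ 2 * ((|(q.1 : ℝ)|)⁻¹ * (|(q.2 : ℝ)|)⁻¹)) (nearSquareParams H) ?_ ?_
  · refine ⟨key.1, key.2.trans ?_⟩
    rw [← Finset.mul_sum, Finset.sum_product]
    simp only [← Finset.sum_mul_sum]
    have h1 := sum_inv_abs_le hH
    have h0 : 0 ≤ ∑ n ∈ I, (|(n : ℝ)|)⁻¹ := Finset.sum_nonneg fun _ _ => by positivity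
    calc _ ≤ 10752 * H ^ 2 * ((16 * Real.log H) * (16 * Real.log H)) := by
          gcongr
          exact h0.trans h1
      _ = _ := by ring
  · rintro ⟨⟨g, u⟩, v, x, a⟩ ⟨hg, hu, -, hx, h, -, -⟩
    simp only at hg hu hx h
    have hg1 : (1 : ℝ) ≤ |(g : ℝ)| := by exact_mod_cast Int.one_le_abs hg
    have hu1 : (1 : ℝ) ≤ |(u : ℝ)| := by exact_mod_cast Int.one_le_abs hu
    have hgu : |(g : ℝ)| * |(u : ℝ)| ^ 2 ≤ 10 * H ^ 2 := by
      rw [← abs_pow, ← abs_mul]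
      have h4 : (x : ℝ) ^ 2 ≤ (2 * H) ^ 2 := sq_le_sq' (abs_le.1 hx).1 (abs_le.1 hx).2
      obtain ⟨h5, h6⟩ := abs_le.1 h
      exact abs_le.2 ⟨by nlinarith, by nlinarith⟩
    have hu2 : |(u : ℝ)| ≤ |(u : ℝ)| ^ 2 := by nlinarith
    rw [Finset.mem_product]
    exact ⟨mem_I g hg (by nlinarith), mem_I u hu (by nlinarith)⟩
  · rintro ⟨g, u⟩ hgu
    obtain ⟨hg, hu⟩ := Finset.mem_product.1 hgu
    replace hg : g ≠ 0 := (Finset.mem_erase.1 hg).1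
    replace hu : u ≠ 0 := (Finset.mem_erase.1 hu).1
    have hg1 : (1 : ℝ) ≤ |(g : ℝ)| := by exact_mod_cast Int.one_le_abs hg
    have hu1 : (1 : ℝ) ≤ |(u : ℝ)| := by exact_mod_cast Int.one_le_abs hu
    have hU : (√|(g : ℝ)| * |(u : ℝ)|) ^ 2 = |(g : ℝ)| * |(u : ℝ)| ^ 2 := by
      rw [mul_pow, Real.sq_sqrt (abs_nonneg _)]
    refine finite_and_ncard_le_of_subset subset_rfl (finite_and_ncard_le_mul
      (m := 3 * |(u : ℝ)|) (n := 3584 * (H ^ 2 / (√|(g : ℝ)| * |(u : ℝ)|) ^ 2)) (by positivity)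
      {v : ℤ | |(v : ℝ) - 0| ≤ |(u : ℝ)|} _ ?_ ?_ ?_) ?_
    · obtain ⟨h1, h2⟩ := finite_and_ncard_int_le (t := 0) (abs_nonneg (u : ℝ))
      exact ⟨h1, by linarith⟩
    · rintro ⟨v, x, a⟩ ⟨-, -, hv, -⟩
      simp only [Set.mem_ofPred_eq, sub_zero]
      exact_mod_cast hv
    · intro v hv
      simp only [Set.mem_ofPred_eq, sub_zero] at hv
      refine finite_and_ncard_le_of_subset ?_ (finite_and_ncard_pairs_le
        (m := g * u ^ 2) (k := g * v ^ 2) (l := g * u * v) hH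
        (mul_pos (Real.sqrt_pos.2 (by linarith)) (by linarith)) ?_ ?_) le_rfl
      · rintro ⟨x, a⟩ ⟨-, -, -, h⟩
        exact h
      · rw [hU, abs_mul, abs_pow]
      · rw [hU, abs_mul, abs_pow]
        gcongr
    · rw [hU]
      apply le_of_eq
      field_simp
      norm_num

/-- Triples `(x, a, e)` with `|a * x| ≤ 2 * H`. -/
def smallProductTriples (H : ℝ) : Set (ℤ × ℤ × ℤ) :=
  {p | |(p.1 : ℝ)| ≤ 2 * H ∧ |(p.2.1 : ℝ)| ≤ H ∧ |(p.2.1 : ℝ) * p.1| ≤ 2 * H ∧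
    |(p.2.2 : ℝ)| ≤ H}

lemma finite_and_ncard_smallProductTriples_le {H : ℝ} (hH : 2 ≤ H) :
    (smallProductTriples H).Finite ∧
      ((smallProductTriples H).ncard : ℝ) ≤ 612 * H ^ 2 * Real.log H ^ 2 := by
  set J : Finset ℤ := Finset.Icc (-(⌊10 * H ^ 2⌋₊ : ℤ)) ⌊10 * H ^ 2⌋₊ with hJ
  have he : {e : ℤ | |(e : ℝ) - 0| ≤ H}.Finite ∧
      ({e : ℤ | |(e : ℝ) - 0| ≤ H}.ncard : ℝ) ≤ 3 * H := by
    obtain ⟨h1, h2⟩ := finite_and_ncard_int_le (t := 0) (r := H) (by linarith)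
    exact ⟨h1, by linarith⟩
  have key := finite_and_ncard_le_sum_fibres (J.filter fun x : ℤ => |(x : ℝ)| ≤ 2 * H)
    (fun x => if x = 0 then 9 * H ^ 2 else 18 * H ^ 2 * (|(x : ℝ)|)⁻¹)
    (smallProductTriples H) ?_ ?_
  · refine ⟨key.1, key.2.trans ?_⟩
    refine (Finset.sum_le_sum_of_subset_of_nonneg (Finset.filter_subset _ J)
      fun x _ _ => by split_ifs <;> positivity).trans ?_
    rw [← Finset.add_sum_erase J _ (a := 0) (by simp [hJ]), if_pos rfl,
      Finset.sum_congr rfl fun x hx => if_neg (Finset.mem_erase.1 hx).1, ← Finset.mul_sum]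
    have h1 := sum_inv_abs_le hH
    have h2 := one_le_two_mul_log hH
    calc _ ≤ 9 * H ^ 2 + 18 * H ^ 2 * (16 * Real.log H) := by gcongr
      _ = H ^ 2 * (9 + 288 * Real.log H) := by ring
      _ ≤ H ^ 2 * (612 * Real.log H ^ 2) := by gcongr; nlinarith
      _ = _ := by ring
  · rintro ⟨x, a, e⟩ ⟨hx, -⟩
    simp only at hx
    have h1 : x.natAbs ≤ ⌊10 * H ^ 2⌋₊ := Nat.le_floor (by
      rw [Nat.cast_natAbs, Int.cast_abs]
      nlinarith)
    rw [Finset.mem_filter, hJ, Finset.mem_Icc]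
    exact ⟨by constructor <;> dsimp only <;> omega, hx⟩
  · intro x hx
    have hx2 := (Finset.mem_filter.1 hx).2
    split_ifs with hx0
    · refine finite_and_ncard_le_of_subset subset_rfl (finite_and_ncard_le_mul
        (m := 3 * H) (n := 3 * H) (by linarith) {e : ℤ | |(e : ℝ) - 0| ≤ H} _ he ?_ ?_) ?_
      · rintro ⟨a, e⟩ ⟨-, ha, -⟩
        simpa using ha
      · intro a _
        refine finite_and_ncard_le_of_subset ?_ he le_rfl
        rintro e ⟨-, -, -, h⟩
        simpa using h
      · linarith
    · have hx1 : 0 < |(x : ℝ)| := by positivity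
      refine finite_and_ncard_le_of_subset subset_rfl (finite_and_ncard_le_mul
        (m := 6 * (H / |(x : ℝ)|)) (n := 3 * H) (by linarith)
        {a : ℤ | |(a : ℝ) - 0| ≤ 2 * (H / |(x : ℝ)|)} _ ?_ ?_ ?_) ?_
      · obtain ⟨h1, h2⟩ := finite_and_ncard_int_le (t := 0) (r := 2 * (H / |(x : ℝ)|))
          (by positivity)
        refine ⟨h1, h2.trans ?_⟩
        have : 1 ≤ 2 * (H / |(x : ℝ)|) := by
          rw [← mul_div_assoc, le_div_iff₀ hx1]
          linarith
        linarith
      · rintro ⟨a, e⟩ ⟨-, -, h, -⟩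
        simp only [Set.mem_ofPred_eq, sub_zero]
        rw [← mul_div_assoc, le_div_iff₀ hx1, ← abs_mul]
        exact h
      · intro a _
        refine finite_and_ncard_le_of_subset ?_ he le_rfl
        rintro e ⟨-, -, -, h⟩
        simpa using h
      · apply le_of_eq
        field_simp
        norm_num

/-- Two nonzero integers with square product are square multiples of a common integer. -/
lemma exists_common_factor_of_mul_eq_sq {D E F : ℤ} (hD : D ≠ 0) (h : D * E = F ^ 2) :
    ∃ g u v : ℤ, D = g * u ^ 2 ∧ E = g * v ^ 2 ∧ F = g * u * v := by
  have h0 : 0 < Int.gcd D F := Int.gcd_pos_of_ne_zero_left _ hD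
  obtain ⟨k, p, q, hk, hpq, hp, hq⟩ := Int.exists_gcd_one' h0
  subst hp hq
  have hk0 : (k : ℤ) ≠ 0 := by positivity
  have hp0 : p ≠ 0 := left_ne_zero_of_mul hD
  have h1 : p * E = k * q ^ 2 := by
    apply mul_left_cancel₀ hk0
    linear_combination h
  have hc : IsCoprime p (q ^ 2) := (Int.isCoprime_iff_gcd_eq_one.2 hpq).pow_right
  obtain ⟨g, hg⟩ : p ∣ (k : ℤ) := hc.dvd_of_dvd_mul_right ⟨E, h1.symm⟩
  refine ⟨g, p, q, by rw [hg]; ring, ?_, by rw [hg]; ring⟩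
  apply mul_left_cancel₀ hp0
  rw [h1, hg]
  ring


/-- The number of integer quintuples `(x,a,b,c,d)` with `|x| ≤ 2H`, `|a|,|b|,|c|,|d| ≤ H`
such that `x` is a root of the cubic resolvent of `X⁴ + aX³ + bX² + cX + d` is
`O(H² (log H)²)`. -/
theorem resolvent_root_count :
    ∃ K : ℝ, 0 < K ∧ ∀ H : ℝ, 2 ≤ H →
      (Set.ncard {q : ℤ × ℤ × ℤ × ℤ × ℤ |
          |(q.1 : ℝ)| ≤ 2 * H ∧ |(q.2.1 : ℝ)| ≤ H ∧ |(q.2.2.1 : ℝ)| ≤ H ∧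
          |(q.2.2.2.1 : ℝ)| ≤ H ∧ |(q.2.2.2.2 : ℝ)| ≤ H ∧
          q.1 ^ 3 - q.2.2.1 * q.1 ^ 2 + (q.2.1 * q.2.2.2.1 - 4 * q.2.2.2.2) * q.1
            - (q.2.1 ^ 2 * q.2.2.2.2 - 4 * q.2.2.1 * q.2.2.2.2 + q.2.2.2.1 ^ 2) = 0} : ℝ)
        ≤ K * H ^ 2 * (Real.log H) ^ 2 := by
  refine ⟨2 * 2752512 + 2 * 612, by norm_num, fun H hH => ?_⟩
  obtain ⟨hT, hTc⟩ := finite_and_ncard_nearSquareParams_le hH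
  obtain ⟨hP, hPc⟩ := finite_and_ncard_smallProductTriples_le hH
  let f₁ : (ℤ × ℤ) × ℤ × ℤ × ℤ → ℤ × ℤ × ℤ × ℤ × ℤ := fun ⟨⟨g, u⟩, v, x, a⟩ =>
    (x, a, (a ^ 2 + 4 * x - g * v ^ 2) / 4, (a * x - g * u * v) / 2, (x ^ 2 - g * u ^ 2) / 4)
  let f₂ : (ℤ × ℤ) × ℤ × ℤ × ℤ → ℤ × ℤ × ℤ × ℤ × ℤ := fun ⟨⟨g, v⟩, u, a, x⟩ =>
    (x, a, (a ^ 2 + 4 * x - g * v ^ 2) / 4, (a * x - g * u * v) / 2, (x ^ 2 - g * u ^ 2) / 4)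
  let f₃ : ℤ × ℤ × ℤ → ℤ × ℤ × ℤ × ℤ × ℤ := fun ⟨x, a, b⟩ => (x, a, b, a * x / 2, x ^ 2 / 4)
  let f₄ : ℤ × ℤ × ℤ → ℤ × ℤ × ℤ × ℤ × ℤ := fun ⟨x, a, d⟩ =>
    (x, a, (a ^ 2 + 4 * x) / 4, a * x / 2, d)
  refine (Nat.cast_le.2 (Set.ncard_le_ncard (t := (f₁ '' nearSquareParams H ∪
    f₂ '' nearSquareParams H) ∪ (f₃ '' smallProductTriples H ∪ f₄ '' smallProductTriples H))
    ?_ (((hT.image _).union (hT.image _)).union ((hP.image _).union (hP.image _))))).trans ?_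
  swap
  · have hf₁ : ((f₁ '' nearSquareParams H).ncard : ℝ) ≤ (nearSquareParams H).ncard :=
      Nat.cast_le.2 (Set.ncard_image_le hT)
    have hf₂ : ((f₂ '' nearSquareParams H).ncard : ℝ) ≤ (nearSquareParams H).ncard :=
      Nat.cast_le.2 (Set.ncard_image_le hT)
    have hf₃ : ((f₃ '' smallProductTriples H).ncard : ℝ) ≤ (smallProductTriples H).ncard :=
      Nat.cast_le.2 (Set.ncard_image_le hP)
    have hf₄ : ((f₄ '' smallProductTriples H).ncard : ℝ) ≤ (smallProductTriples H).ncard :=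
      Nat.cast_le.2 (Set.ncard_image_le hP)
    have h₁ := Set.ncard_union_le (f₁ '' nearSquareParams H) (f₂ '' nearSquareParams H)
    have h₂ := Set.ncard_union_le (f₃ '' smallProductTriples H) (f₄ '' smallProductTriples H)
    refine (Nat.cast_le.2 ((Set.ncard_union_le _ _).trans (add_le_add h₁ h₂))).trans ?_
    push_cast
    linarith
  rintro ⟨x, a, b, c, d⟩ ⟨hx, ha, hb, hc, hd, h⟩
  simp only at hx ha hb hc hd h
  have hDE : (x ^ 2 - 4 * d) * (a ^ 2 + 4 * x - 4 * b) = (a * x - 2 * c) ^ 2 := by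
    linear_combination 4 * h
  have hprod (h0 : a * x = 2 * c) : |(a : ℝ) * x| ≤ 2 * H := by
    have : (a : ℝ) * x = 2 * c := by exact_mod_cast h0
    rw [this, abs_mul, abs_two]
    linarith
  by_cases hD : x ^ 2 - 4 * d = 0
  · have hF : a * x = 2 * c := by
      rw [hD, zero_mul] at hDE
      linarith [pow_eq_zero_iff two_ne_zero |>.1 hDE.symm]
    refine Or.inr (Or.inl ⟨(x, a, b), ⟨hx, ha, hprod hF, hb⟩, ?_⟩)
    simp only [f₃, Prod.mk.injEq, true_and]
    constructor <;> omega
  by_cases hE : a ^ 2 + 4 * x - 4 * b = 0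
  · have hF : a * x = 2 * c := by
      rw [hE, mul_zero] at hDE
      linarith [pow_eq_zero_iff two_ne_zero |>.1 hDE.symm]
    refine Or.inr (Or.inr ⟨(x, a, d), ⟨hx, ha, hprod hF, hd⟩, ?_⟩)
    simp only [f₄, Prod.mk.injEq, true_and, and_true]
    constructor <;> omega
  obtain ⟨g, u, v, hgu, hgv, hguv⟩ := exists_common_factor_of_mul_eq_sq hD hDE
  have hg : g ≠ 0 := by
    rintro rfl
    exact hD (by rw [hgu]; ring)
  have hu : u ≠ 0 := by
    rintro rfl
    exact hD (by rw [hgu]; ring)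
  have hv : v ≠ 0 := by
    rintro rfl
    exact hE (by rw [hgv]; ring)
  rw [abs_le] at hb hc hd
  have hx' := abs_le.1 hx
  have bound_x : |(x : ℝ) ^ 2 - g * u ^ 2| ≤ 12 * H := by
    have : (x : ℝ) ^ 2 - 4 * d = g * u ^ 2 := by exact_mod_cast hgu
    exact abs_le.2 ⟨by linarith, by linarith⟩
  have bound_a : |(a : ℝ) ^ 2 - g * v ^ 2| ≤ 12 * H := by
    have : (a : ℝ) ^ 2 + 4 * x - 4 * b = g * v ^ 2 := by exact_mod_cast hgv
    exact abs_le.2 ⟨by linarith, by linarith⟩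
  have bound_ax : |(a : ℝ) * x - g * u * v| ≤ 12 * H := by
    have : (a : ℝ) * x - 2 * c = g * u * v := by exact_mod_cast hguv
    exact abs_le.2 ⟨by linarith, by linarith⟩
  left
  rcases le_total |v| |u| with hvu | huv
  · refine Or.inl ⟨((g, u), v, x, a), ⟨hg, hu, hvu, hx, bound_x, bound_a, bound_ax⟩, ?_⟩
    simp only [f₁, Prod.mk.injEq, true_and]
    refine ⟨?_, ?_, ?_⟩ <;> omega
  · refine Or.inr ⟨((g, v), u, a, x), ⟨hg, hv, huv, ?_, bound_a, bound_x, ?_⟩, ?_⟩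
    · show |(a : ℝ)| ≤ 2 * H
      linarith
    · show |(x : ℝ) * a - g * v * u| ≤ 12 * H
      rwa [mul_comm (x : ℝ), mul_right_comm]
    · simp only [f₂, Prod.mk.injEq, true_and]
      refine ⟨?_, ?_, ?_⟩ <;> omega
end
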